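/- arXiv:0912.2442 — 3 statements merged into one kernel-verified Lean document; each statement's English description precedes it below -/
import Mathlib

section
/- Let Θ be the 3×1 real matrix (column) with entries θ₁, θ₂, θ₃, where 1, θ₁, θ₂, θ₃ are linearly independent over ℚ. Then β(Θ) ≥ α(Θ)·g₁(α(Θ)). -/
open Filter
open scoped ENNReal

/-- Distance from a real number to the nearest integer. -/
noncomputable def nid (x : ℝ) : ℝ := |x - round x|

/-- Sup-norm height `M(x) = max_i |x_i|` of an integer vector. -/
def heightM {m : ℕ} (x : Fin m → ℤ) : ℕ := Finset.univ.sup fun i => (x i).natAbs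

/-- `ψ_Θ(t) = min { max_j ‖L_j(x)‖ : x ∈ ℤ^m, 0 < M(x) ≤ t }`, valued in `ℝ≥0∞`
(the infimum over the empty family is `⊤`). -/
noncomputable def psiFn {n m : ℕ} (Θ : Matrix (Fin n) (Fin m) ℝ) (t : ℝ) : ℝ≥0∞ :=
  ⨅ (x : Fin m → ℤ) (_ : x ≠ 0) (_ : (heightM x : ℝ) ≤ t),
    ENNReal.ofReal (⨆ j : Fin n, nid (∑ i, Θ j i * (x i : ℝ)))

/-- The set `{γ > 0 : limsup_{t→∞} t^γ ψ_Θ(t) < ∞}`. -/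
noncomputable def uniformExps {n m : ℕ} (Θ : Matrix (Fin n) (Fin m) ℝ) : Set ℝ :=
  {γ : ℝ | 0 < γ ∧ limsup (fun t : ℝ => ENNReal.ofReal (t ^ γ) * psiFn Θ t) atTop < ⊤}

/-- The set `{γ > 0 : liminf_{t→∞} t^γ ψ_Θ(t) < ∞}`. -/
noncomputable def individualExps {n m : ℕ} (Θ : Matrix (Fin n) (Fin m) ℝ) : Set ℝ :=
  {γ : ℝ | 0 < γ ∧ liminf (fun t : ℝ => ENNReal.ofReal (t ^ γ) * psiFn Θ t) atTop < ⊤}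

/-- The uniform Diophantine exponent `α(Θ)`, valued in `ℝ≥0∞`. -/
noncomputable def alphaExp {n m : ℕ} (Θ : Matrix (Fin n) (Fin m) ℝ) : ℝ≥0∞ :=
  sSup (ENNReal.ofReal '' uniformExps Θ)

/-- The individual Diophantine exponent `β(Θ)`, valued in `ℝ≥0∞`. -/
noncomputable def betaExp {n m : ℕ} (Θ : Matrix (Fin n) (Fin m) ℝ) : ℝ≥0∞ :=
  sSup (ENNReal.ofReal '' individualExps Θ)

/-- `g₁(α) = (α(1−α) + √(α²(1−α)² + 4α(2α²−2α+1))) / (2(2α²−2α+1))`. -/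
noncomputable def g1 (α : ℝ) : ℝ :=
  (α * (1 - α) + Real.sqrt (α ^ 2 * (1 - α) ^ 2 + 4 * α * (2 * α ^ 2 - 2 * α + 1))) /
    (2 * (2 * α ^ 2 - 2 * α + 1))


namespace JM

noncomputable def EE (θ : Fin 3 → ℝ) (z : Fin 4 → ℤ) : Fin 3 → ℝ :=
  fun j => (z 0 : ℝ) * θ j - (z j.succ : ℝ)

noncomputable def ff (θ : Fin 3 → ℝ) (q : ℕ) : ℝ :=
  ‖fun j => (q : ℝ) * θ j - (round ((q : ℝ) * θ j) : ℝ)‖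

noncomputable def ZZ (θ : Fin 3 → ℝ) (q : ℕ) : Fin 4 → ℤ :=
  Fin.cons (q : ℤ) (fun j => round ((q : ℝ) * θ j))

noncomputable def ZQ (θ : Fin 3 → ℝ) (q : ℕ) : Fin 4 → ℚ := fun i => (ZZ θ q i : ℚ)

noncomputable def MM (θ : Fin 3 → ℝ) (z w : Fin 4 → ℤ) : Fin 3 → ℝ :=
  (z 0 : ℝ) • EE θ w - (w 0 : ℝ) • EE θ z

structure BA (θ : Fin 3 → ℝ) (X : ℕ → ℕ) : Prop where
  one_le : ∀ i, 1 ≤ X i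
  lt : ∀ i, X i < X (i + 1)
  pos : ∀ i, 0 < ff θ (X i)
  anti : ∀ i, ff θ (X (i + 1)) < ff θ (X i)
  best : ∀ i q, 1 ≤ q → q < X (i + 1) → ff θ (X i) ≤ ff θ q

lemma norm_EE_ZZ (θ : Fin 3 → ℝ) (q : ℕ) : ‖EE θ (ZZ θ q)‖ = ff θ q := by
  unfold ff
  congr 1

lemma ZZ_zero (θ : Fin 3 → ℝ) (q : ℕ) : ZZ θ q 0 = q := by simp [ZZ]

lemma ff_le_half (θ : Fin 3 → ℝ) (q : ℕ) : ff θ q ≤ 1 / 2 := by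
  unfold ff
  rw [pi_norm_le_iff_of_nonneg (by norm_num)]
  intro j
  exact abs_sub_round _

lemma ff_le_norm_EE (θ : Fin 3 → ℝ) (z : Fin 4 → ℤ) : ff θ (z 0).natAbs ≤ ‖EE θ z‖ := by
  unfold ff
  rw [pi_norm_le_iff_of_nonneg (norm_nonneg _)]
  intro j
  have h1 : ‖EE θ z j‖ ≤ ‖EE θ z‖ := norm_le_pi_norm _ j
  refine le_trans ?_ h1
  simp only [EE, Real.norm_eq_abs]
  rcases Int.natAbs_eq (z 0) with h | h
  · have h2 : ((z 0 : ℤ) : ℝ) = (((z 0).natAbs : ℕ) : ℝ) := by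
      rw [← Int.cast_natCast, ← h]
    rw [h2]
    exact round_le _ _
  · have h2 : ((z 0 : ℤ) : ℝ) = -(((z 0).natAbs : ℕ) : ℝ) := by exact_mod_cast h
    rw [h2]
    have := round_le ((((z 0).natAbs : ℕ) : ℝ) * θ j) (-(z j.succ))
    refine this.trans (le_of_eq ?_)
    rw [← abs_neg]
    congr 1
    push_cast
    ring

/-- lower bound for consecutive minors -/
lemma MM_lower {θ : Fin 3 → ℝ} {X : ℕ → ℕ} (h : BA θ X) (i : ℕ) :
    (X (i + 1) : ℝ) * ff θ (X i) / 2 ≤ ‖MM θ (ZZ θ (X i)) (ZZ θ (X (i + 1)))‖ := by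
  set z := ZZ θ (X i) with hz
  set w := ZZ θ (X (i + 1)) with hw
  have hz0 : (z 0 : ℝ) = X i := by rw [hz, ZZ_zero]; simp
  have hw0 : (w 0 : ℝ) = X (i + 1) := by rw [hw, ZZ_zero]; simp
  have hez : ‖EE θ z‖ = ff θ (X i) := norm_EE_ZZ _ _
  have hew : ‖EE θ w‖ = ff θ (X (i + 1)) := norm_EE_ZZ _ _
  have hlt : (X i : ℝ) < X (i + 1) := by exact_mod_cast h.lt i
  have hanti := h.anti i
  have hpos := h.pos i
  have hX : (1 : ℝ) ≤ X i := by exact_mod_cast h.one_le i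
  by_cases hc : (X i : ℝ) ≤ X (i + 1) / 2
  · have h1 : ‖(w 0 : ℝ) • EE θ z‖ - ‖(z 0 : ℝ) • EE θ w‖ ≤ ‖MM θ z w‖ := by
      unfold MM
      rw [norm_sub_rev]
      exact norm_sub_norm_le _ _
    rw [norm_smul, norm_smul, hz0, hw0, hez, hew, Real.norm_of_nonneg (by positivity),
      Real.norm_of_nonneg (by positivity)] at h1
    have hp2 := (h.pos (i + 1)).le
    nlinarith [mul_le_mul hc hanti.le hp2 (by positivity : (0 : ℝ) ≤ X (i + 1) / 2)]
  · push Not at hc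
    have hd : ff θ (X i) ≤ ‖EE θ w - EE θ z‖ := by
      have e1 : EE θ w - EE θ z = EE θ (w - z) := by
        ext j; simp [EE]; ring
      rw [e1]
      refine le_trans ?_ (ff_le_norm_EE θ (w - z))
      have : ((w - z) 0).natAbs = X (i + 1) - X i := by
        have := h.lt i
        simp only [Pi.sub_apply, hz, hw, ZZ_zero]; omega
      rw [this]
      have := h.lt i
      have := h.one_le i
      exact h.best i _ (by omega) (by omega)
    have e2 : MM θ z w = ((w 0 : ℝ) - z 0) • (-EE θ w) + (w 0 : ℝ) • (EE θ w - EE θ z) := by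
      ext j; simp [MM]; ring
    have h1 : ‖(w 0 : ℝ) • (EE θ w - EE θ z)‖ - ‖((w 0 : ℝ) - z 0) • (EE θ w)‖ ≤ ‖MM θ z w‖ := by
      rw [e2]
      have := norm_sub_norm_le ((w 0 : ℝ) • (EE θ w - EE θ z)) (((w 0 : ℝ) - z 0) • (EE θ w))
      refine this.trans (le_of_eq ?_)
      congr 1
      rw [smul_neg]; abel
    rw [norm_smul, norm_smul, hz0, hw0, hew, Real.norm_of_nonneg (by positivity),
      Real.norm_of_nonneg (by linarith)] at h1
    nlinarith [mul_le_mul_of_nonneg_left hd (by positivity : (0 : ℝ) ≤ X (i + 1)),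
      mul_le_mul_of_nonneg_left hanti.le (by linarith : (0 : ℝ) ≤ (X (i + 1) : ℝ) - X i)]

lemma MM_upper {θ : Fin 3 → ℝ} {X : ℕ → ℕ} (h : BA θ X) (i : ℕ) :
    ‖MM θ (ZZ θ (X i)) (ZZ θ (X (i + 1)))‖ ≤ 2 * ((X (i + 1) : ℝ) * ff θ (X i)) := by
  set z := ZZ θ (X i) with hz
  set w := ZZ θ (X (i + 1)) with hw
  have hz0 : (z 0 : ℝ) = X i := by rw [hz, ZZ_zero]; simp
  have hw0 : (w 0 : ℝ) = X (i + 1) := by rw [hw, ZZ_zero]; simp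
  have hez : ‖EE θ z‖ = ff θ (X i) := norm_EE_ZZ _ _
  have hew : ‖EE θ w‖ = ff θ (X (i + 1)) := norm_EE_ZZ _ _
  have hlt : (X i : ℝ) < X (i + 1) := by exact_mod_cast h.lt i
  have h1 : ‖MM θ z w‖ ≤ _ := norm_sub_le _ _
  rw [norm_smul, norm_smul, hz0, hw0, hez, hew, Real.norm_of_nonneg (by positivity),
      Real.norm_of_nonneg (by positivity)] at h1
  have := mul_le_mul hlt.le (h.anti i).le (h.pos (i+1)).le (by positivity)
  linarith

/-- integer points of the plane are integer combinations -/
lemma int_comb {θ : Fin 3 → ℝ} {X : ℕ → ℕ} (h : BA θ X) (i : ℕ) (w : Fin 4 → ℤ)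
    (hw : (fun j => (w j : ℚ)) ∈ Submodule.span ℚ {ZQ θ (X i), ZQ θ (X (i + 1))}) :
    ∃ c d : ℤ, w = c • ZZ θ (X i) + d • ZZ θ (X (i + 1)) := by
  obtain ⟨a, b, hab⟩ := Submodule.mem_span_pair.mp hw
  refine ⟨round a, round b, ?_⟩
  set z := ZZ θ (X i) with hz
  set z' := ZZ θ (X (i + 1)) with hz'
  have hz0 : (z 0 : ℝ) = X i := by rw [hz, ZZ_zero]; simp
  have hz0' : (z' 0 : ℝ) = X (i + 1) := by rw [hz', ZZ_zero]; simp
  have hez : ‖EE θ z‖ = ff θ (X i) := norm_EE_ZZ _ _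
  have hew : ‖EE θ z'‖ = ff θ (X (i + 1)) := norm_EE_ZZ _ _
  have hlt : (X i : ℝ) < X (i + 1) := by exact_mod_cast h.lt i
  set u : Fin 4 → ℤ := w - (round a • z + round b • z') with hu
  have ha : |((a - round a : ℚ) : ℝ)| ≤ 1 / 2 := by
    have := abs_sub_round a
    have h2 : ((|a - round a| : ℚ) : ℝ) ≤ ((1 / 2 : ℚ) : ℝ) := Rat.cast_le.mpr this
    rw [Rat.cast_abs] at h2
    exact h2.trans (by norm_num)
  have hb : |((b - round b : ℚ) : ℝ)| ≤ 1 / 2 := by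
    have := abs_sub_round b
    have h2 : ((|b - round b| : ℚ) : ℝ) ≤ ((1 / 2 : ℚ) : ℝ) := Rat.cast_le.mpr this
    rw [Rat.cast_abs] at h2
    exact h2.trans (by norm_num)
  set a' : ℝ := ((a - round a : ℚ) : ℝ) with ha'
  set b' : ℝ := ((b - round b : ℚ) : ℝ) with hb'
  have huj : ∀ j, (u j : ℝ) = a' * z j + b' * z' j := by
    intro j
    have h1 := congrFun hab j
    simp only [ZQ, Pi.add_apply, Pi.smul_apply, smul_eq_mul] at h1
    rw [← hz, ← hz'] at h1
    have h2 : (w j : ℝ) = a * z j + b * z' j := by exact_mod_cast h1.symm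
    simp only [hu, Pi.sub_apply, Pi.add_apply, Pi.smul_apply, smul_eq_mul]
    push_cast
    rw [h2, ha', hb']
    push_cast
    ring
  have hE : EE θ u = a' • EE θ z + b' • EE θ z' := by
    ext j
    simp only [EE, huj, Pi.add_apply, Pi.smul_apply, smul_eq_mul]
    ring
  have hEn : ‖EE θ u‖ < ff θ (X i) := by
    rw [hE]
    refine (norm_add_le _ _).trans_lt ?_
    rw [norm_smul, norm_smul, hez, hew, Real.norm_eq_abs, Real.norm_eq_abs]
    have := h.anti i
    have h3 := mul_le_mul_of_nonneg_right ha (h.pos i).le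
    have h4 := mul_le_mul_of_nonneg_right hb (h.pos (i + 1)).le
    linarith
  have hq : |(u 0 : ℝ)| < X (i + 1) := by
    rw [huj, hz0, hz0']
    refine (abs_add_le _ _).trans_lt ?_
    rw [abs_mul, abs_mul, Nat.abs_cast, Nat.abs_cast]
    have h3 := mul_le_mul_of_nonneg_right ha (Nat.cast_nonneg (α := ℝ) (X i))
    have h4 := mul_le_mul_of_nonneg_right hb (Nat.cast_nonneg (α := ℝ) (X (i + 1)))
    linarith
  have hq' : (u 0).natAbs < X (i + 1) := by
    have : (((u 0).natAbs : ℕ) : ℝ) < X (i + 1) := by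
      rw [Nat.cast_natAbs]; push_cast; exact hq
    exact_mod_cast this
  have hu0 : u 0 = 0 := by
    by_contra hne
    have := h.best i _ (Int.natAbs_pos.mpr hne) hq'
    have := ff_le_norm_EE θ u
    linarith
  have hall : ∀ j, u j = 0 := by
    intro j
    refine Fin.cases hu0 (fun j => ?_) j
    have h1 : ‖EE θ u j‖ ≤ ‖EE θ u‖ := norm_le_pi_norm _ j
    have h2 := ff_le_half θ (X i)
    simp only [EE, hu0, Int.cast_zero, zero_mul, zero_sub, norm_neg, Real.norm_eq_abs] at h1
    have h3 : |(u j.succ : ℝ)| < 1 := by linarith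
    have h4 : |u j.succ| < 1 := by exact_mod_cast h3
    exact Int.abs_lt_one_iff.mp h4
  have : u = 0 := funext hall
  rw [hu] at this
  exact sub_eq_zero.mp this

lemma MM_comb (θ : Fin 3 → ℝ) (z w : Fin 4 → ℤ) (c d c' d' : ℤ) :
    MM θ (c • z + d • w) (c' • z + d' • w) = ((c * d' - d * c' : ℤ) : ℝ) • MM θ z w := by
  ext j
  simp [MM, EE]
  ring

/-- plane comparison -/
lemma plane_cmp {θ : Fin 3 → ℝ} {X : ℕ → ℕ} (h : BA θ X) (i k : ℕ)
    (h1 : ZQ θ (X i) ∈ Submodule.span ℚ {ZQ θ (X k), ZQ θ (X (k + 1))})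
    (h2 : ZQ θ (X (i + 1)) ∈ Submodule.span ℚ {ZQ θ (X k), ZQ θ (X (k + 1))}) :
    (X (k + 1) : ℝ) * ff θ (X k) ≤ 4 * ((X (i + 1) : ℝ) * ff θ (X i)) := by
  obtain ⟨c, d, e1⟩ := int_comb h k _ h1
  obtain ⟨c', d', e2⟩ := int_comb h k _ h2
  have l1 := MM_lower h i
  have l2 := MM_lower h k
  have l3 := MM_upper h i
  have hp : 0 < (X (i + 1) : ℝ) * ff θ (X i) / 2 := by
    have := h.one_le (i + 1)
    have := h.pos i
    positivity
  have e := MM_comb θ (ZZ θ (X k)) (ZZ θ (X (k + 1))) c d c' d'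
  rw [← e1, ← e2] at e
  have hD : (c * d' - d * c' : ℤ) ≠ 0 := by
    intro h0
    rw [h0] at e
    rw [e] at l1
    simp at l1
    linarith
  have hD1 : (1 : ℝ) ≤ |((c * d' - d * c' : ℤ) : ℝ)| := by
    exact_mod_cast Int.one_le_abs hD
  rw [e, norm_smul, Real.norm_eq_abs] at l3
  have := mul_le_mul_of_nonneg_right hD1 (norm_nonneg (MM θ (ZZ θ (X k)) (ZZ θ (X (k + 1)))))
  linarith

lemma pair_indep {θ : Fin 3 → ℝ} {X : ℕ → ℕ} (h : BA θ X) (k : ℕ) :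
    LinearIndependent ℚ ![ZQ θ (X k), ZQ θ (X (k + 1))] := by
  rw [LinearIndependent.pair_iff]
  intro s t hst
  have l1 := MM_lower h k
  have hp : 0 < (X (k + 1) : ℝ) * ff θ (X k) / 2 := by
    have := h.one_le (k + 1)
    have := h.pos k
    positivity
  set z := ZZ θ (X k) with hz
  set w := ZZ θ (X (k + 1)) with hw
  have hne : MM θ z w ≠ 0 := by
    intro h0
    rw [h0] at l1
    simp at l1
    linarith
  have hj : ∀ j, (s : ℝ) * z j + t * w j = 0 := by
    intro j
    have h1 := congrFun hst j
    simp only [ZQ, Pi.add_apply, Pi.smul_apply, smul_eq_mul, Pi.zero_apply] at h1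
    exact_mod_cast h1
  have hs : (s : ℝ) • MM θ z w = 0 := by
    ext j
    simp only [MM, EE, Pi.smul_apply, Pi.sub_apply, smul_eq_mul, Pi.zero_apply]
    linear_combination (-(w j.succ : ℝ)) * hj 0 + (w 0 : ℝ) * hj j.succ
  have ht : (t : ℝ) • MM θ z w = 0 := by
    ext j
    simp only [MM, EE, Pi.smul_apply, Pi.sub_apply, smul_eq_mul, Pi.zero_apply]
    linear_combination (-(z 0 : ℝ)) * hj j.succ + (z j.succ : ℝ) * hj 0
  constructor
  · exact_mod_cast (smul_eq_zero.mp hs).resolve_right hne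
  · exact_mod_cast (smul_eq_zero.mp ht).resolve_right hne

/-- determinant bound -/
lemma det_bound (θ : Fin 3 → ℝ) (A : Matrix (Fin 4) (Fin 4) ℤ) (hA : A.det ≠ 0)
    (Q : ℝ) (r : Fin 4 → ℝ) (l : ℝ) (hl : 0 < l) (hr : ∀ i, l ≤ r i)
    (hq : ∀ i, |(A i 0 : ℝ)| ≤ Q) (he : ∀ i, ‖EE θ (A i)‖ ≤ r i) :
    1 ≤ 24 * ((∏ i, r i) * (Q / l)) := by
  set B : Matrix (Fin 4) (Fin 4) ℝ := fun i => Fin.cons (A i 0 : ℝ) (EE θ (A i)) with hB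
  have hdet : B.det = -((A.det : ℤ) : ℝ) := by
    have : ((A.det : ℤ) : ℝ) = (A.map (Int.castRingHom ℝ)).det := by
      rw [← RingHom.mapMatrix_apply, ← RingHom.map_det]; simp
    rw [this]
    set T : Matrix (Fin 4) (Fin 4) ℝ :=
      !![1, θ 0, θ 1, θ 2; 0, -1, 0, 0; 0, 0, -1, 0; 0, 0, 0, -1] with hT
    have hTd : T.det = -1 := by
      simp [hT, Matrix.det_succ_row_zero, Fin.sum_univ_succ, Fin.succAbove]
    have hBT : B = A.map (Int.castRingHom ℝ) * T := by
      ext i j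
      fin_cases j <;> simp [hB, hT, Matrix.mul_apply, Fin.sum_univ_succ, Fin.cons, EE, sub_eq_add_neg]
      · exact sub_eq_add_neg ((A i 0 : ℝ) * θ 1) _
      · exact sub_eq_add_neg ((A i 0 : ℝ) * θ 2) _
    rw [hBT, Matrix.det_mul, hTd]
    ring
  have h1 : (1 : ℝ) ≤ |B.det| := by
    rw [hdet, abs_neg]
    exact_mod_cast Int.one_le_abs hA
  refine h1.trans ?_
  set κ : Fin 4 → ℝ := Fin.cons (Q / l) (fun _ => 1) with hκ
  have hent : ∀ i j, |B i j| ≤ r i * κ j := by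
    intro i j
    have hri : 0 < r i := lt_of_lt_of_le hl (hr i)
    have hQ : 0 ≤ Q := (abs_nonneg _).trans (hq i)
    refine Fin.cases ?_ (fun j => ?_) j
    · simp only [hB, hκ, Fin.cons_zero]
      refine (hq i).trans ?_
      rw [mul_div_assoc', le_div_iff₀ hl]
      nlinarith [hr i]
    · simp only [hB, hκ, Fin.cons_succ, mul_one]
      exact (norm_le_pi_norm (EE θ (A i)) j).trans (he i)
  rw [Matrix.det_apply]
  refine (Finset.abs_sum_le_sum_abs _ _).trans ?_
  have : ∀ σ ∈ (Finset.univ : Finset (Equiv.Perm (Fin 4))),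
      |Equiv.Perm.sign σ • ∏ i, B (σ i) i| ≤ (∏ i, r i) * (Q / l) := by
    intro σ _
    have e1 : |Equiv.Perm.sign σ • ∏ i, B (σ i) i| = ∏ i, |B (σ i) i| := by
      rw [← Finset.abs_prod]
      rcases Int.units_eq_one_or (Equiv.Perm.sign σ) with h | h <;> rw [h] <;> simp
    rw [e1]
    calc ∏ i, |B (σ i) i| ≤ ∏ i, (r (σ i) * κ i) :=
          Finset.prod_le_prod (fun i _ => abs_nonneg _) (fun i _ => hent _ _)
      _ = (∏ i, r i) * (Q / l) := by
          rw [Finset.prod_mul_distrib, Equiv.prod_comp σ r]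
          congr 1
          simp [hκ, Fin.prod_univ_succ]
  refine (Finset.sum_le_sum this).trans ?_
  rw [Finset.sum_const, Finset.card_univ, Fintype.card_perm]
  simp [Nat.factorial]

lemma BA.strictMono {θ : Fin 3 → ℝ} {X : ℕ → ℕ} (h : BA θ X) : StrictMono X :=
  strictMono_nat_of_lt_succ h.lt

lemma BA.strictAnti {θ : Fin 3 → ℝ} {X : ℕ → ℕ} (h : BA θ X) :
    StrictAnti (fun i => ff θ (X i)) :=
  strictAnti_nat_of_succ_lt h.anti

lemma span_tail {θ : Fin 3 → ℝ} (hli : LinearIndependent ℚ (Fin.cons (1 : ℝ) θ : Fin 4 → ℝ))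
    {X : ℕ → ℕ} (h : BA θ X) (N : ℕ) :
    Submodule.span ℚ ((fun i => ZQ θ (X i)) '' Set.Ici N) = ⊤ := by
  by_contra hne
  obtain ⟨f, hf0, hf⟩ := Submodule.exists_le_ker_of_lt_top _ (lt_top_iff_ne_top.mpr hne)
  set c : Fin 4 → ℚ := fun j => f (Pi.single j 1) with hc
  have hfc : ∀ v : Fin 4 → ℚ, f v = ∑ j, v j * c j := by
    intro v
    have := LinearMap.pi_apply_eq_sum_univ f v
    rw [this]
    refine Finset.sum_congr rfl fun j _ => ?_
    rw [smul_eq_mul, hc]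
    congr 2
    ext i
    simp [Pi.single_apply, eq_comm]
  have hz : ∀ i, N ≤ i → ∑ j, (ZZ θ (X i) j : ℝ) * (c j : ℝ) = 0 := by
    intro i hi
    have h1 : f (ZQ θ (X i)) = 0 :=
      hf (Submodule.subset_span ⟨i, hi, rfl⟩)
    rw [hfc] at h1
    simp only [ZQ] at h1
    exact_mod_cast h1
  set S : ℝ := (c 0 : ℝ) + ∑ j : Fin 3, (c j.succ : ℝ) * θ j with hS
  set K : ℝ := ∑ j : Fin 3, |(c j.succ : ℝ)| with hK
  have hb : ∀ i, N ≤ i → (X i : ℝ) * |S| ≤ K := by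
    intro i hi
    have h1 := hz i hi
    rw [Fin.sum_univ_succ, ZZ_zero] at h1
    have h2 : (X i : ℝ) * S = ∑ j : Fin 3, (c j.succ : ℝ) * EE θ (ZZ θ (X i)) j := by
      simp only [EE, ZZ_zero, hS, mul_sub, Finset.sum_sub_distrib, mul_add, Finset.mul_sum]
      simp only [Fin.sum_univ_three] at h1 ⊢
      push_cast at h1 ⊢
      linear_combination h1
    have h3 : (X i : ℝ) * |S| = |(X i : ℝ) * S| := by rw [abs_mul, Nat.abs_cast]
    rw [h3, h2]
    refine (Finset.abs_sum_le_sum_abs _ _).trans (Finset.sum_le_sum fun j _ => ?_)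
    rw [abs_mul]
    have h4 : |EE θ (ZZ θ (X i)) j| ≤ ‖EE θ (ZZ θ (X i))‖ :=
      norm_le_pi_norm (EE θ (ZZ θ (X i))) j
    rw [norm_EE_ZZ] at h4
    have := ff_le_half θ (X i)
    exact mul_le_of_le_one_right (abs_nonneg _) (by linarith)
  have hS0 : S = 0 := by
    by_contra hne
    have hp : 0 < |S| := abs_pos.mpr hne
    obtain ⟨n, hn⟩ := exists_nat_gt (K / |S|)
    have h1 := hb (max N n) (le_max_left _ _)
    have h2 : n ≤ X (max N n) := (le_max_right N n).trans (h.strictMono.id_le _)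
    have h3 : (n : ℝ) ≤ X (max N n) := by exact_mod_cast h2
    rw [div_lt_iff₀ hp] at hn
    nlinarith
  rw [Fintype.linearIndependent_iff] at hli
  have hc0 := hli c (by
    rw [Fin.sum_univ_succ]
    simp only [Fin.cons_zero, Fin.cons_succ, Rat.smul_def, mul_one]
    exact hS0)
  apply hf0
  ext v
  simp [hfc, hc0]

lemma exists_config {θ : Fin 3 → ℝ}
    (hli : LinearIndependent ℚ (Fin.cons (1 : ℝ) θ : Fin 4 → ℝ))
    {X : ℕ → ℕ} (h : BA θ X) (N : ℕ) :
    ∃ μ k, N ≤ μ ∧ μ + 1 ≤ k ∧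
      LinearIndependent ℚ ![ZQ θ (X (k + 2)), ZQ θ (X μ), ZQ θ (X k), ZQ θ (X (k + 1))] ∧
      ZQ θ (X (μ + 1)) ∈ Submodule.span ℚ {ZQ θ (X k), ZQ θ (X (k + 1))} ∧
      ZQ θ (X (μ + 2)) ∈ Submodule.span ℚ {ZQ θ (X k), ZQ θ (X (k + 1))} := by
  classical
  set z : ℕ → Fin 4 → ℚ := fun i => ZQ θ (X i) with hz
  set W : ℕ → Submodule ℚ (Fin 4 → ℚ) := fun m => Submodule.span ℚ (z '' Set.Ico N m) with hW
  have hmono : Monotone W := fun a b hab =>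
    Submodule.span_mono (Set.image_mono (Set.Ico_subset_Ico_right hab))
  have hex : ∃ m, W m = ⊤ := by
    obtain ⟨n, hn⟩ := monotone_stabilizes_iff_noetherian.mpr
      (inferInstance : IsNoetherian ℚ (Fin 4 → ℚ)) ⟨W, hmono⟩
    refine ⟨n, ?_⟩
    rw [eq_top_iff, ← span_tail hli h N, Submodule.span_le]
    rintro _ ⟨i, hi, rfl⟩
    have h1 : W n = W (max n (i + 1)) := hn _ (le_max_left _ _)
    rw [h1]
    refine Submodule.subset_span ⟨i, ⟨hi, ?_⟩, rfl⟩
    exact lt_of_lt_of_le (Nat.lt_succ_self i) (le_max_right _ _)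
  obtain ⟨m, hm, hmin⟩ : ∃ m, W m = ⊤ ∧ ∀ m' < m, W m' ≠ ⊤ :=
    ⟨Nat.find hex, Nat.find_spec hex, fun m' h' => Nat.find_min hex h'⟩
  have hcard : ∀ s : Finset (Fin 4 → ℚ), s.card ≤ 3 →
      Submodule.span ℚ (s : Set (Fin 4 → ℚ)) ≠ ⊤ := by
    intro s hs htop
    have h1 := finrank_span_finset_le_card (R := ℚ) s
    have h2 : Set.finrank ℚ (s : Set (Fin 4 → ℚ)) = 4 := by
      unfold Set.finrank
      rw [htop, finrank_top]; simp
    omega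
  -- m is large
  have hm3 : N + 3 < m := by
    by_contra hlt
    push Not at hlt
    have h1 : z '' Set.Ico N m ⊆ (({z N, z (N + 1), z (N + 2)} : Finset (Fin 4 → ℚ)) : Set _) := by
      rintro _ ⟨i, ⟨h1, h2⟩, rfl⟩
      have : i = N ∨ i = N + 1 ∨ i = N + 2 := by omega
      rcases this with rfl | rfl | rfl <;> simp
    refine hcard {z N, z (N + 1), z (N + 2)} Finset.card_le_three (eq_top_iff.mpr ?_)
    rw [← hm]
    exact Submodule.span_mono h1
  obtain ⟨k, rfl⟩ : ∃ k, m = k + 3 := ⟨m - 3, by omega⟩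
  have hlast : z (k + 2) ∉ W (k + 2) := by
    intro hmem
    refine hmin (k + 2) (by omega) (eq_top_iff.mpr ?_)
    rw [← hm, hW, Submodule.span_le]
    rintro _ ⟨i, ⟨h1, h2⟩, rfl⟩
    rcases Nat.lt_succ_iff_lt_or_eq.mp h2 with h3 | h3
    · exact Submodule.subset_span ⟨i, ⟨h1, h3⟩, rfl⟩
    · rw [h3]; exact hmem
  set P := Submodule.span ℚ {z k, z (k + 1)} with hP
  have hPk : z k ∈ P := Submodule.subset_span (by simp)
  have hPk1 : z (k + 1) ∈ P := Submodule.subset_span (by simp)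
  have hexμ : ∃ i, N ≤ i ∧ i ≤ k + 1 ∧ z i ∉ P := by
    by_contra hcon
    push Not at hcon
    refine hcard {z k, z (k + 1), z (k + 2)} Finset.card_le_three (eq_top_iff.mpr ?_)
    rw [← hm, hW, Submodule.span_le]
    rintro _ ⟨i, ⟨h1, h2⟩, rfl⟩
    rcases Nat.lt_succ_iff_lt_or_eq.mp h2 with h3 | h3
    · exact Submodule.span_mono (by intro x; simp; tauto) (hcon i h1 (by omega))
    · rw [h3]; exact Submodule.subset_span (by simp)
  obtain ⟨μ, hμ, hμmax⟩ : ∃ μ, (N ≤ μ ∧ μ ≤ k + 1 ∧ z μ ∉ P) ∧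
      ∀ j, μ < j → j ≤ k + 1 → z j ∈ P := by
    obtain ⟨i, hi⟩ := hexμ
    set p : ℕ → Prop := fun i => N ≤ i ∧ i ≤ k + 1 ∧ z i ∉ P
    have hg : p (Nat.findGreatest p (k + 1)) := Nat.findGreatest_spec hi.2.1 hi
    refine ⟨_, hg, fun j h1 h2 => ?_⟩
    by_contra h3
    exact Nat.findGreatest_is_greatest h1 h2 ⟨hg.1.trans h1.le, h2, h3⟩
  obtain ⟨h1, h2, h3⟩ := hμ
  have hne1 : μ ≠ k + 1 := fun e => h3 (e ▸ hPk1)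
  have hne2 : μ ≠ k := fun e => h3 (e ▸ hPk)
  refine ⟨μ, k, h1, by omega, ?_, hμmax _ (by omega) (by omega), hμmax _ (by omega) (by omega)⟩
  have hr1 : Set.range ![z k, z (k + 1)] = {z k, z (k + 1)} := by
    simp [Matrix.range_cons, Matrix.range_empty, Set.pair_comm]
  have hr2 : Set.range ![z μ, z k, z (k + 1)] ⊆ z '' Set.Ico N (k + 2) := by
    rintro _ ⟨i, rfl⟩
    fin_cases i
    · exact ⟨μ, ⟨h1, by omega⟩, rfl⟩
    · exact ⟨k, ⟨by omega, by omega⟩, rfl⟩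
    · exact ⟨k + 1, ⟨by omega, by omega⟩, rfl⟩
  change LinearIndependent ℚ (Fin.cons (z (k + 2)) ![z μ, z k, z (k + 1)] : Fin 4 → _)
  rw [linearIndependent_finCons]
  refine ⟨?_, fun hmem => hlast (Submodule.span_mono hr2 hmem)⟩
  change LinearIndependent ℚ (Fin.cons (z μ) ![z k, z (k + 1)] : Fin 3 → _)
  rw [linearIndependent_finCons, hr1]
  exact ⟨pair_indep h k, h3⟩

/-- the key inequality -/
lemma key {θ : Fin 3 → ℝ}
    (hli : LinearIndependent ℚ (Fin.cons (1 : ℝ) θ : Fin 4 → ℝ))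
    {X : ℕ → ℕ} (h : BA θ X) (N : ℕ) :
    ∃ μ k, N ≤ μ ∧ μ + 1 ≤ k ∧
      1 ≤ 24 * ((X (k + 2) : ℝ) * ff θ (X μ) * ff θ (X k) * ff θ (X (k + 1))) ∧
      (X (k + 1) : ℝ) * ff θ (X k) ≤ 4 * ((X (μ + 2) : ℝ) * ff θ (X (μ + 1))) := by
  obtain ⟨μ, k, h1, h2, hind, hp1, hp2⟩ := exists_config hli h N
  refine ⟨μ, k, h1, h2, ?_, plane_cmp h _ _ hp1 hp2⟩
  set A : Matrix (Fin 4) (Fin 4) ℤ :=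
    ![ZZ θ (X (k + 2)), ZZ θ (X μ), ZZ θ (X k), ZZ θ (X (k + 1))] with hA
  have hdet : A.det ≠ 0 := by
    intro h0
    have e : (A.map (Int.castRingHom ℚ)).det = 0 := by
      rw [← RingHom.mapMatrix_apply, ← RingHom.map_det, h0]; simp
    have hrow : LinearIndependent ℚ (A.map (Int.castRingHom ℚ)).row := by
      convert hind using 1
      ext i j
      fin_cases i <;> rfl
    have := Matrix.linearIndependent_rows_iff_isUnit.mp hrow
    rw [Matrix.isUnit_iff_isUnit_det, e] at this
    simp at this
  have hl := h.pos (k + 2)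
  have hle : ∀ i, i ≤ k + 2 → ff θ (X (k + 2)) ≤ ff θ (X i) := fun i hi =>
    h.strictAnti.antitone hi
  have hX : ∀ i, i ≤ k + 2 → |((ZZ θ (X i) 0 : ℤ) : ℝ)| ≤ X (k + 2) := fun i hi => by
    rw [ZZ_zero, Int.cast_natCast, Nat.abs_cast]
    exact_mod_cast h.strictMono.monotone hi
  have := det_bound θ A hdet (X (k + 2))
    ![ff θ (X (k + 2)), ff θ (X μ), ff θ (X k), ff θ (X (k + 1))] _ hl
    (by
      intro i
      fin_cases i
      · exact le_rfl
      · exact hle _ (by omega)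
      · exact hle _ (by omega)
      · exact hle _ (by omega))
    (by
      intro i
      fin_cases i
      · exact hX _ (by omega)
      · exact hX _ (by omega)
      · exact hX _ (by omega)
      · exact hX _ (by omega))
    (by
      intro i
      fin_cases i <;> exact (norm_EE_ZZ _ _).le)
  refine this.trans (le_of_eq ?_)
  simp [Fin.prod_univ_succ]
  field_simp

lemma exists_BA {θ : Fin 3 → ℝ} (hpos : ∀ q : ℕ, 1 ≤ q → 0 < ff θ q)
    (hsmall : ∀ ε : ℝ, 0 < ε → ∃ q : ℕ, 1 ≤ q ∧ ff θ q < ε) : ∃ X, BA θ X := by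
  classical
  have hn : ∀ q : {q : ℕ // 1 ≤ q}, ∃ q' : {q : ℕ // 1 ≤ q}, ff θ q' < ff θ q ∧
      ∀ r : ℕ, 1 ≤ r → r < q' → ff θ q ≤ ff θ r := by
    intro q
    have hex := hsmall _ (hpos q q.2)
    refine ⟨⟨Nat.find hex, (Nat.find_spec hex).1⟩, (Nat.find_spec hex).2, fun r h1 h2 => ?_⟩
    by_contra h3
    exact Nat.find_min hex h2 ⟨h1, not_le.mp h3⟩
  choose nx hnx1 hnx2 using hn
  set Y : ℕ → {q : ℕ // 1 ≤ q} := fun n => Nat.rec ⟨1, le_rfl⟩ (fun _ y => nx y) n with hY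
  have hs : ∀ n, Y (n + 1) = nx (Y n) := fun n => rfl
  refine ⟨fun n => (Y n : ℕ), fun i => (Y i).2, ?_, fun i => hpos _ (Y i).2, ?_, ?_⟩
  · intro i
    have hne : (Y (i + 1) : ℕ) ≠ Y i := by
      intro e
      have := hnx1 (Y i)
      rw [← hs, e] at this
      exact lt_irrefl _ this
    refine lt_of_le_of_ne ?_ hne.symm
    by_contra hlt
    push Not at hlt
    cases i with
    | zero => 
      have h1 : (Y 0 : ℕ) = 1 := rfl
      have h2 := (Y (0 + 1)).2
      omega
    | succ i =>
      have h1 := hnx2 (Y i) (Y (i + 1 + 1)) (Y (i + 1 + 1)).2 (by rw [← hs]; exact hlt)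
      have h2 := hnx1 (Y i)
      have h3 := hnx1 (Y (i + 1))
      rw [← hs] at h2
      rw [← hs (i + 1)] at h3
      linarith
  · intro i
    exact hnx1 (Y i)
  · intro i q h1 h2
    exact hnx2 (Y i) q h1 h2

lemma core {θ : Fin 3 → ℝ}
    (hli : LinearIndependent ℚ (Fin.cons (1 : ℝ) θ : Fin 4 → ℝ)) (a b : ℝ) (ha : 0 < a)
    (hA : ∀ᶠ n : ℕ in atTop, ∃ q : ℕ, 1 ≤ q ∧ q < n ∧ ff θ q ≤ (n : ℝ) ^ (-a))
    (hB : ∀ᶠ n : ℕ in atTop, (n : ℝ) ^ (-b) ≤ ff θ n)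
    (h1 : (1 - a) * (b / a) ≤ 1)
    (h2 : 0 < a + a * (b / a) - (1 - a) * (b / a) ^ 2) : False := by
  have hpos : ∀ q : ℕ, 1 ≤ q → 0 < ff θ q := by
    intro q hq
    refine lt_of_le_of_ne (norm_nonneg _) fun h0 => ?_
    have h3 := congrFun (norm_eq_zero.mp h0.symm) 0
    simp only [Pi.zero_apply] at h3
    rw [Fintype.linearIndependent_iff] at hli
    have := hli (Fin.cons (-(round ((q : ℝ) * θ 0) : ℚ)) (Fin.cons (q : ℚ) 0)) (by
      simp [Fin.sum_univ_succ, Rat.smul_def]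
      linarith) 1
    change (q : ℚ) = 0 at this
    have : q = 0 := by exact_mod_cast this
    omega
  have hsmall : ∀ ε : ℝ, 0 < ε → ∃ q : ℕ, 1 ≤ q ∧ ff θ q < ε := by
    intro ε hε
    have ht : Tendsto (fun n : ℕ => (n : ℝ) ^ (-a)) atTop (nhds 0) :=
      (tendsto_rpow_neg_atTop ha).comp tendsto_natCast_atTop_atTop
    obtain ⟨n, ⟨q, hq1, _, hq2⟩, hn⟩ := (hA.and (ht.eventually_lt_const hε)).exists
    exact ⟨q, hq1, hq2.trans_lt hn⟩
  obtain ⟨X, h⟩ := exists_BA hpos hsmall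
  obtain ⟨N1, hN1⟩ := eventually_atTop.mp hA
  obtain ⟨N2, hN2⟩ := eventually_atTop.mp hB
  set H := b / a with hH
  set g := a + a * H - (1 - a) * H ^ 2 with hg
  set c := Real.log 96 with hc
  have hcpos : 0 < c := Real.log_pos (by norm_num)
  obtain ⟨N3, hN3⟩ : ∃ N3 : ℕ, ∀ n ≥ N3, c / a < Real.log n ∧ c / g < Real.log n := by
    have ht : Tendsto (fun n : ℕ => Real.log n) atTop atTop :=
      Real.tendsto_log_atTop.comp tendsto_natCast_atTop_atTop
    exact eventually_atTop.mp ((ht.eventually_gt_atTop _).and (ht.eventually_gt_atTop _))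
  obtain ⟨μ, k, hμ, hk, k1, k2⟩ := key hli h (N1 + N2 + N3)
  have hXp : ∀ i, (0 : ℝ) < X i := fun i => by exact_mod_cast h.one_le i
  have hid : ∀ i, i ≤ X i := fun i => h.strictMono.id_le i
  have hs : ∀ i, N1 ≤ i → Real.log (ff θ (X i)) ≤ -a * Real.log (X (i + 1)) := by
    intro i hi
    obtain ⟨q, hq1, hq2, hq3⟩ := hN1 (X (i + 1)) (by have := hid (i + 1); omega)
    have h3 := (h.best i q hq1 hq2).trans hq3
    have h4 := Real.log_le_log (h.pos i) h3
    rwa [Real.log_rpow (hXp _)] at h4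
  have hs' : ∀ i, N2 ≤ i → -b * Real.log (X i) ≤ Real.log (ff θ (X i)) := by
    intro i hi
    have h3 := hN2 (X i) (by have := hid i; omega)
    have h4 := Real.log_le_log (Real.rpow_pos_of_pos (hXp _) _) h3
    rwa [Real.log_rpow (hXp _)] at h4
  have hx : ∀ i, N1 + N2 ≤ i → Real.log (X (i + 1)) ≤ H * Real.log (X i) := by
    intro i hi
    have h3 := hs i (by omega)
    have h4 := hs' i (by omega)
    rw [hH, div_mul_eq_mul_div, le_div_iff₀ ha]
    linarith
  have hfp := h.pos
  have e1 : (X (k + 1) : ℝ) ≤ 96 * (X (k + 2) * X (μ + 2) * ff θ (X μ) * ff θ (X (k + 1)) *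
      ff θ (X (μ + 1))) := by
    have q1 : 0 ≤ 24 * (X (k + 2) * ff θ (X μ) * ff θ (X (k + 1))) := by
      have := hfp μ; have := hfp (k + 1); positivity
    have q2 := mul_le_mul_of_nonneg_left k2 q1
    have q3 := mul_le_mul_of_nonneg_left k1 (hXp (k + 1)).le
    nlinarith
  have e2 := Real.log_le_log (hXp _) e1
  have n1 := (hXp (k + 2)).ne'
  have n2 := (hXp (μ + 2)).ne'
  have n3 := (hfp (μ)).ne'
  have n4 := (hfp (k + 1)).ne'
  have n5 := (hfp (μ + 1)).ne'
  rw [Real.log_mul (by norm_num) (by positivity), Real.log_mul (by positivity) n5,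
    Real.log_mul (by positivity) n4, Real.log_mul (by positivity) n3,
    Real.log_mul n1 n2] at e2
  have s1 := hs μ (by omega)
  have s2 := hs (μ + 1) (by omega)
  have s3 := hs (k + 1) (by omega)
  have x1 := hx (μ + 1) (by omega)
  have x2 := hx (k + 1) (by omega)
  have hmono : Real.log (X (μ + 2)) ≤ Real.log (X (k + 1)) :=
    Real.log_le_log (hXp _) (by exact_mod_cast h.strictMono.monotone (by omega))
  have hmono2 : Real.log (X (k + 1)) ≤ Real.log (X (k + 2)) :=
    Real.log_le_log (hXp _) (by exact_mod_cast h.strictMono.monotone (by omega))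
  have hmono1 : Real.log (X (μ + 1)) ≤ Real.log (X (μ + 2)) :=
    Real.log_le_log (hXp _) (by exact_mod_cast h.strictMono.monotone (by omega))
  obtain ⟨l1, l2⟩ := hN3 (X (μ + 1)) (by have := hid (μ + 1); omega)
  simp only [add_assoc, Nat.reduceAdd] at *
  rw [← hc] at e2
  set xn := Real.log (X (μ + 1))
  set xn1 := Real.log (X (μ + 2))
  set xk := Real.log (X (k + 1))
  set xk1 := Real.log (X (k + 2))
  rw [div_lt_iff₀ ha] at l1
  rw [div_lt_iff₀ h2] at l2
  have hxn : 0 ≤ xn := Real.log_natCast_nonneg _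
  -- main
  have m0 : xk ≤ c + (1 - a) * xk1 + (1 - a) * xn1 - a * xn := by linarith
  by_cases ha1 : a ≤ 1
  · have m1 : (1 - (1 - a) * H) * xk ≤ c + (1 - a) * xn1 - a * xn := by
      nlinarith [mul_le_mul_of_nonneg_left x2 (by linarith : 0 ≤ 1 - a)]
    have m2 : (1 - (1 - a) * H) * xn1 ≤ c + (1 - a) * xn1 - a * xn := by
      nlinarith [mul_le_mul_of_nonneg_left hmono (by linarith : 0 ≤ 1 - (1 - a) * H)]
    by_cases hcs : 0 ≤ a - (1 - a) * H
    · nlinarith [mul_nonneg hcs (hxn.trans hmono1)]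
    · push Not at hcs
      nlinarith [mul_le_mul_of_nonneg_left x1 (by linarith : 0 ≤ -(a - (1 - a) * H))]
  · push Not at ha1
    nlinarith [mul_nonneg (by linarith : 0 ≤ a - 1) (hxn.trans hmono1),
      mul_nonneg (by linarith : 0 ≤ a - 1) ((hxn.trans hmono1).trans (hmono.trans hmono2))]

lemma nid_neg (y : ℝ) : nid (-y) = nid y := by
  unfold nid
  apply le_antisymm
  · refine (round_le (-y) (-(round y))).trans (le_of_eq ?_)
    rw [← abs_neg]; congr 1; push_cast; ring
  · refine (round_le y (-(round (-y)))).trans (le_of_eq ?_)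
    rw [← abs_neg]; congr 1; push_cast; ring

lemma heightM_one (x : Fin 1 → ℤ) : heightM x = (x 0).natAbs := by
  simp [heightM]

lemma sup_eq (θ₁ θ₂ θ₃ : ℝ) (x : Fin 1 → ℤ) :
    (⨆ j : Fin 3, nid (∑ i, (!![θ₁; θ₂; θ₃] : Matrix (Fin 3) (Fin 1) ℝ) j i * (x i : ℝ)))
      = ff ![θ₁, θ₂, θ₃] (heightM x) := by
  have hj : ∀ j : Fin 3,
      nid (∑ i, (!![θ₁; θ₂; θ₃] : Matrix (Fin 3) (Fin 1) ℝ) j i * (x i : ℝ)) =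
      ‖((heightM x : ℕ) : ℝ) * ![θ₁, θ₂, θ₃] j
        - (round (((heightM x : ℕ) : ℝ) * ![θ₁, θ₂, θ₃] j) : ℝ)‖ := by
    intro j
    have e : (!![θ₁; θ₂; θ₃] : Matrix (Fin 3) (Fin 1) ℝ) j 0 = ![θ₁, θ₂, θ₃] j := by
      fin_cases j <;> rfl
    rw [Fin.sum_univ_one, e, heightM_one]
    change _ = nid _
    rcases Int.natAbs_eq (x 0) with h | h
    · have h2 : ((x 0 : ℤ) : ℝ) = (((x 0).natAbs : ℕ) : ℝ) := by
        rw [← Int.cast_natCast, ← h]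
      rw [h2, mul_comm]
    · have h2 : ((x 0 : ℤ) : ℝ) = -(((x 0).natAbs : ℕ) : ℝ) := by
        rw [← Int.cast_natCast, ← Int.cast_neg, ← h]
      rw [h2, mul_neg, nid_neg, mul_comm]
  simp only [hj]
  apply le_antisymm
  · exact ciSup_le fun j => norm_le_pi_norm (fun j : Fin 3 => ((heightM x : ℕ) : ℝ) *
      ![θ₁, θ₂, θ₃] j - (round (((heightM x : ℕ) : ℝ) * ![θ₁, θ₂, θ₃] j) : ℝ)) j
  · unfold ff
    have hb := Set.finite_range (fun j : Fin 3 => ‖((heightM x : ℕ) : ℝ) * ![θ₁, θ₂, θ₃] j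
        - (round (((heightM x : ℕ) : ℝ) * ![θ₁, θ₂, θ₃] j) : ℝ)‖) |>.bddAbove
    rw [pi_norm_le_iff_of_nonneg ((norm_nonneg _).trans (le_ciSup hb 0))]
    intro j
    exact le_ciSup hb j

lemma psi_le (θ₁ θ₂ θ₃ : ℝ) (n : ℕ) (hn : 1 ≤ n) :
    psiFn !![θ₁; θ₂; θ₃] (n : ℝ) ≤ ENNReal.ofReal (ff ![θ₁, θ₂, θ₃] n) := by
  have hh : heightM (fun _ : Fin 1 => (n : ℤ)) = n := by rw [heightM_one]; simp
  unfold psiFn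
  refine (iInf_le _ (fun _ : Fin 1 => (n : ℤ))).trans ?_
  refine (iInf_le _ (by
    intro h0
    have := congrFun h0 0
    simp at this
    omega)).trans ?_
  refine (iInf_le _ (by rw [hh])).trans ?_
  rw [sup_eq, hh]

lemma le_psi (θ₁ θ₂ θ₃ : ℝ) (t c : ℝ)
    (h : ∀ q : ℕ, 1 ≤ q → (q : ℝ) ≤ t → c ≤ ff ![θ₁, θ₂, θ₃] q) :
    ENNReal.ofReal c ≤ psiFn !![θ₁; θ₂; θ₃] t := by
  unfold psiFn
  refine le_iInf fun x => le_iInf fun hx => le_iInf fun ht => ?_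
  rw [sup_eq]
  refine ENNReal.ofReal_le_ofReal (h _ ?_ ht)
  rw [heightM_one]
  refine Int.natAbs_pos.mpr fun h0 => hx ?_
  ext i
  rw [Subsingleton.elim i 0]; exact h0

lemma uniform_bound (θ₁ θ₂ θ₃ a0 a : ℝ) (ha : a < a0)
    (h : a0 ∈ uniformExps !![θ₁; θ₂; θ₃]) :
    ∀ᶠ n : ℕ in atTop, ∃ q : ℕ, 1 ≤ q ∧ q < n ∧ ff ![θ₁, θ₂, θ₃] q ≤ (n : ℝ) ^ (-a) := by
  obtain ⟨_, hl⟩ := h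
  obtain ⟨C, hC, _⟩ := ENNReal.lt_iff_exists_nnreal_btwn.mp hl
  have h1 := eventually_lt_of_limsup_lt hC
  have ht : Tendsto (fun n : ℕ => (n : ℝ) / 2) atTop atTop :=
    tendsto_natCast_atTop_atTop.atTop_div_const (by norm_num)
  have h2 := ht.eventually h1
  have h3 : Tendsto (fun n : ℕ => (n : ℝ) ^ (a0 - a)) atTop atTop :=
    (tendsto_rpow_atTop (by linarith)).comp tendsto_natCast_atTop_atTop
  filter_upwards [h2, h3.eventually_ge_atTop ((C : ℝ) * 2 ^ a0), eventually_ge_atTop 1]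
    with n hn hn2 hn3
  by_contra hcon
  push Not at hcon
  have hn0 : (0 : ℝ) < n := by exact_mod_cast hn3
  have h4 := le_psi θ₁ θ₂ θ₃ ((n : ℝ) / 2) ((n : ℝ) ^ (-a)) (fun q hq1 hq2 => by
    refine (hcon q hq1 ?_).le
    have : (q : ℝ) < n := by linarith
    exact_mod_cast this)
  have h5 : ENNReal.ofReal (((n : ℝ) / 2) ^ a0) * ENNReal.ofReal ((n : ℝ) ^ (-a)) < C :=
    lt_of_le_of_lt (by gcongr) hn
  rw [← ENNReal.ofReal_mul (by positivity), ← ENNReal.ofReal_coe_nnreal,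
    ENNReal.ofReal_lt_ofReal_iff_of_nonneg (by positivity)] at h5
  rw [Real.div_rpow hn0.le (by norm_num), div_mul_eq_mul_div, ← Real.rpow_add hn0,
    div_lt_iff₀ (by positivity), ← sub_eq_add_neg] at h5
  linarith

lemma individual_bound (θ₁ θ₂ θ₃ b : ℝ) (hb : 0 < b)
    (h : b ∉ individualExps !![θ₁; θ₂; θ₃]) :
    ∀ᶠ n : ℕ in atTop, (n : ℝ) ^ (-b) ≤ ff ![θ₁, θ₂, θ₃] n := by
  have h1 : 1 < liminf (fun t : ℝ => ENNReal.ofReal (t ^ b) * psiFn !![θ₁; θ₂; θ₃] t) atTop := by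
    by_contra hcon
    exact h ⟨hb, (not_lt.mp hcon).trans_lt (by simp)⟩
  have h2 := eventually_lt_of_lt_liminf h1
  have h3 := (tendsto_natCast_atTop_atTop (R := ℝ)).eventually h2
  filter_upwards [h3, eventually_ge_atTop 1] with n hn hn1
  have hn0 : (0 : ℝ) < n := by exact_mod_cast hn1
  have h5 : 1 < ENNReal.ofReal ((n : ℝ) ^ b) * ENNReal.ofReal (ff ![θ₁, θ₂, θ₃] n) :=
    lt_of_lt_of_le hn (by gcongr; exact psi_le _ _ _ _ hn1)
  rw [← ENNReal.ofReal_mul (by positivity), ← ENNReal.ofReal_one,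
    ENNReal.ofReal_lt_ofReal_iff_of_nonneg (by norm_num)] at h5
  rw [Real.rpow_neg hn0.le, inv_le_iff_one_le_mul₀ (by positivity)]
  linarith

lemma alpha_le_beta (θ₁ θ₂ θ₃ : ℝ) : alphaExp !![θ₁; θ₂; θ₃] ≤ betaExp !![θ₁; θ₂; θ₃] := by
  unfold alphaExp betaExp
  apply sSup_le_sSup
  apply Set.image_mono
  rintro γ ⟨h1, h2⟩
  exact ⟨h1, lt_of_le_of_lt liminf_le_limsup h2⟩

lemma g1_eq (α : ℝ) (hα : 0 < α) :
    (2 * α ^ 2 - 2 * α + 1) * g1 α ^ 2 = α * (1 - α) * g1 α + α := by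
  have hD : 0 < 2 * α ^ 2 - 2 * α + 1 := by nlinarith [sq_nonneg (2 * α - 1)]
  have hS : 0 ≤ α ^ 2 * (1 - α) ^ 2 + 4 * α * (2 * α ^ 2 - 2 * α + 1) := by positivity
  have hs := Real.sq_sqrt hS
  unfold g1
  set D := 2 * α ^ 2 - 2 * α + 1
  set s := √(α ^ 2 * (1 - α) ^ 2 + 4 * α * D)
  field_simp
  linear_combination hs

lemma cond (α h g : ℝ) (hα : 0 < α) (hα1 : α < 1) (hh : 0 < h) (hg : 1 < g) (hhg : h < g)
    (e : (2 * α ^ 2 - 2 * α + 1) * g ^ 2 = α * (1 - α) * g + α) :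
    0 < α + α * h - (1 - α) * h ^ 2 := by
  have hD : 0 < 2 * α ^ 2 - 2 * α + 1 := by nlinarith [sq_nonneg (2 * α - 1)]
  have h3 : 1 / 3 ≤ α := by
    by_contra hc
    push Not at hc
    have q1 : α * (1 - α) + α < 2 * α ^ 2 - 2 * α + 1 := by nlinarith
    have q2 : α * (1 - α) * g ≤ α * (1 - α) * g ^ 2 :=
      mul_le_mul_of_nonneg_left (by nlinarith) (mul_pos hα (by linarith)).le
    have q3 : α ≤ α * g ^ 2 := by nlinarith
    nlinarith [mul_lt_mul_of_pos_right q1 (by positivity : 0 < g ^ 2)]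
  have key : (1 - α) * g ^ 2 ≤ α * g + α := by
    have : (2 * α ^ 2 - 2 * α + 1) * ((1 - α) * g ^ 2)
        ≤ (2 * α ^ 2 - 2 * α + 1) * (α * g + α) := by
      have q : 0 ≤ α * g - (1 - 2 * α) := by nlinarith
      have : (2 * α ^ 2 - 2 * α + 1) * (α * g + α)
        - (1 - α) * ((2 * α ^ 2 - 2 * α + 1) * g ^ 2) = α ^ 2 * (α * g - (1 - 2 * α)) := by
        rw [e]; ring
      nlinarith [mul_nonneg (sq_nonneg α) q]
    exact le_of_mul_le_mul_left this hD
  have h4 : (1 - α) * h ^ 2 * g ^ 2 < (α + α * h) * g ^ 2 := by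
    have q1 := mul_le_mul_of_nonneg_right key (sq_nonneg h)
    have q2 : 0 < α * h * g * (g - h) := by
      have : 0 < g - h := by linarith
      positivity
    have q3 : 0 < α * (g - h) * (g + h) := by
      have : 0 < g - h := by linarith
      positivity
    nlinarith
  have := lt_of_mul_lt_mul_right h4 (sq_nonneg g)
  linarith

end JM

/-- **Theorem 2 (Moshchevitin).** For a column of three real numbers `θ₁, θ₂, θ₃` such that
`1, θ₁, θ₂, θ₃` are linearly independent over `ℚ`, one has `β(Θ) ≥ α(Θ)·g₁(α(Θ))`. -/
theorem jarnik_improvement_m1_n3 (θ₁ θ₂ θ₃ : ℝ)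
    (hli : LinearIndependent ℚ ![(1 : ℝ), θ₁, θ₂, θ₃]) :
    ENNReal.ofReal
        ((alphaExp !![θ₁; θ₂; θ₃]).toReal * g1 (alphaExp !![θ₁; θ₂; θ₃]).toReal) ≤
      betaExp !![θ₁; θ₂; θ₃] := by
  by_contra hcon
  push Not at hcon
  set α := (alphaExp !![θ₁; θ₂; θ₃]).toReal with hα
  set g := g1 α with hg
  have hab := JM.alpha_le_beta θ₁ θ₂ θ₃
  have hbt : betaExp !![θ₁; θ₂; θ₃] ≠ ⊤ := (hcon.trans_le le_top).ne
  have hat : alphaExp !![θ₁; θ₂; θ₃] ≠ ⊤ := ne_top_of_le_ne_top hbt hab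
  set β := (betaExp !![θ₁; θ₂; θ₃]).toReal with hβ
  have hαβ : α ≤ β := ENNReal.toReal_mono hbt hab
  have hα0 : 0 ≤ α := ENNReal.toReal_nonneg
  have hβe : betaExp !![θ₁; θ₂; θ₃] = ENNReal.ofReal β := (ENNReal.ofReal_toReal hbt).symm
  have hαe : alphaExp !![θ₁; θ₂; θ₃] = ENNReal.ofReal α := (ENNReal.ofReal_toReal hat).symm
  rw [hβe, ENNReal.ofReal_lt_ofReal_iff_of_nonneg ENNReal.toReal_nonneg] at hcon
  have hαp : 0 < α := by
    rcases hα0.eq_or_lt with h | h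
    · rw [← h] at hcon hαβ
      linarith
    · exact h
  have hg1 : 1 < g := by
    by_contra hc
    nlinarith
  set b := (β + α * g) / 2 with hb
  have hb1 : β < b := by rw [hb]; linarith
  have hb2 : b < α * g := by rw [hb]; linarith
  have hb0 : 0 < b := by linarith
  have hbn : b ∉ individualExps !![θ₁; θ₂; θ₃] := by
    intro hmem
    have : ENNReal.ofReal b ≤ betaExp !![θ₁; θ₂; θ₃] := le_sSup ⟨b, hmem, rfl⟩
    rw [hβe, ENNReal.ofReal_le_ofReal_iff ENNReal.toReal_nonneg] at this
    linarith
  have hh0 : 0 < b / α := by positivity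
  have hhg : b / α < g := by rw [div_lt_iff₀ hαp]; linarith
  have c2 : 0 < α + α * (b / α) - (1 - α) * (b / α) ^ 2 := by
    rcases lt_or_ge α 1 with h1 | h1
    · exact JM.cond α (b / α) g hαp h1 hh0 hg1 hhg (JM.g1_eq α hαp)
    · have : 0 < α * (b / α) := by positivity
      nlinarith [mul_nonneg (by linarith : 0 ≤ α - 1) (sq_nonneg (b / α))]
  have c1 : (1 - α) * (b / α) < 1 := by
    rcases lt_or_ge α 1 with h1 | h1
    · by_contra hc
      push Not at hc
      nlinarith [mul_le_mul_of_nonneg_right hc hh0.le]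
    · nlinarith
  have hcont : ContinuousAt (fun a : ℝ => b / a) α := by
    apply ContinuousAt.div continuousAt_const continuousAt_id hαp.ne'
  have hca : ContinuousAt (fun a : ℝ => a) α := continuousAt_id
  have ev1 : ∀ᶠ a in nhds α, (1 - a) * (b / a) < 1 :=
    ContinuousAt.eventually_lt ((continuousAt_const.sub hca).mul hcont) continuousAt_const c1
  have ev2 : ∀ᶠ a in nhds α, 0 < a + a * (b / a) - (1 - a) * (b / a) ^ 2 :=
    ContinuousAt.eventually_lt continuousAt_const
      ((hca.add (hca.mul hcont)).sub ((continuousAt_const.sub hca).mul (hcont.pow 2))) c2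
  have ev3 : ∀ᶠ a in nhds α, 0 < a := lt_mem_nhds hαp
  have ev : ∀ᶠ a in nhdsWithin α (Set.Iio α),
      (1 - a) * (b / a) < 1 ∧ 0 < a + a * (b / a) - (1 - a) * (b / a) ^ 2 ∧ 0 < a :=
    (ev1.and (ev2.and ev3)).filter_mono nhdsWithin_le_nhds
  obtain ⟨a, ⟨a1, a2, a3⟩, a4⟩ := (ev.and self_mem_nhdsWithin).exists
  have hlt : ENNReal.ofReal a < alphaExp !![θ₁; θ₂; θ₃] := by
    rw [hαe, ENNReal.ofReal_lt_ofReal_iff_of_nonneg a3.le]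
    exact a4
  obtain ⟨_, ⟨a0, ha0, rfl⟩, ha0'⟩ := lt_sSup_iff.mp hlt
  rw [ENNReal.ofReal_lt_ofReal_iff_of_nonneg a3.le] at ha0'
  exact JM.core (θ := ![θ₁, θ₂, θ₃]) hli a b a3
    (JM.uniform_bound θ₁ θ₂ θ₃ a0 a ha0' ha0)
    (JM.individual_bound θ₁ θ₂ θ₃ b hb0 hbn) a1.le a2
end

section
/- Let Θ be the 1×3 real matrix (row) with entries θ¹, θ², θ³, where 1, θ¹, θ², θ³ are linearly independent over ℚ, and assume α(Θ) is finite. Then β(Θ) ≥ α(Θ)·g₂(α(Θ)). -/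
open Filter
open scoped ENNReal

/-- `g₂(α) = √(α + 1/α² − 7/4) + 1/α − 1/2`. -/
noncomputable def g2 (α : ℝ) : ℝ := Real.sqrt (α + 1 / α ^ 2 - 7 / 4) + 1 / α - 1 / 2


/-- The linear form on real 4-vectors. -/
def Lf (a b c : ℝ) (w : Fin 4 → ℝ) : ℝ := a * w 0 + b * w 1 + c * w 2 - w 3

/-- cast of integer vectors -/
def toR (w : Fin 4 → ℤ) : Fin 4 → ℝ := fun i => (w i : ℝ)

/-- height of the first three coordinates -/
def ht (w : Fin 4 → ℤ) : ℕ := max (max (w 0).natAbs (w 1).natAbs) (w 2).natAbs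

theorem abs_le_ht (w : Fin 4 → ℤ) : |(w 0 : ℝ)| ≤ ht w ∧ |(w 1 : ℝ)| ≤ ht w ∧ |(w 2 : ℝ)| ≤ ht w := by
  have h : (w 0).natAbs ≤ ht w ∧ (w 1).natAbs ≤ ht w ∧ (w 2).natAbs ≤ ht w := by
    unfold ht; omega
  have e : ∀ i, |(w i : ℝ)| = ((w i).natAbs : ℝ) := fun i => by
    rw [Nat.cast_natAbs]; simp
  simp only [e]
  exact_mod_cast h

theorem ht_lt_of (w : Fin 4 → ℤ) (n : ℕ) (h0 : |(w 0 : ℝ)| < n) (h1 : |(w 1 : ℝ)| < n)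
    (h2 : |(w 2 : ℝ)| < n) : ht w < n := by
  have e : ∀ i, |(w i : ℝ)| = ((w i).natAbs : ℝ) := fun i => by
    rw [Nat.cast_natAbs]; simp
  simp only [e] at *
  norm_cast at *
  unfold ht; omega

theorem ht_eq (w : Fin 4 → ℤ) :
    ∃ i : Fin 4, i ≠ 3 ∧ |(w i : ℝ)| = ht w := by
  have e : ∀ i, |(w i : ℝ)| = ((w i).natAbs : ℝ) := fun i => by
    rw [Nat.cast_natAbs]; simp
  simp only [e]
  norm_cast
  by_contra! h
  have h0 := h 0 (by decide)
  have h1 := h 1 (by decide)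
  have h2 := h 2 (by decide)
  unfold ht at *; omega

theorem dirichlet (a b c : ℝ) (N : ℕ) (hN : 0 < N) :
    ∃ w : Fin 4 → ℤ, 0 < ht w ∧ ht w ≤ N ∧ |Lf a b c (toR w)| ≤ 1 / (N : ℝ) ^ 3 := by
  let g : (Fin 3 → Fin (N + 1)) → ℝ := fun x =>
    a * ((x 0 : ℕ) : ℝ) + b * ((x 1 : ℕ) : ℝ) + c * ((x 2 : ℕ) : ℝ)
  let f : (Fin 3 → Fin (N + 1)) → ℤ := fun x => ⌊(N : ℝ) ^ 3 * Int.fract (g x)⌋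
  have hN' : (0 : ℝ) < (N : ℝ) ^ 3 := by positivity
  have hmaps : ∀ x ∈ (Finset.univ : Finset (Fin 3 → Fin (N + 1))), f x ∈ Finset.Ico (0 : ℤ) ((N : ℤ) ^ 3) := by
    intro x _
    rw [Finset.mem_Ico]
    refine ⟨Int.floor_nonneg.2 (mul_nonneg hN'.le (Int.fract_nonneg _)), ?_⟩
    rw [Int.floor_lt]
    push_cast
    have := Int.fract_lt_one (g x)
    nlinarith
  have hcard : (Finset.Ico (0 : ℤ) ((N : ℤ) ^ 3)).card < (Finset.univ : Finset (Fin 3 → Fin (N + 1))).card := by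
    simp only [Int.card_Ico, Finset.card_univ, Fintype.card_fun, Fintype.card_fin]
    have : ((N : ℤ) ^ 3 - 0).toNat = N ^ 3 := by
      rw [sub_zero]; exact_mod_cast Int.toNat_natCast (N ^ 3)
    rw [this]
    exact Nat.pow_lt_pow_left (Nat.lt_succ_self N) (by norm_num)
  obtain ⟨x, _, y, _, hxy, hf⟩ := Finset.exists_ne_map_eq_of_card_lt_of_maps_to hcard hmaps
  refine ⟨![(x 0 : ℕ) - (y 0 : ℕ), (x 1 : ℕ) - (y 1 : ℕ), (x 2 : ℕ) - (y 2 : ℕ), ⌊g x⌋ - ⌊g y⌋], ?_, ?_, ?_⟩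
  · by_contra h
    apply hxy
    simp [ht] at h
    funext i
    apply Fin.ext
    fin_cases i <;> simp <;> omega
  · simp [ht]
    omega
  · have hlt : |(N : ℝ) ^ 3 * Int.fract (g x) - (N : ℝ) ^ 3 * Int.fract (g y)| < 1 :=
      Int.abs_sub_lt_one_of_floor_eq_floor hf
    have e : Lf a b c (toR ![(x 0 : ℕ) - (y 0 : ℕ), (x 1 : ℕ) - (y 1 : ℕ), (x 2 : ℕ) - (y 2 : ℕ), ⌊g x⌋ - ⌊g y⌋])
        = Int.fract (g x) - Int.fract (g y) := by
      simp only [Int.fract, g, Lf, toR]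
      simp [-Int.self_sub_floor]
      ring
    rw [e, le_div_iff₀ hN']
    rw [← mul_sub, abs_mul, abs_of_pos hN'] at hlt
    linarith

/-- Sequence of best approximations. -/
structure BestSeq (a b c : ℝ) (z : ℕ → Fin 4 → ℤ) : Prop where
  pos : ∀ k, 0 < Lf a b c (toR (z k))
  dec : ∀ k, Lf a b c (toR (z (k + 1))) < Lf a b c (toR (z k))
  hlt : ∀ k, ht (z k) < ht (z (k + 1))
  best : ∀ k (w : Fin 4 → ℤ), w ≠ 0 → ht w < ht (z (k + 1)) →
    Lf a b c (toR (z k)) ≤ |Lf a b c (toR w)|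

theorem Lf_neg (a b c : ℝ) (w : Fin 4 → ℤ) : Lf a b c (toR (-w)) = - Lf a b c (toR w) := by
  simp [Lf, toR]; ring

theorem ht_neg (w : Fin 4 → ℤ) : ht (-w) = ht w := by simp [ht]

theorem finite_low (a b c : ℝ) (H : ℕ) :
    {w : Fin 4 → ℤ | ht w ≤ H ∧ |Lf a b c (toR w)| ≤ 1}.Finite := by
  obtain ⟨B, hB⟩ := exists_nat_gt (1 + |a| * H + |b| * H + |c| * H + H)
  refine (Set.finite_Icc (fun _ : Fin 4 => -(B : ℤ)) (fun _ => (B : ℤ))).subset ?_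
  rintro w ⟨h1, h2⟩
  have hH : (ht w : ℝ) ≤ H := by exact_mod_cast h1
  obtain ⟨q0, q1, q2⟩ := abs_le_ht w
  have p0 : |a * (w 0 : ℝ)| ≤ |a| * H := by rw [abs_mul]; gcongr; linarith
  have p1 : |b * (w 1 : ℝ)| ≤ |b| * H := by rw [abs_mul]; gcongr; linarith
  have p2 : |c * (w 2 : ℝ)| ≤ |c| * H := by rw [abs_mul]; gcongr; linarith
  have na : 0 ≤ |a| * H := by positivity
  have nb : 0 ≤ |b| * H := by positivity
  have nc : 0 ≤ |c| * H := by positivity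
  have nH : (0 : ℝ) ≤ H := by positivity
  have key : ∀ i, |(w i : ℝ)| ≤ B := by
    intro i
    fin_cases i
    · show |(w 0 : ℝ)| ≤ B
      linarith
    · show |(w 1 : ℝ)| ≤ B
      linarith
    · show |(w 2 : ℝ)| ≤ B
      linarith
    · show |(w 3 : ℝ)| ≤ B
      simp only [Lf, toR] at h2
      rw [abs_le] at *
      constructor <;> linarith
  rw [Set.mem_Icc]
  constructor <;> intro i <;> have := abs_le.1 (key i)
  · exact_mod_cast this.1
  · exact_mod_cast this.2

theorem best_step (a b c : ℝ) (hL : ∀ w : Fin 4 → ℤ, w ≠ 0 → Lf a b c (toR w) ≠ 0)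
    (z : Fin 4 → ℤ) (hz : 0 < Lf a b c (toR z) ∧ Lf a b c (toR z) ≤ 1 ∧
      ∀ w : Fin 4 → ℤ, w ≠ 0 → ht w ≤ ht z → Lf a b c (toR z) ≤ |Lf a b c (toR w)|) :
    ∃ z' : Fin 4 → ℤ, (0 < Lf a b c (toR z') ∧ Lf a b c (toR z') ≤ 1 ∧
      ∀ w : Fin 4 → ℤ, w ≠ 0 → ht w ≤ ht z' → Lf a b c (toR z') ≤ |Lf a b c (toR w)|) ∧
      Lf a b c (toR z') < Lf a b c (toR z) ∧ ht z < ht z' ∧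
      ∀ w : Fin 4 → ℤ, w ≠ 0 → ht w < ht z' → Lf a b c (toR z) ≤ |Lf a b c (toR w)| := by
  classical
  obtain ⟨hpos, hle, hQ⟩ := hz
  have hex : ∃ H : ℕ, ∃ w : Fin 4 → ℤ, w ≠ 0 ∧ ht w = H ∧ |Lf a b c (toR w)| < Lf a b c (toR z) := by
    obtain ⟨N, hN⟩ := exists_nat_gt (1 / Lf a b c (toR z))
    have hN0 : (0 : ℝ) < N := lt_trans (by positivity) hN
    have hN1 : 0 < N := by exact_mod_cast hN0
    obtain ⟨w, h1, h2, h3⟩ := dirichlet a b c N hN1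
    refine ⟨ht w, w, ?_, rfl, ?_⟩
    · rintro rfl; simp [ht] at h1
    · refine lt_of_le_of_lt h3 ?_
      rw [div_lt_iff₀ hpos] at hN
      rw [div_lt_iff₀ (by positivity)]
      have : (1 : ℝ) ≤ N := by exact_mod_cast hN1
      have h3 : (N : ℝ) ≤ (N : ℝ) ^ 3 := by nlinarith [mul_nonneg hN0.le hN0.le]
      nlinarith
  set H := Nat.find hex with hH
  obtain ⟨w0, hw0, hw0H, hw0L⟩ := Nat.find_spec hex
  have hmin : ∀ w : Fin 4 → ℤ, w ≠ 0 → ht w < H → Lf a b c (toR z) ≤ |Lf a b c (toR w)| := by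
    intro w hw hlt
    by_contra! h
    exact Nat.find_min hex hlt ⟨w, hw, rfl, h⟩
  let T : Set (Fin 4 → ℤ) := {w | w ≠ 0 ∧ ht w = H ∧ |Lf a b c (toR w)| < Lf a b c (toR z)}
  have hTf : T.Finite := (finite_low a b c H).subset (fun w hw => ⟨hw.2.1.le, hw.2.2.le.trans hle⟩)
  obtain ⟨v, hv, hvmin⟩ := Set.exists_min_image T (fun w => |Lf a b c (toR w)|) hTf ⟨w0, hw0, hw0H, hw0L⟩
  have hv0 : Lf a b c (toR v) ≠ 0 := hL v hv.1
  obtain ⟨v', hv'L, hv'h⟩ : ∃ v' : Fin 4 → ℤ, Lf a b c (toR v') = |Lf a b c (toR v)| ∧ ht v' = ht v := by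
    rcases lt_or_gt_of_ne hv0 with h | h
    · exact ⟨-v, by rw [Lf_neg, abs_of_neg h], ht_neg v⟩
    · exact ⟨v, by rw [abs_of_pos h], rfl⟩
  refine ⟨v', ⟨?_, ?_, ?_⟩, ?_, ?_, ?_⟩
  · rw [hv'L]; positivity
  · rw [hv'L]; exact hv.2.2.le.trans hle
  · intro w hw hwh
    rw [hv'L]
    rw [hv'h, hv.2.1] at hwh
    by_cases h : |Lf a b c (toR w)| < Lf a b c (toR z)
    · rcases hwh.lt_or_eq with h1 | h1
      · exact absurd (hmin w hw h1) (not_le.2 h)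
      · exact hvmin w ⟨hw, h1, h⟩
    · exact hv.2.2.le.trans (not_lt.1 h)
  · rw [hv'L]; exact hv.2.2
  · by_contra! h
    have := hQ v hv.1 (by omega)
    exact absurd hv.2.2 (not_lt.2 this)
  · intro w hw hlt
    exact hmin w hw (by rw [hv'h, hv.2.1] at hlt; exact hlt)

theorem exists_bestSeq (a b c : ℝ) (hL : ∀ w : Fin 4 → ℤ, w ≠ 0 → Lf a b c (toR w) ≠ 0) :
    ∃ z, BestSeq a b c z := by
  let Q : (Fin 4 → ℤ) → Prop := fun z => 0 < Lf a b c (toR z) ∧ Lf a b c (toR z) ≤ 1 ∧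
      ∀ w : Fin 4 → ℤ, w ≠ 0 → ht w ≤ ht z → Lf a b c (toR z) ≤ |Lf a b c (toR w)|
  have h0 : Q ![0, 0, 0, -1] := by
    refine ⟨by simp [Lf, toR], by simp [Lf, toR], ?_⟩
    intro w hw hh
    have h3 : w 0 = 0 ∧ w 1 = 0 ∧ w 2 = 0 := by simp [ht] at hh; omega
    have h4 : w 3 ≠ 0 := by
      intro h
      apply hw
      funext i
      fin_cases i <;> simp [h, h3]
    have : (1 : ℝ) ≤ |(w 3 : ℝ)| := by exact_mod_cast Int.one_le_abs h4
    simpa [Lf, toR, h3] using this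
  choose! f hf using best_step a b c hL
  let s : ℕ → Fin 4 → ℤ := fun n => f^[n] ![0, 0, 0, -1]
  have hs : ∀ n, s (n + 1) = f (s n) := fun n => Function.iterate_succ_apply' f n _
  have hQ : ∀ n, Q (s n) := by
    intro n
    induction n with
    | zero => exact h0
    | succ n ih => rw [hs]; exact (hf _ ih).1
  refine ⟨s, fun k => (hQ k).1, fun k => ?_, fun k => ?_, fun k => ?_⟩
  · rw [hs]; exact (hf _ (hQ k)).2.1
  · rw [hs]; exact (hf _ (hQ k)).2.2.1
  · rw [hs]; exact (hf _ (hQ k)).2.2.2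

theorem Lf_comb (a b c s t : ℝ) (u v : Fin 4 → ℝ) :
    Lf a b c (s • u + t • v) = s * Lf a b c u + t * Lf a b c v := by
  simp [Lf]; ring

theorem Lf_add (a b c : ℝ) (u v : Fin 4 → ℝ) :
    Lf a b c (u + v) = Lf a b c u + Lf a b c v := by
  simp [Lf]; ring

theorem Lf_smul (a b c s : ℝ) (u : Fin 4 → ℝ) :
    Lf a b c (s • u) = s * Lf a b c u := by
  simp [Lf]; ring

theorem abs_le_ht' (w : Fin 4 → ℤ) (i : Fin 4) (hi : i ≠ 3) : |toR w i| ≤ ht w := by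
  obtain ⟨h0, h1, h2⟩ := abs_le_ht w
  fin_cases i
  · exact h0
  · exact h1
  · exact h2
  · exact absurd rfl hi

theorem BestSeq.pair {a b c : ℝ} {z : ℕ → Fin 4 → ℤ} (h : BestSeq a b c z) (k : ℕ) :
    LinearIndependent ℝ ![toR (z k), toR (z (k + 1))] := by
  rw [LinearIndependent.pair_iff]
  intro s t hst
  have hL := congrArg (Lf a b c) hst
  rw [Lf_comb] at hL
  have h00 : Lf a b c 0 = 0 := by simp [Lf]
  rw [h00] at hL
  obtain ⟨i, hi, hX⟩ := ht_eq (z (k + 1))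
  have hc := congrFun hst i
  simp only [Pi.add_apply, Pi.smul_apply, smul_eq_mul, Pi.zero_apply] at hc
  have hlt : (ht (z k) : ℝ) < ht (z (k + 1)) := by exact_mod_cast h.hlt k
  have hle := abs_le_ht' (z k) i hi
  have hnn : (0 : ℝ) ≤ ht (z k) := by positivity
  have e1 : |t| * ht (z (k + 1)) = |s| * |toR (z k) i| := by
    rw [← hX, ← abs_mul, ← abs_mul]
    have : s * toR (z k) i = - (t * (z (k + 1) i : ℝ)) := by
      simp only [toR] at *; linarith
    rw [this, abs_neg]
  have e2 : |s| * Lf a b c (toR (z k)) = |t| * Lf a b c (toR (z (k + 1))) := by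
    have : s * Lf a b c (toR (z k)) = - (t * Lf a b c (toR (z (k + 1)))) := by linarith
    have := congrArg abs this
    rwa [abs_neg, abs_mul, abs_mul, abs_of_pos (h.pos k), abs_of_pos (h.pos (k + 1))] at this
  have hts : |t| ≤ |s| := by
    have : |t| * ht (z (k + 1)) ≤ |s| * ht (z (k + 1)) := by
      rw [e1]; gcongr; linarith
    exact le_of_mul_le_mul_right this (by linarith)
  have hs : |s| = 0 := by
    by_contra hne
    have hp : 0 < |s| := lt_of_le_of_ne (abs_nonneg s) (Ne.symm hne)
    have := h.dec k
    have h1 := h.pos (k + 1)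
    nlinarith
  have ht0 : |t| = 0 := le_antisymm (by linarith) (abs_nonneg t)
  exact ⟨abs_eq_zero.1 hs, abs_eq_zero.1 ht0⟩

theorem BestSeq.integral {a b c : ℝ} {z : ℕ → Fin 4 → ℤ} (h : BestSeq a b c z) (k : ℕ)
    (w : Fin 4 → ℤ) (hw : toR w ∈ Submodule.span ℝ {toR (z k), toR (z (k + 1))}) :
    ∃ s t : ℤ, toR w = (s : ℝ) • toR (z k) + (t : ℝ) • toR (z (k + 1)) := by
  obtain ⟨s, t, hst⟩ := Submodule.mem_span_pair.1 hw
  refine ⟨round s, round t, ?_⟩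
  set w' : Fin 4 → ℤ := w - round s • z k - round t • z (k + 1) with hw'
  have e : toR w' = (s - round s) • toR (z k) + (t - round t) • toR (z (k + 1)) := by
    funext i
    have := congrFun hst i
    simp [toR] at this
    simp [toR, hw']
    linarith
  have hs := abs_sub_round s
  have ht' := abs_sub_round t
  have hlt : (ht (z k) : ℝ) < ht (z (k + 1)) := by exact_mod_cast h.hlt k
  have hnn : (0 : ℝ) ≤ ht (z k) := by positivity
  have hi : ∀ i, i ≠ 3 → |(w' i : ℝ)| < ht (z (k + 1)) := by
    intro i hi
    have e' : (w' i : ℝ) = (s - round s) * toR (z k) i + (t - round t) * toR (z (k + 1)) i := by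
      have := congrFun e i
      simpa [toR] using this
    have h1 := abs_le_ht' (z k) i hi
    have h2 := abs_le_ht' (z (k + 1)) i hi
    rw [e']
    refine lt_of_le_of_lt (abs_add_le _ _) ?_
    rw [abs_mul, abs_mul]
    have p1 : |s - round s| * |toR (z k) i| ≤ 1 / 2 * ht (z k) := by gcongr
    have p2 : |t - round t| * |toR (z (k + 1)) i| ≤ 1 / 2 * ht (z (k + 1)) := by gcongr
    linarith
  have hw0 : w' = 0 := by
    by_contra hne
    have hb := h.best k w' hne (ht_lt_of _ _ (hi 0 (by decide)) (hi 1 (by decide)) (hi 2 (by decide)))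
    rw [e, Lf_comb] at hb
    have q := abs_add_le ((s - round s) * Lf a b c (toR (z k))) ((t - round t) * Lf a b c (toR (z (k + 1))))
    rw [abs_mul, abs_mul, abs_of_pos (h.pos k), abs_of_pos (h.pos (k + 1))] at q
    have := h.dec k
    have := h.pos k
    have := h.pos (k + 1)
    nlinarith
  funext i
  have := congrFun hw0 i
  simp [hw'] at this
  have h2 : (w i : ℝ) - round s * z k i - round t * z (k + 1) i = 0 := by exact_mod_cast this
  simp [toR]
  linarith

theorem BestSeq.delta {a b c : ℝ} {z : ℕ → Fin 4 → ℤ} (h : BestSeq a b c z) (k : ℕ) :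
    ∃ i : Fin 4, i ≠ 3 ∧ (ht (z (k + 1)) : ℝ) * Lf a b c (toR (z k)) / 2 ≤
      |toR (z k) i * Lf a b c (toR (z (k + 1))) - toR (z (k + 1)) i * Lf a b c (toR (z k))| := by
  have hlt : (ht (z k) : ℝ) < ht (z (k + 1)) := by exact_mod_cast h.hlt k
  have hnn : (0 : ℝ) ≤ ht (z k) := by positivity
  have hd := h.dec k
  have hp := h.pos k
  have hp' := h.pos (k + 1)
  by_cases hc : Lf a b c (toR (z (k + 1))) ≤ Lf a b c (toR (z k)) / 2
  · obtain ⟨i, hi, hX⟩ := ht_eq (z (k + 1))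
    refine ⟨i, hi, ?_⟩
    have h1 := abs_le_ht' (z k) i hi
    have h2 := abs_sub_abs_le_abs_sub (toR (z (k + 1)) i * Lf a b c (toR (z k)))
      (toR (z k) i * Lf a b c (toR (z (k + 1))))
    rw [abs_sub_comm] at h2
    refine le_trans ?_ h2
    rw [abs_mul, abs_mul, abs_of_pos hp, abs_of_pos hp']
    have hX' : |toR (z (k + 1)) i| = ht (z (k + 1)) := hX
    rw [hX']
    have : |toR (z k) i| * Lf a b c (toR (z (k + 1))) ≤ ht (z (k + 1)) * (Lf a b c (toR (z k)) / 2) := by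
      gcongr; linarith
    linarith
  · push Not at hc
    set d : Fin 4 → ℤ := z (k + 1) - z k with hd'
    have hdL : Lf a b c (toR d) = Lf a b c (toR (z (k + 1))) - Lf a b c (toR (z k)) := by
      simp [Lf, toR, hd']; ring
    have hd0 : d ≠ 0 := by
      intro h0
      have : z (k + 1) = z k := sub_eq_zero.1 h0
      rw [this] at hlt
      exact lt_irrefl _ hlt
    have hdh : ht (z (k + 1)) ≤ ht d := by
      by_contra! hh
      have := h.best k d hd0 hh
      rw [hdL, abs_of_neg (by linarith)] at this
      linarith
    obtain ⟨i, hi, hX⟩ := ht_eq d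
    refine ⟨i, hi, ?_⟩
    have hX2 : (ht (z (k + 1)) : ℝ) ≤ |toR (z (k + 1)) i - toR (z k) i| := by
      have : (d i : ℝ) = toR (z (k + 1)) i - toR (z k) i := by simp [hd', toR]
      rw [← this, hX]
      exact_mod_cast hdh
    have h1 := abs_le.1 (abs_le_ht' (z k) i hi)
    have h2 := abs_le.1 (abs_le_ht' (z (k + 1)) i hi)
    set x := toR (z k) i
    set x' := toR (z (k + 1)) i
    set ζ := Lf a b c (toR (z k))
    set ζ' := Lf a b c (toR (z (k + 1)))
    rcases le_or_gt 0 (x' - x) with hs | hs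
    · rw [abs_of_nonneg hs] at hX2
      have hx' : 0 ≤ x' := by linarith
      have hx : x ≤ 0 := by linarith
      rw [abs_sub_comm]
      refine le_trans ?_ (le_abs_self _)
      nlinarith
    · rw [abs_of_neg hs] at hX2
      have hx' : x' ≤ 0 := by linarith
      have hx : 0 ≤ x := by linarith
      refine le_trans ?_ (le_abs_self _)
      nlinarith

theorem BestSeq.compare {a b c : ℝ} {z : ℕ → Fin 4 → ℤ} (h : BestSeq a b c z) (k n : ℕ)
    (h1 : toR (z n) ∈ Submodule.span ℝ {toR (z k), toR (z (k + 1))})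
    (h2 : toR (z (n + 1)) ∈ Submodule.span ℝ {toR (z k), toR (z (k + 1))}) :
    (ht (z (k + 1)) : ℝ) * Lf a b c (toR (z k)) ≤
      4 * (ht (z (n + 1)) * Lf a b c (toR (z n))) := by
  obtain ⟨s, t, e1⟩ := h.integral k _ h1
  obtain ⟨s', t', e2⟩ := h.integral k _ h2
  obtain ⟨i, hi, hD⟩ := h.delta k
  have hne : s * t' - s' * t ≠ 0 := by
    intro h0
    have h0' : (s : ℝ) * t' - s' * t = 0 := by exact_mod_cast h0
    have hp := LinearIndependent.pair_iff.1 (h.pair n)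
    have r1 := hp (t' : ℝ) (-(t : ℝ)) (by
      rw [e1, e2]
      funext j
      simp
      linear_combination (toR (z k) j) * h0')
    have r2 := hp (s' : ℝ) (-(s : ℝ)) (by
      rw [e1, e2]
      funext j
      simp
      linear_combination (-toR (z (k + 1)) j) * h0')
    have hs : (s : ℝ) = 0 := by linarith [r2.2]
    have htt : (t : ℝ) = 0 := by linarith [r1.2]
    have := h.pos n
    rw [e1, Lf_comb, hs, htt] at this
    simp at this
  have h1le : (1 : ℝ) ≤ |(s : ℝ) * t' - s' * t| := by exact_mod_cast Int.one_le_abs hne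
  have e : toR (z n) i * Lf a b c (toR (z (n + 1))) - toR (z (n + 1)) i * Lf a b c (toR (z n))
      = ((s : ℝ) * t' - s' * t) * (toR (z k) i * Lf a b c (toR (z (k + 1))) - toR (z (k + 1)) i * Lf a b c (toR (z k))) := by
    rw [e1, e2, Lf_comb, Lf_comb]
    simp
    ring
  have hup : |toR (z n) i * Lf a b c (toR (z (n + 1))) - toR (z (n + 1)) i * Lf a b c (toR (z n))|
      ≤ 2 * (ht (z (n + 1)) * Lf a b c (toR (z n))) := by
    refine (abs_sub _ _).trans ?_
    rw [abs_mul, abs_mul, abs_of_pos (h.pos n), abs_of_pos (h.pos (n + 1))]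
    have q1 := abs_le_ht' (z n) i hi
    have q2 := abs_le_ht' (z (n + 1)) i hi
    have hlt : (ht (z n) : ℝ) < ht (z (n + 1)) := by exact_mod_cast h.hlt n
    have p1 : |toR (z n) i| * Lf a b c (toR (z (n + 1))) ≤ ht (z (n + 1)) * Lf a b c (toR (z n)) := by
      have := h.pos (n + 1)
      have := h.dec n
      gcongr
      linarith
    have p2 : |toR (z (n + 1)) i| * Lf a b c (toR (z n)) ≤ ht (z (n + 1)) * Lf a b c (toR (z n)) := by
      have := h.pos n
      gcongr
    linarith
  rw [e, abs_mul] at hup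
  have := le_mul_of_one_le_left (abs_nonneg (toR (z k) i * Lf a b c (toR (z (k + 1))) - toR (z (k + 1)) i * Lf a b c (toR (z k)))) h1le
  linarith

/-- 4 by 4 determinant by rows -/
noncomputable def D4 (e w u v : Fin 4 → ℝ) : ℝ := (Matrix.of ![e, w, u, v]).det

theorem li3 (w u v : Fin 4 → ℝ) : LinearIndependent ℝ ![w, u, v] ↔
    w ∉ Submodule.span ℝ {u, v} ∧ LinearIndependent ℝ ![u, v] := by
  have : (![w, u, v] : Fin 3 → Fin 4 → ℝ) = Fin.cons w ![u, v] := rfl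
  rw [this, linearIndependent_finCons, and_comm]
  simp [Matrix.range_cons, Matrix.range_empty, Set.pair_comm]

theorem li4 (e w u v : Fin 4 → ℝ) : D4 e w u v ≠ 0 ↔
    e ∉ Submodule.span ℝ {w, u, v} ∧ LinearIndependent ℝ ![w, u, v] := by
  have h1 : D4 e w u v ≠ 0 ↔ LinearIndependent ℝ ![e, w, u, v] := by
    rw [D4, ← isUnit_iff_ne_zero, ← Matrix.isUnit_iff_isUnit_det, ← Matrix.linearIndependent_rows_iff_isUnit]
    rfl
  have : (![e, w, u, v] : Fin 4 → Fin 4 → ℝ) = Fin.cons e ![w, u, v] := rfl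
  rw [h1, this, linearIndependent_finCons, and_comm]
  have : Set.range ![w, u, v] = {w, u, v} := by
    ext x; simp [Matrix.range_cons, Matrix.range_empty]; tauto
  rw [this]

theorem minor_bound (p0 p1 p2 q0 q1 q2 r0 r1 r2 P Q R : ℝ)
    (a0 : |p0| ≤ P) (a1 : |p1| ≤ P) (a2 : |p2| ≤ P)
    (b0 : |q0| ≤ Q) (b1 : |q1| ≤ Q) (b2 : |q2| ≤ Q)
    (c0 : |r0| ≤ R) (c1 : |r1| ≤ R) (c2 : |r2| ≤ R) :
    |p0 * q1 * r2 - p0 * q2 * r1 - p1 * q0 * r2 + p1 * q2 * r0 + p2 * q0 * r1 - p2 * q1 * r0|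
      ≤ 6 * (P * Q * R) := by
  have hP : 0 ≤ P := (abs_nonneg _).trans a0
  have hQ : 0 ≤ Q := (abs_nonneg _).trans b0
  have key : ∀ x y t : ℝ, |x| ≤ P → |y| ≤ Q → |t| ≤ R → |x * y * t| ≤ P * Q * R := by
    intro x y t h1 h2 h3
    rw [abs_mul, abs_mul]; gcongr
  have k1 := abs_le.1 (key _ _ _ a0 b1 c2)
  have k2 := abs_le.1 (key _ _ _ a0 b2 c1)
  have k3 := abs_le.1 (key _ _ _ a1 b0 c2)
  have k4 := abs_le.1 (key _ _ _ a1 b2 c0)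
  have k5 := abs_le.1 (key _ _ _ a2 b0 c1)
  have k6 := abs_le.1 (key _ _ _ a2 b1 c0)
  rw [abs_le]
  constructor <;> linarith [k1.1, k1.2, k2.1, k2.2, k3.1, k3.2, k4.1, k4.2, k5.1, k5.2, k6.1, k6.2]

theorem D4_bound (a b c : ℝ) (u : Fin 4 → Fin 4 → ℝ) (X ζ : Fin 4 → ℝ)
    (hX : ∀ i j, j ≠ 3 → |u i j| ≤ X i) (hζ : ∀ i, |Lf a b c (u i)| ≤ ζ i) :
    |D4 (u 0) (u 1) (u 2) (u 3)| ≤ 6 * (ζ 0 * (X 1 * X 2 * X 3) + ζ 1 * (X 0 * X 2 * X 3)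
      + ζ 2 * (X 0 * X 1 * X 3) + ζ 3 * (X 0 * X 1 * X 2)) := by
  let m : Fin 4 → Fin 4 → Fin 4 → ℝ := fun i j k =>
    u i 0 * u j 1 * u k 2 - u i 0 * u j 2 * u k 1 - u i 1 * u j 0 * u k 2 + u i 1 * u j 2 * u k 0
      + u i 2 * u j 0 * u k 1 - u i 2 * u j 1 * u k 0
  have hm : ∀ i j k, |m i j k| ≤ 6 * (X i * X j * X k) := fun i j k =>
    minor_bound _ _ _ _ _ _ _ _ _ _ _ _ (hX i 0 (by decide)) (hX i 1 (by decide)) (hX i 2 (by decide))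
      (hX j 0 (by decide)) (hX j 1 (by decide)) (hX j 2 (by decide))
      (hX k 0 (by decide)) (hX k 1 (by decide)) (hX k 2 (by decide))
  have e : D4 (u 0) (u 1) (u 2) (u 3) = Lf a b c (u 0) * m 1 2 3 - Lf a b c (u 1) * m 0 2 3
      + Lf a b c (u 2) * m 0 1 3 - Lf a b c (u 3) * m 0 1 2 := by
    simp only [m, Lf, D4]
    rw [Matrix.det_succ_row_zero]
    simp [Fin.sum_univ_succ, Matrix.det_fin_three, Fin.succAbove, Matrix.submatrix]
    ring
  have key : ∀ i j k l, |Lf a b c (u i) * m j k l| ≤ ζ i * (6 * (X j * X k * X l)) := by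
    intro i j k l
    rw [abs_mul]
    have : 0 ≤ ζ i := (abs_nonneg _).trans (hζ i)
    exact mul_le_mul (hζ i) (hm j k l) (abs_nonneg _) this
  have k1 := abs_le.1 (key 0 1 2 3)
  have k2 := abs_le.1 (key 1 0 2 3)
  have k3 := abs_le.1 (key 2 0 1 3)
  have k4 := abs_le.1 (key 3 0 1 2)
  rw [e, abs_le]
  constructor <;> linarith [k1.1, k1.2, k2.1, k2.2, k3.1, k3.2, k4.1, k4.2]

theorem D4_scale (w u v w' u' v' : Fin 4 → ℝ)
    (hw : w' ∈ Submodule.span ℝ {w, u, v}) (hu : u' ∈ Submodule.span ℝ {w, u, v})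
    (hv : v' ∈ Submodule.span ℝ {w, u, v}) :
    ∃ κ : ℝ, ∀ e, D4 e w' u' v' = κ * D4 e w u v := by
  obtain ⟨a1, a2, a3, rfl⟩ := Submodule.mem_span_triple.1 hw
  obtain ⟨b1, b2, b3, rfl⟩ := Submodule.mem_span_triple.1 hu
  obtain ⟨c1, c2, c3, rfl⟩ := Submodule.mem_span_triple.1 hv
  refine ⟨(!![1, 0, 0, 0; 0, a1, a2, a3; 0, b1, b2, b3; 0, c1, c2, c3] : Matrix (Fin 4) (Fin 4) ℝ).det, fun e => ?_⟩
  rw [D4, D4, ← Matrix.det_mul]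
  congr 1
  ext i j
  fin_cases i <;> simp [Matrix.mul_apply, Fin.sum_univ_succ] <;> ring

theorem D4_int (e w u v : Fin 4 → ℤ) (h : D4 (toR e) (toR w) (toR u) (toR v) ≠ 0) :
    1 ≤ |D4 (toR e) (toR w) (toR u) (toR v)| := by
  have : D4 (toR e) (toR w) (toR u) (toR v) = (((Matrix.of ![e, w, u, v]).det : ℤ) : ℝ) := by
    rw [D4, Int.cast_det]
    congr 1
    ext i j
    fin_cases i <;> rfl
  rw [this] at h ⊢
  have h' : (Matrix.of ![e, w, u, v]).det ≠ 0 := by exact_mod_cast h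
  exact_mod_cast Int.one_le_abs h'

/-- The triple starting at `k` is independent. -/
def Good (z : ℕ → Fin 4 → ℤ) (k : ℕ) : Prop :=
  LinearIndependent ℝ ![toR (z (k + 2)), toR (z k), toR (z (k + 1))]

/-- Span of the triple starting at `k`. -/
def S3 (z : ℕ → Fin 4 → ℤ) (k : ℕ) : Submodule ℝ (Fin 4 → ℝ) :=
  Submodule.span ℝ {toR (z (k + 2)), toR (z k), toR (z (k + 1))}

theorem S3_mem (z : ℕ → Fin 4 → ℤ) (k : ℕ) :
    toR (z k) ∈ S3 z k ∧ toR (z (k + 1)) ∈ S3 z k ∧ toR (z (k + 2)) ∈ S3 z k := by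
  refine ⟨Submodule.subset_span ?_, Submodule.subset_span ?_, Submodule.subset_span ?_⟩ <;> simp

theorem S3_le (z : ℕ → Fin 4 → ℤ) (k : ℕ) (S : Submodule ℝ (Fin 4 → ℝ))
    (h0 : toR (z k) ∈ S) (h1 : toR (z (k + 1)) ∈ S) (h2 : toR (z (k + 2)) ∈ S) : S3 z k ≤ S := by
  rw [S3, Submodule.span_le]
  rintro x (rfl | rfl | rfl) <;> assumption

theorem dichotomy {a b c : ℝ} {z : ℕ → Fin 4 → ℤ} (h : BestSeq a b c z)
    (J : ℕ) (hA : ¬ ∃ k ≥ J, ∃ n ≥ k + 1,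
      toR (z n) ∈ Submodule.span ℝ {toR (z (k + 1)), toR (z (k + 2))} ∧
      toR (z (n + 1)) ∈ Submodule.span ℝ {toR (z (k + 1)), toR (z (k + 2))} ∧
      D4 (toR (z (n + 2))) (toR (z (k + 2))) (toR (z k)) (toR (z (k + 1))) ≠ 0)
    (k0 : ℕ) (hk0 : J ≤ k0) (hg : Good z k0) : ∀ n ≥ k0, toR (z n) ∈ S3 z k0 := by
  have P : ∀ d, ∃ k ≥ J, k + 1 ≤ k0 + 1 + d ∧ Good z k ∧ S3 z k ≤ S3 z k0 ∧
      toR (z (k0 + 1 + d)) ∈ Submodule.span ℝ {toR (z (k + 1)), toR (z (k + 2))} ∧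
      toR (z (k0 + 1 + d + 1)) ∈ Submodule.span ℝ {toR (z (k + 1)), toR (z (k + 2))} := by
    intro d
    induction d with
    | zero =>
      exact ⟨k0, hk0, le_rfl, hg, le_rfl, Submodule.subset_span (by simp), Submodule.subset_span (by simp)⟩
    | succ d ih =>
      obtain ⟨k, hk, hkd, hgk, hS, m1, m2⟩ := ih
      set n := k0 + 1 + d with hn
      have hin : toR (z (n + 2)) ∈ S3 z k := by
        by_contra hout
        exact hA ⟨k, hk, n, hkd, m1, m2, (li4 _ _ _ _).2 ⟨hout, hgk⟩⟩
      have hsub : Submodule.span ℝ {toR (z (k + 1)), toR (z (k + 2))} ≤ S3 z k := by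
        rw [Submodule.span_le]
        have := S3_mem z k
        rintro x (rfl | rfl)
        · exact this.2.1
        · exact this.2.2
      by_cases hc : toR (z (n + 2)) ∈ Submodule.span ℝ {toR (z (k + 1)), toR (z (k + 2))}
      · exact ⟨k, hk, by omega, hgk, hS, m2, hc⟩
      · have hle : Submodule.span ℝ {toR (z n), toR (z (n + 1))} ≤
            Submodule.span ℝ {toR (z (k + 1)), toR (z (k + 2))} := by
          rw [Submodule.span_le]; rintro x (rfl | rfl) <;> assumption
        refine ⟨n, by omega, by omega, (li3 _ _ _).2 ⟨fun hh => hc (hle hh), h.pair n⟩, ?_, ?_, ?_⟩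
        · exact S3_le z n _ (hS (hsub m1)) (hS (hsub m2)) (hS hin)
        · exact Submodule.subset_span (Or.inl rfl)
        · exact Submodule.subset_span (Or.inr rfl)
  intro n hn
  rcases hn.lt_or_eq with hlt | heq
  · obtain ⟨k, -, -, -, hS, m1, -⟩ := P (n - (k0 + 1))
    have e : k0 + 1 + (n - (k0 + 1)) = n := by omega
    rw [e] at m1
    refine hS ((Submodule.span_le.2 ?_ : Submodule.span ℝ {toR (z (k + 1)), toR (z (k + 2))} ≤ _) m1)
    have := S3_mem z k
    rintro x (rfl | rfl)
    · exact this.2.1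
    · exact this.2.2
  · rw [← heq]; exact (S3_mem z k0).1

theorem not_good {a b c : ℝ} {z : ℕ → Fin 4 → ℤ} (h : BestSeq a b c z)
    (J : ℕ) (hA : ∀ k ≥ J, ¬ Good z k) (n : ℕ) (hn : J ≤ n) :
    toR (z n) ∈ Submodule.span ℝ {toR (z J), toR (z (J + 1))} ∧
    toR (z (n + 1)) ∈ Submodule.span ℝ {toR (z J), toR (z (J + 1))} := by
  induction n, hn using Nat.le_induction with
  | base => exact ⟨Submodule.subset_span (by simp), Submodule.subset_span (by simp)⟩
  | succ n hn ih =>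
    refine ⟨ih.2, ?_⟩
    have hle : Submodule.span ℝ {toR (z n), toR (z (n + 1))} ≤
        Submodule.span ℝ {toR (z J), toR (z (J + 1))} := by
      rw [Submodule.span_le]
      rintro x (rfl | rfl)
      · exact ih.1
      · exact ih.2
    by_contra hc
    exact hA n hn ((li3 _ _ _).2 ⟨fun hh => hc (hle hh), h.pair n⟩)

/-- In the degenerate case, a uniform lower bound. -/
theorem degenerate {a b c : ℝ} {z : ℕ → Fin 4 → ℤ} (h : BestSeq a b c z)
    (k0 : ℕ) (hg : Good z k0) (hS : ∀ n ≥ k0, toR (z n) ∈ S3 z k0) :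
    ∃ δ > 0, ∀ n ≥ k0, Good z n →
      δ ≤ Lf a b c (toR (z n)) * (ht (z (n + 1)) * ht (z (n + 2))) := by
  -- a standard basis vector outside
  have h1 : ∃ e : Fin 4 → ℤ, toR e ∉ S3 z k0 := by
    by_contra! hc
    have htop : S3 z k0 = ⊤ := by
      rw [eq_top_iff, ← (Pi.basisFun ℝ (Fin 4)).span_eq, Submodule.span_le]
      rintro x ⟨i, rfl⟩
      have := hc (Pi.single i 1)
      have e : toR (Pi.single i 1) = Pi.basisFun ℝ (Fin 4) i := by
        funext j
        simp [toR, Pi.single_apply]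
      rw [e] at this
      exact this
    have hr : Module.finrank ℝ (S3 z k0) = 3 := by
      have := finrank_span_eq_card hg
      have e : Set.range ![toR (z (k0 + 2)), toR (z k0), toR (z (k0 + 1))] = {toR (z (k0 + 2)), toR (z k0), toR (z (k0 + 1))} := by
        ext x; simp [Matrix.range_cons, Matrix.range_empty]; tauto
      rw [e] at this
      exact this.trans rfl
    rw [htop] at hr
    simp at hr
  -- a vector of the kernel outside
  have h2 : ∃ f : Fin 4 → ℝ, (∀ j, j ≠ 3 → |f j| ≤ 1) ∧ Lf a b c f = 0 ∧ f ∉ S3 z k0 := by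
    by_contra! hc
    have m0 : ![1, 0, 0, a] ∈ S3 z k0 := hc _ (by intro j hj; fin_cases j <;> simp at *) (by simp [Lf])
    have m1 : ![0, 1, 0, b] ∈ S3 z k0 := hc _ (by intro j hj; fin_cases j <;> simp at *) (by simp [Lf])
    have m2 : ![0, 0, 1, c] ∈ S3 z k0 := hc _ (by intro j hj; fin_cases j <;> simp at *) (by simp [Lf])
    have m3 : ![0, 0, 0, 1] ∈ S3 z k0 := by
      have hp := h.pos k0
      have : ![0, 0, 0, 1] = (Lf a b c (toR (z k0)))⁻¹ • (toR (z k0) 0 • ![1, 0, 0, a] + toR (z k0) 1 • ![0, 1, 0, b]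
          + toR (z k0) 2 • ![0, 0, 1, c] - toR (z k0)) := by
        rw [eq_inv_smul_iff₀ hp.ne']
        funext i
        fin_cases i <;> simp [Lf]
        ring
      rw [this]
      refine Submodule.smul_mem _ _ (Submodule.sub_mem _ (Submodule.add_mem _ (Submodule.add_mem _ ?_ ?_) ?_) (S3_mem z k0).1)
      · exact Submodule.smul_mem _ _ m0
      · exact Submodule.smul_mem _ _ m1
      · exact Submodule.smul_mem _ _ m2
    obtain ⟨e, he⟩ := h1
    apply he
    have : toR e = toR e 0 • ![1, 0, 0, a] + toR e 1 • ![0, 1, 0, b] + toR e 2 • ![0, 0, 1, c]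
        + (- Lf a b c (toR e)) • ![0, 0, 0, 1] := by
      funext i
      fin_cases i <;> simp [Lf]
      ring
    rw [this]
    refine Submodule.add_mem _ (Submodule.add_mem _ (Submodule.add_mem _ ?_ ?_) ?_) ?_
    · exact Submodule.smul_mem _ _ m0
    · exact Submodule.smul_mem _ _ m1
    · exact Submodule.smul_mem _ _ m2
    · exact Submodule.smul_mem _ _ m3
  obtain ⟨e, he⟩ := h1
  obtain ⟨f, hf1, hf2, hf⟩ := h2
  have hE : D4 (toR e) (toR (z (k0 + 2))) (toR (z k0)) (toR (z (k0 + 1))) ≠ 0 := (li4 _ _ _ _).2 ⟨he, hg⟩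
  have hF : D4 f (toR (z (k0 + 2))) (toR (z k0)) (toR (z (k0 + 1))) ≠ 0 := (li4 _ _ _ _).2 ⟨hf, hg⟩
  set E := D4 (toR e) (toR (z (k0 + 2))) (toR (z k0)) (toR (z (k0 + 1)))
  set F := D4 f (toR (z (k0 + 2))) (toR (z k0)) (toR (z (k0 + 1)))
  have hE' : 0 < |E| := abs_pos.2 hE
  have hF' : 0 < |F| := abs_pos.2 hF
  refine ⟨|F| / |E| / 18, by positivity, ?_⟩
  intro n hn hgn
  obtain ⟨κ, hκ⟩ := D4_scale _ _ _ _ _ _ (hS (n + 2) (by omega)) (hS n hn) (hS (n + 1) (by omega))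
  have hSn : S3 z n ≤ S3 z k0 := S3_le z n _ (hS n hn) (hS (n + 1) (by omega)) (hS (n + 2) (by omega))
  have hEn := D4_int _ _ _ _ ((li4 (toR e) _ _ _).2 ⟨fun hh => he (hSn hh), hgn⟩)
  rw [hκ, abs_mul] at hEn
  have hFn : |D4 f (toR (z (n + 2))) (toR (z n)) (toR (z (n + 1)))| = |κ| * |F| := by rw [hκ, abs_mul]
  have hκ1 : 1 / |E| ≤ |κ| := by rw [div_le_iff₀ hE']; exact hEn
  have hb := D4_bound a b c ![f, toR (z (n + 2)), toR (z n), toR (z (n + 1))]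
    ![1, ht (z (n + 2)), ht (z n), ht (z (n + 1))]
    ![0, Lf a b c (toR (z (n + 2))), Lf a b c (toR (z n)), Lf a b c (toR (z (n + 1)))]
    (by
      intro i j hj
      fin_cases i
      · exact hf1 j hj
      · exact abs_le_ht' _ j hj
      · exact abs_le_ht' _ j hj
      · exact abs_le_ht' _ j hj)
    (by
      intro i
      fin_cases i
      · simp [hf2]
      · exact (abs_of_pos (h.pos _)).le
      · exact (abs_of_pos (h.pos _)).le
      · exact (abs_of_pos (h.pos _)).le)
  simp only [Matrix.cons_val_zero, Matrix.cons_val_one, Matrix.cons_val, zero_mul, one_mul] at hb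
  rw [hFn] at hb
  have x1 : (ht (z n) : ℝ) ≤ ht (z (n + 1)) := by exact_mod_cast (h.hlt n).le
  have x2 : (ht (z (n + 1)) : ℝ) ≤ ht (z (n + 2)) := by exact_mod_cast (h.hlt (n + 1)).le
  have y1 := (h.dec n).le
  have y2 := (h.dec (n + 1)).le
  have p0 := h.pos n
  have p2 := h.pos (n + 2)
  have p1 := h.pos (n + 1)
  have q : |F| / |E| ≤ |κ| * |F| := by
    rw [div_eq_mul_one_div, mul_comm]; gcongr
  set ζ0 := Lf a b c (toR (z n))
  have t1 : Lf a b c (toR (z (n + 2))) * (ht (z n) * ht (z (n + 1)) : ℝ) ≤ ζ0 * (ht (z (n + 1)) * ht (z (n + 2))) := by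
    apply mul_le_mul
    · exact y2.trans y1
    · gcongr
    · positivity
    · exact p0.le
  have t2 : Lf a b c (toR (z (n + 1))) * (ht (z (n + 2)) * ht (z n) : ℝ) ≤ ζ0 * (ht (z (n + 1)) * ht (z (n + 2))) := by
    rw [mul_comm (ht (z (n + 2)) : ℝ)]
    gcongr
  have t3 : ζ0 * (ht (z (n + 2)) * ht (z (n + 1)) : ℝ) = ζ0 * (ht (z (n + 1)) * ht (z (n + 2))) := by ring
  linarith

theorem BestSeq.ht_ge {a b c : ℝ} {z : ℕ → Fin 4 → ℤ} (h : BestSeq a b c z) (k : ℕ) :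
    k ≤ ht (z k) := by
  induction k with
  | zero => exact Nat.zero_le _
  | succ k ih => have := h.hlt k; omega

theorem BestSeq.ht_mono {a b c : ℝ} {z : ℕ → Fin 4 → ℤ} (h : BestSeq a b c z) {k n : ℕ} (hkn : k ≤ n) :
    ht (z k) ≤ ht (z n) :=
  monotone_nat_of_le_succ (f := fun k => ht (z k)) (fun n => (h.hlt n).le) hkn

theorem BestSeq.L_anti {a b c : ℝ} {z : ℕ → Fin 4 → ℤ} (h : BestSeq a b c z) {k n : ℕ} (hkn : k ≤ n) :
    Lf a b c (toR (z n)) ≤ Lf a b c (toR (z k)) :=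
  antitone_nat_of_succ_le (f := fun k => Lf a b c (toR (z k))) (fun n => (h.dec n).le) hkn

theorem det_bound_A {a b c : ℝ} {z : ℕ → Fin 4 → ℤ} (h : BestSeq a b c z) (k n : ℕ) (hkn : k + 1 ≤ n)
    (hD : D4 (toR (z (n + 2))) (toR (z (k + 2))) (toR (z k)) (toR (z (k + 1))) ≠ 0) :
    1 ≤ 24 * (Lf a b c (toR (z k)) * (ht (z (k + 1)) * ht (z (k + 2)) * ht (z (n + 2)))) := by
  have h1 := D4_int _ _ _ _ hD
  have hb := D4_bound a b c ![toR (z (n + 2)), toR (z (k + 2)), toR (z k), toR (z (k + 1))]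
    ![ht (z (n + 2)), ht (z (k + 2)), ht (z k), ht (z (k + 1))]
    ![Lf a b c (toR (z (n + 2))), Lf a b c (toR (z (k + 2))), Lf a b c (toR (z k)), Lf a b c (toR (z (k + 1)))]
    (by
      intro i j hj
      fin_cases i
      · exact abs_le_ht' _ j hj
      · exact abs_le_ht' _ j hj
      · exact abs_le_ht' _ j hj
      · exact abs_le_ht' _ j hj)
    (by
      intro i
      fin_cases i
      · exact (abs_of_pos (h.pos _)).le
      · exact (abs_of_pos (h.pos _)).le
      · exact (abs_of_pos (h.pos _)).le
      · exact (abs_of_pos (h.pos _)).le)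
  simp only [Matrix.cons_val_zero, Matrix.cons_val_one, Matrix.cons_val] at hb
  have x1 : (ht (z k) : ℝ) ≤ ht (z (k + 1)) := by exact_mod_cast h.ht_mono (by omega)
  have x2 : (ht (z (k + 1)) : ℝ) ≤ ht (z (k + 2)) := by exact_mod_cast h.ht_mono (by omega)
  have x3 : (ht (z (k + 2)) : ℝ) ≤ ht (z (n + 2)) := by exact_mod_cast h.ht_mono (by omega)
  have y1 := h.L_anti (show k ≤ k + 1 by omega)
  have y2 := h.L_anti (show k ≤ k + 2 by omega)
  have y3 := h.L_anti (show k ≤ n + 2 by omega)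
  have p0 := h.pos k
  have n0 : (0 : ℝ) ≤ ht (z k) := by positivity
  have n1 : (0 : ℝ) ≤ ht (z (k + 1)) := by positivity
  have n2 : (0 : ℝ) ≤ ht (z (k + 2)) := by positivity
  have n3 : (0 : ℝ) ≤ ht (z (n + 2)) := by positivity
  set ζ := Lf a b c (toR (z k))
  generalize Lf a b c (toR (z (n + 2))) = ζ3 at *
  generalize Lf a b c (toR (z (k + 2))) = ζ2 at *
  generalize Lf a b c (toR (z (k + 1))) = ζ1 at *
  generalize (ht (z k) : ℝ) = A0 at *
  generalize (ht (z (k + 1)) : ℝ) = A1 at *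
  generalize (ht (z (k + 2)) : ℝ) = A2 at *
  generalize (ht (z (n + 2)) : ℝ) = A3 at *
  have t1 : ζ3 * (A2 * A0 * A1) ≤ ζ * (A1 * A2 * A3) := by
    have e : A2 * A0 * A1 ≤ A1 * A2 * A3 := by
      calc A2 * A0 * A1 = A1 * A2 * A0 := by ring
        _ ≤ A1 * A2 * A3 := by gcongr; linarith
    exact mul_le_mul y3 e (by positivity) p0.le
  have t2 : ζ2 * (A3 * A0 * A1) ≤ ζ * (A1 * A2 * A3) := by
    have e : A3 * A0 * A1 ≤ A1 * A2 * A3 := by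
      calc A3 * A0 * A1 = A1 * A0 * A3 := by ring
        _ ≤ A1 * A2 * A3 := by gcongr; linarith
    exact mul_le_mul y2 e (by positivity) p0.le
  have t3 : ζ1 * (A3 * A2 * A0) ≤ ζ * (A1 * A2 * A3) := by
    have e : A3 * A2 * A0 ≤ A1 * A2 * A3 := by
      calc A3 * A2 * A0 = A0 * A2 * A3 := by ring
        _ ≤ A1 * A2 * A3 := by gcongr
    exact mul_le_mul y1 e (by positivity) p0.le
  have t4 : ζ * (A3 * A2 * A1) = ζ * (A1 * A2 * A3) := by ring
  linarith

set_option maxHeartbeats 1000000 in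
theorem main_abs {a b c : ℝ} {z : ℕ → Fin 4 → ℤ} (h : BestSeq a b c z) (γ β C : ℝ) (K : ℕ)
    (hβ : 0 < β) (hγ0 : 0 < γ) (hγ : 1 + β / γ + (β / γ) ^ 2 < γ)
    (U : ∀ k ≥ K, γ * Real.log (ht (z (k + 1))) ≤ - Real.log (Lf a b c (toR (z k))) + C)
    (V : ∀ k ≥ K, - Real.log (Lf a b c (toR (z k))) ≤ β * Real.log (ht (z k))) : False := by
  set ρ := β / γ with hρ
  have hρ0 : 0 < ρ := by positivity
  have hβρ : β = ρ * γ := by rw [hρ]; field_simp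
  have hγ1 : 1 < γ := by nlinarith
  -- unbounded logs
  have hinf : ∀ B : ℝ, ∃ J : ℕ, ∀ k ≥ J, B < Real.log (ht (z k)) := by
    intro B
    have : Filter.Tendsto (fun k : ℕ => Real.log (ht (z k))) Filter.atTop Filter.atTop := by
      refine Real.tendsto_log_atTop.comp (tendsto_natCast_atTop_atTop.comp ?_)
      exact Filter.tendsto_atTop_mono h.ht_ge Filter.tendsto_id
    exact Filter.eventually_atTop.1 (this.eventually_gt_atTop B)
  have hXpos : ∀ k, 1 ≤ k → (0 : ℝ) < ht (z k) := by
    intro k hk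
    have := h.ht_ge k
    exact_mod_cast (by omega : 0 < ht (z k))
  -- infinitely many good triples
  have hgood : ∀ J, ∃ k ≥ J, Good z k := by
    intro J0
    by_contra! hc
    set c0 := Real.log (ht (z (J0 + 1))) + Real.log (Lf a b c (toR (z J0))) with hc0
    obtain ⟨J, hJ⟩ := hinf ((C + Real.log 4 - c0) / (γ - 1))
    set n := max (max J J0) K
    have hn1 : J ≤ n := by omega
    have hn2 : J0 ≤ n := by omega
    have hn3 : K ≤ n := by omega
    have hng := not_good h J0 hc n hn2
    have hcmp := h.compare J0 n hng.1 hng.2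
    have hl := Real.log_le_log (mul_pos (hXpos _ (by omega)) (h.pos J0)) hcmp
    rw [Real.log_mul (hXpos _ (by omega)).ne' (h.pos _).ne',
      Real.log_mul (by norm_num) (mul_pos (hXpos _ (by omega)) (h.pos n)).ne',
      Real.log_mul (hXpos _ (by omega)).ne' (h.pos _).ne'] at hl
    have hU := U n hn3
    have hB := hJ (n + 1) (by omega)
    rw [div_lt_iff₀ (by linarith)] at hB
    nlinarith
  by_cases hA : ∀ J, ∃ k ≥ J, ∃ n ≥ k + 1,
      toR (z n) ∈ Submodule.span ℝ {toR (z (k + 1)), toR (z (k + 2))} ∧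
      toR (z (n + 1)) ∈ Submodule.span ℝ {toR (z (k + 1)), toR (z (k + 2))} ∧
      D4 (toR (z (n + 2))) (toR (z (k + 2))) (toR (z k)) (toR (z (k + 1))) ≠ 0
  · -- nondegenerate case
    set η := γ - 1 - ρ - ρ ^ 2 with hη
    have hη0 : 0 < η := by linarith
    set M := Real.log 24 + |C| + |C| / γ + |C| / γ + ρ * (Real.log 4 + |C|) / (γ - 1) with hM
    obtain ⟨J, hJ⟩ := hinf (M / η)
    obtain ⟨k, hk, n, hn, m1, m2, hD⟩ := hA (max J K)
    have hkJ : J ≤ k := by omega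
    have hkK : K ≤ k := by omega
    have hdet := det_bound_A h k n hn hD
    have hcmp := h.compare (k + 1) n m1 m2
    have l1 := Real.log_le_log (by norm_num) hdet
    have P1 := hXpos (k + 1) (by omega)
    have P2 := hXpos (k + 2) (by omega)
    have P3 := hXpos (n + 1) (by omega)
    have P4 := hXpos (n + 2) (by omega)
    have Q0 := h.pos k
    have Q1 := h.pos (k + 1)
    have Q2 := h.pos n
    rw [Real.log_one, Real.log_mul (by norm_num) (by positivity), Real.log_mul (by positivity) (by positivity),
      Real.log_mul (by positivity) (by positivity), Real.log_mul (by positivity) (by positivity)] at l1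
    have l2 := Real.log_le_log (mul_pos P2 Q1) hcmp
    rw [Real.log_mul (by positivity) (by positivity), Real.log_mul (by positivity) (by positivity),
      Real.log_mul (by positivity) (by positivity)] at l2
    have U0 := U k hkK
    have U1 := U (k + 1) (by omega)
    have Un := U n (by omega)
    have Un1 := U (n + 1) (by omega)
    have V1 := V (k + 1) (by omega)
    have Vn1 := V (n + 1) (by omega)
    have hB := hJ (k + 1) (by omega)
    have e1 : k + 1 + 1 = k + 2 := rfl
    have e2 : n + 1 + 1 = n + 2 := rfl
    rw [e1] at *
    rw [e2] at *
    clear_value η M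
    generalize Real.log (Lf a b c (toR (z k))) = A0 at *
    generalize Real.log (Lf a b c (toR (z (k + 1)))) = A1 at *
    generalize Real.log (Lf a b c (toR (z n))) = A2 at *
    generalize Real.log (Lf a b c (toR (z (n + 1)))) = A3 at *
    generalize Real.log (ht (z (k + 1)) : ℝ) = x0 at *
    generalize Real.log (ht (z (k + 2)) : ℝ) = x1 at *
    generalize Real.log (ht (z (n + 1)) : ℝ) = v at *
    generalize Real.log (ht (z (n + 2)) : ℝ) = w at *
    have hCa := le_abs_self C
    have hCn := abs_nonneg C
    -- w ≤ ρ v + |C|/γ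
    have w1 : w ≤ ρ * v + |C| / γ := by
      have : γ * w ≤ γ * (ρ * v + |C| / γ) := by
        have : γ * (ρ * v + |C| / γ) = β * v + |C| := by rw [hβρ]; field_simp
        rw [this]; linarith
      exact le_of_mul_le_mul_left this hγ0
    have w2 : x1 ≤ ρ * x0 + |C| / γ := by
      have : γ * x1 ≤ γ * (ρ * x0 + |C| / γ) := by
        have : γ * (ρ * x0 + |C| / γ) = β * x0 + |C| := by rw [hβρ]; field_simp
        rw [this]; linarith
      exact le_of_mul_le_mul_left this hγ0
    have w3 : (γ - 1) * v ≤ Real.log 4 + |C| + β * x0 - x1 := by linarith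
    have hg1 : 0 < γ - 1 := by linarith
    have w4 : v ≤ (Real.log 4 + |C|) / (γ - 1) + (β * x0 - x1) / (γ - 1) := by
      rw [← add_div, le_div_iff₀ hg1]; linarith
    set τ := ρ / (γ - 1) with hτ
    have hτ1 : τ ≤ 1 := by
      rw [hτ, div_le_one hg1]; nlinarith
    have hτ0 : 0 < τ := by positivity
    have w5 : ρ * v ≤ ρ * (Real.log 4 + |C|) / (γ - 1) + τ * (β * x0 - x1) := by
      have := mul_le_mul_of_nonneg_left w4 hρ0.le
      have e : ρ * ((Real.log 4 + |C|) / (γ - 1) + (β * x0 - x1) / (γ - 1)) =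
          ρ * (Real.log 4 + |C|) / (γ - 1) + τ * (β * x0 - x1) := by rw [hτ]; ring
      linarith
    have w6 : (1 - τ) * x1 ≤ (1 - τ) * (ρ * x0) + |C| / γ := by
      have h1 := mul_le_mul_of_nonneg_left w2 (by linarith : 0 ≤ 1 - τ)
      have h2 : 0 ≤ τ * (|C| / γ) := by positivity
      linarith
    have w7 : τ * (β * x0) - τ * (ρ * x0) = ρ ^ 2 * x0 := by
      rw [hτ, hβρ]; field_simp
    have w8 : η * x0 ≤ M := by
      rw [hη, hM]; linarith
    rw [div_lt_iff₀ hη0] at hB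
    linarith
  · push Not at hA
    obtain ⟨J, hJ⟩ := hA
    obtain ⟨k0, hk0, hg⟩ := hgood J
    have hS := dichotomy h J (by
      push Not
      exact hJ) k0 hk0 hg
    obtain ⟨δ, hδ, hlow⟩ := degenerate h k0 hg hS
    have hη0 : 0 < γ - 1 - ρ := by nlinarith
    obtain ⟨J', hJ'⟩ := hinf ((|C| + |C| / γ - Real.log δ) / (γ - 1 - ρ))
    obtain ⟨n, hn, hgn⟩ := hgood (max (max J' K) k0)
    have hl := hlow n (by omega) hgn
    have P1 := hXpos (n + 1) (by omega)
    have P2 := hXpos (n + 2) (by omega)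
    have Q0 := h.pos n
    have l1 := Real.log_le_log hδ hl
    rw [Real.log_mul (by positivity) (by positivity), Real.log_mul (by positivity) (by positivity)] at l1
    have U0 := U n (by omega)
    have U1 := U (n + 1) (by omega)
    have V1 := V (n + 1) (by omega)
    have hB := hJ' (n + 1) (by omega)
    have e1 : n + 1 + 1 = n + 2 := rfl
    rw [e1] at *
    generalize Real.log (Lf a b c (toR (z n))) = A0 at *
    generalize Real.log (Lf a b c (toR (z (n + 1)))) = A1 at *
    generalize Real.log (ht (z (n + 1)) : ℝ) = x0 at *
    generalize Real.log (ht (z (n + 2)) : ℝ) = x1 at *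
    have hCa := le_abs_self C
    have w2 : x1 ≤ ρ * x0 + |C| / γ := by
      have : γ * x1 ≤ γ * (ρ * x0 + |C| / γ) := by
        have : γ * (ρ * x0 + |C| / γ) = β * x0 + |C| := by rw [hβρ]; field_simp
        rw [this]; linarith
      exact le_of_mul_le_mul_left this hγ0
    rw [div_lt_iff₀ hη0] at hB
    linarith

theorem g2_bound (α : ℝ) (hα : 3 ≤ α) : 0 ≤ g2 α ∧ 1 + g2 α + g2 α ^ 2 ≤ α := by
  unfold g2
  have hi : 0 < 1 / α := by positivity
  have hi2 : 1 / α ^ 2 = (1 / α) ^ 2 := by rw [one_div_pow]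
  have hia : 1 / α * α = 1 := by field_simp
  rw [hi2]
  generalize 1 / α = i at *
  have hnn : 0 ≤ α + i ^ 2 - 7 / 4 := by nlinarith
  have hs := Real.sq_sqrt hnn
  have hs0 := Real.sqrt_nonneg (α + i ^ 2 - 7 / 4)
  have hi3 : i ≤ 1 / 3 := by nlinarith
  have hle : Real.sqrt (α + i ^ 2 - 7 / 4) ≤ α / 2 - i := by
    apply Real.sqrt_le_iff.2
    constructor
    · linarith
    · nlinarith
  have hge : 1 ≤ Real.sqrt (α + i ^ 2 - 7 / 4) := by
    apply Real.le_sqrt_of_sq_le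
    nlinarith
  generalize Real.sqrt (α + i ^ 2 - 7 / 4) = s at *
  constructor
  · linarith
  · have : i * s ≤ i * (α / 2 - i) := by gcongr
    nlinarith

theorem nid_le (x : ℝ) (n : ℤ) : nid x ≤ |x - n| := round_le x n

theorem heightM_eq (w : Fin 4 → ℤ) : heightM ![w 0, w 1, w 2] = ht w := by
  unfold heightM ht
  simp [Fin.univ_succ, Finset.sup_insert]

theorem row_sum (θ1 θ2 θ3 : ℝ) (x : Fin 3 → ℤ) (j : Fin 1) :
    ∑ i, (!![θ1, θ2, θ3] : Matrix (Fin 1) (Fin 3) ℝ) j i * (x i : ℝ) = θ1 * x 0 + θ2 * x 1 + θ3 * x 2 := by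
  fin_cases j
  simp [Fin.sum_univ_succ]
  ring

theorem psi_le (θ1 θ2 θ3 t : ℝ) (w : Fin 4 → ℤ) (h0 : 0 < ht w) (ht' : (ht w : ℝ) ≤ t) :
    psiFn !![θ1, θ2, θ3] t ≤ ENNReal.ofReal |Lf θ1 θ2 θ3 (toR w)| := by
  unfold psiFn
  refine (iInf_le _ ![w 0, w 1, w 2]).trans ((iInf_le _ ?_).trans ((iInf_le _ ?_).trans ?_))
  · intro h
    have a0 := congrFun h 0
    have a1 := congrFun h 1
    have a2 := congrFun h 2
    simp at a0 a1 a2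
    simp [ht, a0, a1, a2] at h0
  · rw [heightM_eq]; exact ht'
  · apply ENNReal.ofReal_le_ofReal
    simp only [row_sum, ciSup_const]
    exact nid_le _ (w 3)

theorem psi_lt (θ1 θ2 θ3 t : ℝ) (y : ENNReal) (h : psiFn !![θ1, θ2, θ3] t < y) :
    ∃ w : Fin 4 → ℤ, w ≠ 0 ∧ (ht w : ℝ) ≤ t ∧ ENNReal.ofReal |Lf θ1 θ2 θ3 (toR w)| < y := by
  unfold psiFn at h
  simp only [iInf_lt_iff] at h
  obtain ⟨x, hx, hxt, hy⟩ := h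
  refine ⟨![x 0, x 1, x 2, round (θ1 * x 0 + θ2 * x 1 + θ3 * x 2)], ?_, ?_, ?_⟩
  · intro h
    apply hx
    funext i
    have a0 := congrFun h 0
    have a1 := congrFun h 1
    have a2 := congrFun h 2
    simp at a0 a1 a2
    fin_cases i <;> simp [a0, a1, a2]
  · rw [← heightM_eq]
    convert hxt using 3
    funext i
    fin_cases i <;> rfl
  · simp only [row_sum, ciSup_const] at hy
    exact hy

theorem three_mem (θ1 θ2 θ3 : ℝ) : (3 : ℝ) ∈ uniformExps !![θ1, θ2, θ3] := by
  refine ⟨by norm_num, ?_⟩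
  refine lt_of_le_of_lt (Filter.limsup_le_of_le (a := ENNReal.ofReal 8) ?_ ?_) ENNReal.ofReal_lt_top
  · exact Filter.isCobounded_le_of_bot
  · filter_upwards [Filter.eventually_ge_atTop (1 : ℝ)] with t ht1
    have hN : 0 < ⌊t⌋₊ := Nat.floor_pos.2 ht1
    obtain ⟨w, w1, w2, w3⟩ := dirichlet θ1 θ2 θ3 _ hN
    have hfl : (⌊t⌋₊ : ℝ) ≤ t := Nat.floor_le (by linarith)
    have hp := psi_le θ1 θ2 θ3 t w w1 (le_trans (by exact_mod_cast w2) hfl)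
    refine (mul_le_mul_right hp _).trans ?_
    rw [← ENNReal.ofReal_mul (by positivity)]
    apply ENNReal.ofReal_le_ofReal
    have hN' : (1 : ℝ) ≤ ⌊t⌋₊ := by exact_mod_cast hN
    have hlt := Nat.lt_floor_add_one t
    have h2 : t ≤ 2 * ⌊t⌋₊ := by linarith
    have e : t ^ (3 : ℝ) = t ^ 3 := by exact_mod_cast Real.rpow_natCast t 3
    rw [e]
    calc t ^ 3 * |Lf θ1 θ2 θ3 (toR w)| ≤ (2 * ⌊t⌋₊) ^ 3 * (1 / (⌊t⌋₊ : ℝ) ^ 3) := by gcongr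
      _ = 8 := by field_simp; norm_num

theorem Lf_ne (θ1 θ2 θ3 : ℝ) (hli : LinearIndependent ℚ ![(1 : ℝ), θ1, θ2, θ3])
    (w : Fin 4 → ℤ) (hw : w ≠ 0) : Lf θ1 θ2 θ3 (toR w) ≠ 0 := by
  intro h
  apply hw
  have := Fintype.linearIndependent_iff.1 hli ![-(w 3 : ℚ), w 0, w 1, w 2] (by
    simp [Fin.sum_univ_succ, Rat.smul_def]
    simp [Lf, toR] at h
    linarith)
  funext i
  have a0 := this 0
  have a1 := this 1
  have a2 := this 2
  have a3 := this 3
  simp at a0 a1 a2 a3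
  fin_cases i <;> simp [a0, a1, a2, a3]

theorem core (θ1 θ2 θ3 : ℝ) (hli : LinearIndependent ℚ ![(1 : ℝ), θ1, θ2, θ3])
    (γ β : ℝ) (hγ : γ ∈ uniformExps !![θ1, θ2, θ3]) (hβ0 : 0 < β)
    (hβ : β ∉ individualExps !![θ1, θ2, θ3]) (hγβ : 1 + β / γ + (β / γ) ^ 2 < γ) : False := by
  obtain ⟨hγ0, hlim⟩ := hγ
  have hlim2 : Filter.liminf (fun t : ℝ => ENNReal.ofReal (t ^ β) * psiFn !![θ1, θ2, θ3] t) Filter.atTop = ⊤ := by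
    by_contra hne
    exact hβ ⟨hβ0, lt_top_iff_ne_top.2 hne⟩
  obtain ⟨z, h⟩ := exists_bestSeq θ1 θ2 θ3 (Lf_ne θ1 θ2 θ3 hli)
  obtain ⟨C, hC1, hC2⟩ := ENNReal.lt_iff_exists_nnreal_btwn.1 hlim
  have ev1 := Filter.eventually_lt_of_limsup_lt hC1
  have ev2 : ∀ᶠ t : ℝ in Filter.atTop, 1 < ENNReal.ofReal (t ^ β) * psiFn !![θ1, θ2, θ3] t :=
    Filter.eventually_lt_of_lt_liminf (by rw [hlim2]; exact ENNReal.one_lt_top)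
  obtain ⟨T1, hT1⟩ := Filter.eventually_atTop.1 ev1
  obtain ⟨T2, hT2⟩ := Filter.eventually_atTop.1 ev2
  obtain ⟨K, hK⟩ := exists_nat_gt (2 * |T1| + |T2| + 1)
  have hX : ∀ k ≥ K, 2 * |T1| + |T2| + 1 < ht (z k) := by
    intro k hk
    have h1 : (K : ℝ) ≤ ht (z k) := by exact_mod_cast hk.trans (h.ht_ge k)
    linarith
  have a1 := abs_nonneg T1
  have a2 := abs_nonneg T2
  refine main_abs h γ β (Real.log (C + 1) + γ * Real.log 2) K hβ0 hγ0 hγβ ?_ ?_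
  · intro k hk
    have hXk := hX (k + 1) (by omega)
    have hXp : (0 : ℝ) < ht (z (k + 1)) := by linarith
    have hlt := hT1 ((ht (z (k + 1)) : ℝ) / 2) (by linarith [le_abs_self T1])
    have htp : 0 < ((ht (z (k + 1)) : ℝ) / 2) ^ γ := by positivity
    have hlt2 : psiFn !![θ1, θ2, θ3] ((ht (z (k + 1)) : ℝ) / 2) <
        ENNReal.ofReal ((C + 1) / ((ht (z (k + 1)) : ℝ) / 2) ^ γ) := by
      rw [ENNReal.ofReal_div_of_pos htp, ENNReal.lt_div_iff_mul_lt (Or.inl (by simpa using htp))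
        (Or.inl ENNReal.ofReal_ne_top), mul_comm]
      refine hlt.trans_le ?_
      rw [ENNReal.ofReal_add (by positivity) (by norm_num)]
      simp
    obtain ⟨w, w1, w2, w3⟩ := psi_lt _ _ _ _ _ hlt2
    have hb := h.best k w w1 (by
      have : (ht w : ℝ) < ht (z (k + 1)) := by linarith
      exact_mod_cast this)
    have w4 := (ENNReal.ofReal_lt_ofReal_iff (by positivity)).1 w3
    have hl := Real.log_le_log (h.pos k) (hb.trans w4.le)
    have hC0 : (0 : ℝ) < C + 1 := by positivity
    rw [Real.log_div hC0.ne' htp.ne', Real.log_rpow (by positivity), Real.log_div hXp.ne' (by norm_num)] at hl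
    linarith
  · intro k hk
    have hXk := hX k hk
    have hXp : (0 : ℝ) < ht (z k) := by linarith
    have hgt := hT2 (ht (z k) : ℝ) (by linarith [le_abs_self T2])
    have hp := psi_le θ1 θ2 θ3 (ht (z k)) (z k) (by exact_mod_cast hXp) le_rfl
    rw [abs_of_pos (h.pos k)] at hp
    have h1 := hgt.trans_le (mul_le_mul_right hp _)
    rw [← ENNReal.ofReal_mul (by positivity), ← ENNReal.ofReal_one] at h1
    have h2 := (ENNReal.ofReal_lt_ofReal_iff_of_nonneg zero_le_one).1 h1
    have hl := Real.log_le_log one_pos h2.le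
    have := h.pos k
    rw [Real.log_one, Real.log_mul (by positivity) this.ne', Real.log_rpow hXp] at hl
    linarith

/-- **Theorem 3 (Moshchevitin).** For a row of three real numbers `θ¹, θ², θ³` such that
`1, θ¹, θ², θ³` are linearly independent over `ℚ`, if `α(Θ)` is finite then
`β(Θ) ≥ α(Θ)·g₂(α(Θ))`. -/
theorem jarnik_improvement_m3_n1 (θ1 θ2 θ3 : ℝ)
    (hli : LinearIndependent ℚ ![(1 : ℝ), θ1, θ2, θ3])
    (hfin : alphaExp !![θ1, θ2, θ3] ≠ ⊤) :
    ENNReal.ofReal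
        ((alphaExp !![θ1, θ2, θ3]).toReal * g2 (alphaExp !![θ1, θ2, θ3]).toReal) ≤
      betaExp !![θ1, θ2, θ3] := by
  by_contra! hlt
  set α := (alphaExp !![θ1, θ2, θ3]).toReal with hα
  have hαe : alphaExp !![θ1, θ2, θ3] = ENNReal.ofReal α := (ENNReal.ofReal_toReal hfin).symm
  have h3 : 3 ≤ α := by
    have : ENNReal.ofReal 3 ≤ alphaExp !![θ1, θ2, θ3] := le_sSup ⟨3, three_mem θ1 θ2 θ3, rfl⟩
    rw [hαe] at this
    exact (ENNReal.ofReal_le_ofReal_iff (by positivity)).1 this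
  obtain ⟨hg0, hg⟩ := g2_bound α h3
  have hβtop : betaExp !![θ1, θ2, θ3] ≠ ⊤ := (hlt.trans ENNReal.ofReal_lt_top).ne
  have hβr : (betaExp !![θ1, θ2, θ3]).toReal < α * g2 α := by
    rw [← ENNReal.ofReal_toReal hβtop] at hlt
    exact (ENNReal.ofReal_lt_ofReal_iff_of_nonneg ENNReal.toReal_nonneg).1 hlt
  obtain ⟨β, hβ1, hβ2⟩ := exists_between hβr
  have hβ0 : 0 < β := lt_of_le_of_lt ENNReal.toReal_nonneg hβ1
  have hβn : β ∉ individualExps !![θ1, θ2, θ3] := by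
    intro hmem
    have h1 : ENNReal.ofReal β ≤ betaExp !![θ1, θ2, θ3] := le_sSup ⟨β, hmem, rfl⟩
    have := (ENNReal.ofReal_le_iff_le_toReal hβtop).1 h1
    linarith
  have hα0 : 0 < α := by linarith
  have hρ : β / α < g2 α := by rw [div_lt_iff₀ hα0]; linarith
  have hρ0 : 0 < β / α := by positivity
  have hstrict : 1 + β / α + (β / α) ^ 2 < α := by nlinarith
  -- continuity
  have hcont : ContinuousAt (fun γ : ℝ => γ - (1 + β / γ + (β / γ) ^ 2)) α := by
    have : ContinuousAt (fun γ : ℝ => β / γ) α := continuousAt_const.div continuousAt_id hα0.ne'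
    fun_prop (disch := assumption)
  have hev : ∀ᶠ γ in nhds α, 0 < γ - (1 + β / γ + (β / γ) ^ 2) :=
    hcont.eventually (lt_mem_nhds (by linarith))
  obtain ⟨ε, hε, hball⟩ := Metric.eventually_nhds_iff.1 hev
  have hlt2 : ENNReal.ofReal (max (α - ε / 2) 0) < alphaExp !![θ1, θ2, θ3] := by
    rw [hαe]
    exact (ENNReal.ofReal_lt_ofReal_iff hα0).2 (max_lt (by linarith) hα0)
  obtain ⟨_, ⟨γ, hγ, rfl⟩, hγlt⟩ := lt_sSup_iff.1 hlt2
  have hγ1 : max (α - ε / 2) 0 < γ := (ENNReal.ofReal_lt_ofReal_iff hγ.1).1 hγlt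
  have hγ2 : γ ≤ α := by
    have : ENNReal.ofReal γ ≤ alphaExp !![θ1, θ2, θ3] := le_sSup ⟨γ, hγ, rfl⟩
    rw [hαe] at this
    exact (ENNReal.ofReal_le_ofReal_iff hα0.le).1 this
  have hd : dist γ α < ε := by
    rw [Real.dist_eq, abs_lt]
    have := le_max_left (α - ε / 2) 0
    constructor <;> linarith
  have := hball hd
  exact core θ1 θ2 θ3 hli γ β hγ hβ0 hβn (by linarith)
end

section
/- Let Θ be the 2×2 real matrix with entries θ_j^i (i, j ∈ {1,2}), where 1, θ₁¹, θ₁², θ₂¹, θ₂² are linearly independent over ℚ, and assume α(Θ) is finite. Then β(Θ) ≥ α(Θ)·g₃(α(Θ)). -/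
open Filter
open scoped ENNReal

/-- `g₃(α) = (1 − α + √((1−α)² + 4α(2α²−2α+1))) / (2α)`. -/
noncomputable def g3 (α : ℝ) : ℝ :=
  (1 - α + Real.sqrt ((1 - α) ^ 2 + 4 * α * (2 * α ^ 2 - 2 * α + 1))) / (2 * α)


namespace JarnikAux

/-- the `x`-part of an integer vector `(x,y)` -/
noncomputable def xs : (Fin 4 → ℤ) →+ (Fin 2 → ℝ) :=
  AddMonoidHom.mk' (fun w => ![(w 0 : ℝ), (w 1 : ℝ)]) (by
    intro a b; ext i; fin_cases i <;> simp)

/-- the error part `Θ x - y` of an integer vector `(x,y)` -/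
noncomputable def es (T : Matrix (Fin 2) (Fin 2) ℝ) : (Fin 4 → ℤ) →+ (Fin 2 → ℝ) :=
  AddMonoidHom.mk' (fun w => ![T 0 0 * (w 0 : ℝ) + T 0 1 * (w 1 : ℝ) - (w 2 : ℝ),
    T 1 0 * (w 0 : ℝ) + T 1 1 * (w 1 : ℝ) - (w 3 : ℝ)]) (by
    intro a b; ext i; fin_cases i <;> simp <;> ring)

@[simp] lemma xs_zero (w : Fin 4 → ℤ) : xs w 0 = w 0 := rfl
@[simp] lemma xs_one (w : Fin 4 → ℤ) : xs w 1 = w 1 := rfl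
@[simp] lemma es_zero (T : Matrix (Fin 2) (Fin 2) ℝ) (w : Fin 4 → ℤ) :
    es T w 0 = T 0 0 * (w 0 : ℝ) + T 0 1 * (w 1 : ℝ) - (w 2 : ℝ) := rfl
@[simp] lemma es_one (T : Matrix (Fin 2) (Fin 2) ℝ) (w : Fin 4 → ℤ) :
    es T w 1 = T 1 0 * (w 0 : ℝ) + T 1 1 * (w 1 : ℝ) - (w 3 : ℝ) := rfl

/-- sequence of minimal points -/
structure MinSeq (T : Matrix (Fin 2) (Fin 2) ℝ) (z : ℕ → Fin 4 → ℤ) : Prop where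
  hX : ∀ k, ‖xs (z k)‖ < ‖xs (z (k + 1))‖
  hE : ∀ k, ‖es T (z (k + 1))‖ < ‖es T (z k)‖
  hmin : ∀ k w, ‖xs w‖ < ‖xs (z (k + 1))‖ → ‖es T w‖ < ‖es T (z k)‖ → w = 0

lemma exists_abs_eq_norm (v : Fin 2 → ℝ) : ∃ i, |v i| = ‖v‖ := by
  by_contra h
  push Not at h
  have h1 : ∀ i, |v i| < ‖v‖ := fun i => lt_of_le_of_ne (norm_le_pi_norm v i) (h i)
  have h2 : ‖v‖ < ‖v‖ := (pi_norm_lt_iff (lt_of_le_of_lt (abs_nonneg _) (h1 0))).2 h1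
  exact lt_irrefl _ h2

variable {T : Matrix (Fin 2) (Fin 2) ℝ} {z : ℕ → Fin 4 → ℤ}

lemma MinSeq.Epos (h : MinSeq T z) (k : ℕ) : 0 < ‖es T (z k)‖ :=
  lt_of_le_of_lt (norm_nonneg _) (h.hE k)

lemma norm_zsmul' (m : ℤ) (v : Fin 2 → ℝ) : ‖m • v‖ = |(m : ℝ)| * ‖v‖ := by
  rw [← Int.cast_smul_eq_zsmul ℝ, norm_smul, Real.norm_eq_abs]

lemma MinSeq.indep (h : MinSeq T z) (k : ℕ) (m n : ℤ) (he : m • z k + n • z (k + 1) = 0) :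
    m = 0 ∧ n = 0 := by
  have he' : m • z k = - (n • z (k + 1)) := eq_neg_of_add_eq_zero_left he
  have h1 : |(m : ℝ)| * ‖xs (z k)‖ = |(n : ℝ)| * ‖xs (z (k+1))‖ := by
    rw [← norm_zsmul', ← norm_zsmul', ← map_zsmul, ← map_zsmul, he', map_neg, norm_neg]
  have h2 : |(m : ℝ)| * ‖es T (z k)‖ = |(n : ℝ)| * ‖es T (z (k+1))‖ := by
    rw [← norm_zsmul', ← norm_zsmul', ← map_zsmul, ← map_zsmul, he', map_neg, norm_neg]
  have hx := h.hX k
  have hE := h.hE k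
  have hp := h.Epos k
  have hn : n = 0 := by
    by_contra hn
    have hn' : 0 < |(n : ℝ)| := by positivity
    have h3 : |(n:ℝ)| < |(m:ℝ)| := by
      by_contra hc
      push Not at hc
      nlinarith [norm_nonneg (xs (z k))]
    nlinarith
  subst hn
  refine ⟨?_, rfl⟩
  simp only [Int.cast_zero, abs_zero, zero_mul, mul_eq_zero, abs_eq_zero, Int.cast_eq_zero] at h2
  rcases h2 with h2 | h2
  · exact h2
  · exact absurd h2 hp.ne'

lemma xs_lin (w u v : Fin 4 → ℤ) (a b : ℝ) (hw : ∀ i, (w i : ℝ) = a * u i + b * v i) :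
    xs w = a • xs u + b • xs v := by
  ext i; fin_cases i <;> simp [hw]

lemma es_lin (w u v : Fin 4 → ℤ) (a b : ℝ) (hw : ∀ i, (w i : ℝ) = a * u i + b * v i) :
    es T w = a • es T u + b • es T v := by
  ext i; fin_cases i <;> simp [hw] <;> ring

lemma MinSeq.basis (h : MinSeq T z) (k : ℕ) (w : Fin 4 → ℤ) (a b : ℝ)
    (hw : ∀ i, (w i : ℝ) = a * z k i + b * z (k + 1) i) :
    ∃ m n : ℤ, w = m • z k + n • z (k + 1) := by
  refine ⟨round a, round b, ?_⟩
  set u : Fin 4 → ℤ := w - (round a • z k + round b • z (k + 1)) with hu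
  have hu' : ∀ i, (u i : ℝ) = (a - round a) * z k i + (b - round b) * z (k+1) i := by
    intro i
    simp [hu, hw]; ring
  have ha := abs_sub_round a
  have hb := abs_sub_round b
  have key : ∀ p q : Fin 2 → ℝ, ‖(a - round a) • p + (b - round b) • q‖ ≤ 1/2 * ‖p‖ + 1/2 * ‖q‖ := by
    intro p q
    refine (norm_add_le _ _).trans ?_
    rw [norm_smul, norm_smul, Real.norm_eq_abs, Real.norm_eq_abs]
    gcongr
  have h0 : u = 0 := by
    apply h.hmin k
    · rw [xs_lin _ _ _ _ _ hu']
      have := key (xs (z k)) (xs (z (k+1)))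
      have := h.hX k
      linarith
    · rw [es_lin _ _ _ _ _ hu']
      have := key (es T (z k)) (es T (z (k+1)))
      have := h.hE k
      linarith
  exact sub_eq_zero.1 h0

/-- mixed-minor lower bound -/
lemma MinSeq.mixed (h : MinSeq T z) (k : ℕ) : ∃ a b : Fin 2,
    ‖es T (z k)‖ * ‖xs (z (k+1))‖ / 3 ≤
      |xs (z k) a * es T (z (k+1)) b - xs (z (k+1)) a * es T (z k) b| := by
  by_contra hcon
  push Not at hcon
  obtain ⟨a, ha⟩ := exists_abs_eq_norm (xs (z (k+1)))
  obtain ⟨b, hb⟩ := exists_abs_eq_norm (es T (z k))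
  set X' := ‖xs (z (k+1))‖ with hX'
  set Z := ‖es T (z k)‖ with hZ
  have hZp : 0 < Z := h.Epos k
  have hXp : 0 < X' := lt_of_le_of_lt (norm_nonneg _) (h.hX k)
  set lam := es T (z (k+1)) b / es T (z k) b with hlam
  set mu := xs (z k) a / xs (z (k+1)) a with hmu
  have hb0 : es T (z k) b ≠ 0 := by
    intro h0; rw [h0, abs_zero] at hb; exact hZp.ne hb
  have ha0 : xs (z (k+1)) a ≠ 0 := by
    intro h0; rw [h0, abs_zero] at ha; exact hXp.ne ha
  have hlam1 : |lam| < 1 := by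
    rw [hlam, abs_div, hb, div_lt_one hZp]
    exact lt_of_le_of_lt (norm_le_pi_norm (es T (z (k+1))) b) (h.hE k)
  have hmu1 : |mu| < 1 := by
    rw [hmu, abs_div, ha, div_lt_one hXp]
    exact lt_of_le_of_lt (norm_le_pi_norm (xs (z k)) a) (h.hX k)
  -- first family
  have F1 : ∀ i, |lam * xs (z k) i - xs (z (k+1)) i| < X' / 3 := by
    intro i
    have := hcon i b
    have e : xs (z k) i * es T (z (k+1)) b - xs (z (k+1)) i * es T (z k) b
        = (lam * xs (z k) i - xs (z (k+1)) i) * es T (z k) b := by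
      rw [hlam]; field_simp
    rw [e, abs_mul, hb] at this
    by_contra hc
    push Not at hc
    nlinarith
  have F2 : ∀ i, |mu * es T (z (k+1)) i - es T (z k) i| < Z / 3 := by
    intro i
    have := hcon a i
    have e : xs (z k) a * es T (z (k+1)) i - xs (z (k+1)) a * es T (z k) i
        = (mu * es T (z (k+1)) i - es T (z k) i) * xs (z (k+1)) a := by
      rw [hmu]; field_simp
    rw [e, abs_mul, ha] at this
    by_contra hc
    push Not at hc
    nlinarith
  -- product close to one
  have F3 : |mu * lam - 1| < 1 / 3 := by
    have := hcon a b
    have e : xs (z k) a * es T (z (k+1)) b - xs (z (k+1)) a * es T (z k) b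
        = (mu * lam - 1) * (es T (z k) b * xs (z (k+1)) a) := by
      rw [hmu, hlam]; field_simp
    rw [e, abs_mul, abs_mul, ha, hb] at this
    by_contra hc
    push Not at hc
    nlinarith [mul_pos hZp hXp]
  obtain ⟨s, hs, hs1, hs2⟩ : ∃ s : ℤ, (s = 1 ∨ s = -1) ∧ |lam - s| < 1/3 ∧ |mu - s| < 1/3 := by
    rw [abs_lt] at hlam1 hmu1 F3
    rcases le_or_gt 0 lam with hl | hl
    · have : 0 < mu := by nlinarith
      refine ⟨1, Or.inl rfl, ?_, ?_⟩ <;> rw [abs_lt] <;> push_cast <;> constructor <;> nlinarith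
    · have : mu < 0 := by nlinarith
      refine ⟨-1, Or.inr rfl, ?_, ?_⟩ <;> rw [abs_lt] <;> push_cast <;> constructor <;> nlinarith
  have hw : z (k+1) - s • z k = 0 := by
    apply h.hmin k
    · rw [pi_norm_lt_iff hXp]
      intro i
      have e : xs (z (k+1) - s • z k) i
        = (lam - s) * xs (z k) i - (lam * xs (z k) i - xs (z (k+1)) i) := by
        rw [map_sub, map_zsmul]; simp; ring
      rw [e, Real.norm_eq_abs]
      refine lt_of_le_of_lt (abs_sub _ _) ?_
      rw [abs_mul]
      have h1 : |xs (z k) i| ≤ X' := (norm_le_pi_norm (xs (z k)) i).trans (h.hX k).le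
      have := F1 i
      nlinarith [abs_nonneg (lam - s), abs_nonneg (xs (z k) i)]
    · have e' : z (k+1) - s • z k = (-s) • (z k - s • z (k+1)) := by
        rcases hs with rfl | rfl <;> simp
        abel
      have hs' : |((-s : ℤ) : ℝ)| = 1 := by
        rcases hs with rfl | rfl <;> simp
      rw [e', map_zsmul, norm_zsmul', hs', one_mul, pi_norm_lt_iff hZp]
      intro i
      have e : es T (z k - s • z (k+1)) i
        = (mu - s) * es T (z (k+1)) i - (mu * es T (z (k+1)) i - es T (z k) i) := by
        rw [map_sub, map_zsmul]; simp; ring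
      rw [e, Real.norm_eq_abs]
      refine lt_of_le_of_lt (abs_sub _ _) ?_
      rw [abs_mul]
      have h1 : |es T (z (k+1)) i| ≤ Z := (norm_le_pi_norm (es T (z (k+1))) i).trans (h.hE k).le
      have := F2 i
      nlinarith [abs_nonneg (mu - s), abs_nonneg (es T (z (k+1)) i)]
  have := h.indep k (-s) 1 (by rw [← hw]; simp; abel)
  omega

/-- 2x2 minor -/
def W2 (f g : (Fin 4 → ℤ) →+ ℝ) (u v : Fin 4 → ℤ) : ℝ := f u * g v - f v * g u

noncomputable def xc (a : Fin 2) : (Fin 4 → ℤ) →+ ℝ := (Pi.evalAddMonoidHom _ a).comp xs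
noncomputable def ec (T : Matrix (Fin 2) (Fin 2) ℝ) (a : Fin 2) : (Fin 4 → ℤ) →+ ℝ :=
  (Pi.evalAddMonoidHom _ a).comp (es T)

lemma xc_apply (a : Fin 2) (w : Fin 4 → ℤ) : xc a w = xs w a := rfl
lemma ec_apply (a : Fin 2) (w : Fin 4 → ℤ) : ec T a w = es T w a := rfl

def Dep (z : ℕ → Fin 4 → ℤ) (j : ℕ) : Prop :=
  ∃ m n : ℤ, z (j + 2) = m • z j + n • z (j + 1)

lemma MinSeq.dep_unit (h : MinSeq T z) {j : ℕ} {m n : ℤ}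
    (hd : z (j + 2) = m • z j + n • z (j + 1)) : m = 1 ∨ m = -1 := by
  have hm : m ≠ 0 := by
    rintro rfl
    have := h.indep (j+1) (-n) 1 (by
      show _ + (1:ℤ) • z (j + 2) = 0
      rw [hd]; simp)
    omega
  have hmR : (m : ℝ) ≠ 0 := by exact_mod_cast hm
  obtain ⟨p, q, hpq⟩ := h.basis (j+1) (z j) (-n / m) (1 / m) (by
    intro i
    show _ = _ * _ + _ * ((z (j+2) i : ℤ) : ℝ)
    rw [hd]
    simp
    field_simp
    ring)
  have hpq' : z j = p • z (j+1) + q • z (j+2) := hpq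
  rw [hd] at hpq'
  have := h.indep j (q * m - 1) (p + q * n) (by
    have e : (q * m - 1) • z j + (p + q * n) • z (j+1)
      = (p • z (j + 1) + q • (m • z j + n • z (j + 1))) - z j := by
      ext i; simp; ring
    rw [e, ← hpq', sub_self])
  have h1 : q * m = 1 := by omega
  exact Int.isUnit_iff.1 (IsUnit.of_mul_eq_one_right (a := q) (b := m) h1)

lemma MinSeq.chain (h : MinSeq T z) (p n : ℕ) (hd : ∀ j, p ≤ j → j < p + n → Dep z j) :
    ∃ s : ℝ, (s = 1 ∨ s = -1) ∧ ∀ f g : (Fin 4 → ℤ) →+ ℝ,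
      W2 f g (z p) (z (p+1)) = s * W2 f g (z (p+n)) (z (p+n+1)) := by
  induction n with
  | zero => exact ⟨1, Or.inl rfl, fun f g => by simp⟩
  | succ n ih =>
    obtain ⟨s, hs, H⟩ := ih (fun j h1 h2 => hd j h1 (by omega))
    obtain ⟨m, k, hmk⟩ := hd (p + n) (by omega) (by omega)
    have hm := h.dep_unit hmk
    refine ⟨-s * m, ?_, ?_⟩
    · rcases hs with rfl | rfl <;> rcases hm with rfl | rfl <;> simp
    · intro f g
      rw [H f g]
      show _ = -s * m * W2 f g (z (p + n + 1)) (z (p + n + 2))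
      rw [hmk]
      simp only [W2, map_add, map_zsmul]
      simp only [zsmul_eq_mul]
      rcases hm with rfl | rfl <;> push_cast <;> ring

end JarnikAux

namespace JarnikAux
variable {T : Matrix (Fin 2) (Fin 2) ℝ} {z : ℕ → Fin 4 → ℤ}

lemma xs_le (w : Fin 4 → ℤ) (a : Fin 2) : |xs w a| ≤ ‖xs w‖ := norm_le_pi_norm (xs w) a
lemma es_le (w : Fin 4 → ℤ) (a : Fin 2) : |es T w a| ≤ ‖es T w‖ := norm_le_pi_norm (es T w) a

lemma MinSeq.Xmono (h : MinSeq T z) : StrictMono (fun k => ‖xs (z k)‖) := strictMono_nat_of_lt_succ h.hX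
lemma MinSeq.Eanti (h : MinSeq T z) : StrictAnti (fun k => ‖es T (z k)‖) := strictAnti_nat_of_succ_lt h.hE

lemma abs_minor_le {a b c d A B C D : ℝ} (ha : |a| ≤ A) (hb : |b| ≤ B) (hc : |c| ≤ C)
    (hd : |d| ≤ D) : |a * b - c * d| ≤ A * B + C * D := by
  refine (abs_sub _ _).trans ?_
  rw [abs_mul, abs_mul]
  have := abs_nonneg a
  have := abs_nonneg b
  have := abs_nonneg c
  have := abs_nonneg d
  gcongr <;> linarith

lemma MinSeq.mixed_le (h : MinSeq T z) (k : ℕ) (a b : Fin 2) :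
    |xs (z k) a * es T (z (k+1)) b - xs (z (k+1)) a * es T (z k) b| ≤
      2 * (‖es T (z k)‖ * ‖xs (z (k+1))‖) := by
  have := abs_minor_le (xs_le (z k) a) (es_le (T := T) (z (k+1)) b) (xs_le (z (k+1)) a)
    (es_le (T := T) (z k) b)
  have h1 := h.hX k
  have h2 := h.hE k
  have := mul_le_mul h1.le h2.le (norm_nonneg _) (norm_nonneg _)
  linarith

/-- integral independence of `1, θ` -/
def IntIndep (T : Matrix (Fin 2) (Fin 2) ℝ) : Prop :=
  ∀ a b c d e : ℤ, (a : ℝ) + b * T 0 0 + c * T 0 1 + d * T 1 0 + e * T 1 1 = 0 →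
    a = 0 ∧ b = 0 ∧ c = 0 ∧ d = 0 ∧ e = 0

lemma int_zero_of_abs {a : ℤ} (h : |(a : ℝ)| < 1) : a = 0 := by
  have : |a| < 1 := by exact_mod_cast h
  exact Int.abs_lt_one_iff.1 this

lemma MinSeq.nondeg (h : MinSeq T z) (hT : IntIndep T)
    (hη : Tendsto (fun k => ‖es T (z k)‖ * ‖xs (z (k+1))‖) atTop (nhds 0))
    (c : Fin 4 → ℤ) (hc : c ≠ 0) (K : ℕ) : ∃ j ≥ K, ∑ i, c i * z j i ≠ 0 := by
  by_contra hcon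
  push Not at hcon
  set p : ℝ := c 0 + c 2 * T 0 0 + c 3 * T 1 0 with hp
  set q : ℝ := c 1 + c 2 * T 0 1 + c 3 * T 1 1 with hq
  have hpq : 0 < |p| + |q| := by
    by_contra hle
    have h1 : p = 0 := abs_eq_zero.1 (by linarith [abs_nonneg p, abs_nonneg q])
    have h2 : q = 0 := abs_eq_zero.1 (by linarith [abs_nonneg p, abs_nonneg q])
    have e1 := hT (c 0) (c 2) 0 (c 3) 0 (by rw [← h1, hp]; push_cast; ring)
    have e2 := hT (c 1) 0 (c 2) 0 (c 3) (by rw [← h2, hq]; push_cast; ring)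
    apply hc
    ext i; fin_cases i
    · exact e1.1
    · exact e2.1
    · exact e1.2.1
    · exact e1.2.2.2.1
  set C : ℝ := |(c 2 : ℝ)| + |(c 3 : ℝ)| with hC
  have hC0 : 0 ≤ C := by positivity
  obtain ⟨j, hjK, hj1, hj2⟩ : ∃ j ≥ K, ‖es T (z j)‖ * ‖xs (z (j+1))‖ * 2 < 1 ∧
      ‖es T (z j)‖ * ‖xs (z (j+1))‖ * (4 * C) < |p| + |q| := by
    have t1 := hη.mul_const 2
    have t2 := hη.mul_const (4 * C)
    rw [zero_mul] at t1 t2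
    obtain ⟨j, hj⟩ := ((eventually_ge_atTop K).and ((t1.eventually_lt_const one_pos).and
      (t2.eventually_lt_const hpq))).exists
    exact ⟨j, hj.1, hj.2.1, hj.2.2⟩
  have rel : ∀ i ≥ K, p * xs (z i) 0 + q * xs (z i) 1 = c 2 * es T (z i) 0 + c 3 * es T (z i) 1 := by
    intro i hi
    have h0 := hcon i hi
    have h0' : (c 0 * z i 0 + c 1 * z i 1 + c 2 * z i 2 + c 3 * z i 3 : ℝ) = 0 := by
      rw [Fin.sum_univ_four] at h0
      exact_mod_cast h0
    simp only [xs_zero, xs_one, es_zero, es_one, hp, hq]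
    linear_combination h0'
  have relb : ∀ i ≥ K, |p * xs (z i) 0 + q * xs (z i) 1| ≤ C * ‖es T (z i)‖ := by
    intro i hi
    rw [rel i hi]
    refine (abs_add_le _ _).trans ?_
    rw [abs_mul, abs_mul, hC, add_mul]
    have := es_le (T := T) (z i) 0
    have := es_le (T := T) (z i) 1
    gcongr
  have hX := h.hX j
  have hE := h.hE j
  have hprod := mul_le_mul hX.le hE.le (norm_nonneg _) (norm_nonneg _)
  -- the integer minor
  set w : ℤ := z j 0 * z (j+1) 1 - z j 1 * z (j+1) 0 with hw
  have hw0 : w = 0 := by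
    apply int_zero_of_abs
    have b1 : |p| * |(w:ℝ)| ≤ 2 * C * (‖es T (z j)‖ * ‖xs (z (j+1))‖) := by
      have e : p * w = (p * xs (z j) 0 + q * xs (z j) 1) * xs (z (j+1)) 1
          - (p * xs (z (j+1)) 0 + q * xs (z (j+1)) 1) * xs (z j) 1 := by
        simp [hw]; ring
      rw [← abs_mul, e]
      have := abs_minor_le (relb j hjK) (xs_le (z (j+1)) 1) (relb (j+1) (by omega)) (xs_le (z j) 1)
      nlinarith
    have b2 : |q| * |(w:ℝ)| ≤ 2 * C * (‖es T (z j)‖ * ‖xs (z (j+1))‖) := by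
      have e : q * w = (p * xs (z (j+1)) 0 + q * xs (z (j+1)) 1) * xs (z j) 0
          - (p * xs (z j) 0 + q * xs (z j) 1) * xs (z (j+1)) 0 := by
        simp [hw]; ring
      rw [← abs_mul, e]
      have := abs_minor_le (relb (j+1) (by omega)) (xs_le (z j) 0) (relb j hjK) (xs_le (z (j+1)) 0)
      nlinarith
    by_contra hge
    push Not at hge
    nlinarith
  have hw0' : (z j 0 : ℝ) * z (j+1) 1 - z j 1 * z (j+1) 0 = 0 := by
    rw [hw] at hw0; exact_mod_cast hw0
  -- mixed minors vanish
  have mm : ∀ (a b : Fin 2) (m : ℤ),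
      (m : ℝ) = xs (z j) a * es T (z (j+1)) b - xs (z (j+1)) a * es T (z j) b →
      xs (z j) a * es T (z (j+1)) b - xs (z (j+1)) a * es T (z j) b = 0 := by
    intro a b m hm
    rw [← hm]
    have := h.mixed_le j a b
    rw [← hm] at this
    have : m = 0 := int_zero_of_abs (by linarith)
    rw [this]; simp
  have hall : ∀ a b : Fin 2, xs (z j) a * es T (z (j+1)) b - xs (z (j+1)) a * es T (z j) b = 0 := by
    intro a b
    fin_cases a <;> fin_cases b
    · apply mm _ _ (z (j+1) 0 * z j 2 - z j 0 * z (j+1) 2)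
      simp; linear_combination -T 0 1 * hw0'
    · apply mm _ _ (z (j+1) 0 * z j 3 - z j 0 * z (j+1) 3)
      simp; linear_combination -T 1 1 * hw0'
    · apply mm _ _ (z (j+1) 1 * z j 2 - z j 1 * z (j+1) 2)
      simp; linear_combination T 0 0 * hw0'
    · apply mm _ _ (z (j+1) 1 * z j 3 - z j 1 * z (j+1) 3)
      simp; linear_combination T 1 0 * hw0'
  obtain ⟨a, b, hab⟩ := h.mixed j
  rw [hall a b, abs_zero] at hab
  have := mul_pos (h.Epos j) (lt_of_le_of_lt (norm_nonneg _) (h.hX j))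
  linarith

/-- comparing the areas along a chain -/
lemma MinSeq.chain_area (h : MinSeq T z) (p n : ℕ) (hd : ∀ j, p ≤ j → j < p + n → Dep z j) :
    ‖es T (z p)‖ * ‖xs (z (p+1))‖ ≤ 6 * (‖es T (z (p+n))‖ * ‖xs (z (p+n+1))‖) := by
  obtain ⟨s, hs, H⟩ := h.chain p n hd
  obtain ⟨a, b, hab⟩ := h.mixed p
  have e := H (xc a) (ec T b)
  have hs' : |s| = 1 := by rcases hs with rfl | rfl <;> simp
  have e2 : |xs (z p) a * es T (z (p+1)) b - xs (z (p+1)) a * es T (z p) b| =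
    |xs (z (p+n)) a * es T (z (p+n+1)) b - xs (z (p+n+1)) a * es T (z (p+n)) b| := by
    have := congrArg abs e
    rw [abs_mul, hs', one_mul] at this
    exact this
  have := h.mixed_le (p+n) a b
  linarith

lemma MinSeq.exists_nondep (h : MinSeq T z)
    (hη : Tendsto (fun k => ‖es T (z k)‖ * ‖xs (z (k+1))‖) atTop (nhds 0)) (K : ℕ) :
    ∃ p ≥ K, ¬ Dep z p := by
  by_contra hcon
  push Not at hcon
  have h0 := mul_pos (h.Epos K) (lt_of_le_of_lt (norm_nonneg _) (h.hX K))
  have t := hη.mul_const 6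
  rw [zero_mul] at t
  obtain ⟨l, hl1, hl2⟩ := ((eventually_ge_atTop K).and (t.eventually_lt_const h0)).exists
  obtain ⟨n, rfl⟩ := Nat.exists_eq_add_of_le hl1
  have := h.chain_area K n (fun j hj _ => hcon j hj)
  linarith

lemma MinSeq.det_ne (h : MinSeq T z) (p r : ℕ) (hp : ¬ Dep z p) (c : Fin 4 → ℤ)
    (h0 : ∑ i, c i * z p i = 0) (h1 : ∑ i, c i * z (p+1) i = 0) (h2 : ∑ i, c i * z (p+2) i = 0)
    (h3 : ∑ i, c i * z r i ≠ 0) :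
    (Matrix.of ![z p, z (p+1), z (p+2), z r]).det ≠ 0 := by
  intro hdet
  obtain ⟨v, hv, hv0⟩ := Matrix.exists_vecMul_eq_zero_iff.2 hdet
  have E : ∀ i, v 0 * z p i + v 1 * z (p+1) i + v 2 * z (p+2) i + v 3 * z r i = 0 := by
    intro i
    have := congrFun hv0 i
    simpa [Matrix.vecMul, dotProduct, Fin.sum_univ_four] using this
  simp only [Fin.sum_univ_four] at h0 h1 h2 h3
  have e3 : v 3 = 0 := by
    have : v 3 * (c 0 * z r 0 + c 1 * z r 1 + c 2 * z r 2 + c 3 * z r 3) = 0 := by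
      linear_combination c 0 * E 0 + c 1 * E 1 + c 2 * E 2 + c 3 * E 3 - v 0 * h0 - v 1 * h1 - v 2 * h2
    exact (mul_eq_zero.1 this).resolve_right h3
  have e2 : v 2 = 0 := by
    by_contra h2
    apply hp
    have h2R : (v 2 : ℝ) ≠ 0 := by exact_mod_cast h2
    apply h.basis p (z (p+2)) (-v 0 / v 2) (-v 1 / v 2)
    intro i
    have := E i
    rw [e3] at this
    have t : (v 0 * z p i + v 1 * z (p+1) i + v 2 * z (p+2) i : ℝ) = 0 := by
      have : v 0 * z p i + v 1 * z (p+1) i + v 2 * z (p+2) i = 0 := by linarith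
      exact_mod_cast this
    field_simp
    linear_combination t
  have := h.indep p (v 0) (v 1) (by
    ext i
    have := E i
    simp [e3, e2] at this ⊢
    exact this)
  apply hv
  ext i; fin_cases i
  · exact this.1
  · exact this.2
  · exact e2
  · exact e3

lemma MinSeq.exists_pair (h : MinSeq T z) (hT : IntIndep T)
    (hη : Tendsto (fun k => ‖es T (z k)‖ * ‖xs (z (k+1))‖) atTop (nhds 0)) (K : ℕ) :
    ∃ p ≥ K, ∃ q > p, (∀ j, p < j → j < q → Dep z j) ∧
      (Matrix.of ![z p, z (p+1), z (p+2), z (q+2)]).det ≠ 0 := by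
  classical
  obtain ⟨p0, hp0, hnd⟩ := h.exists_nondep hη K
  obtain ⟨c, hc, hc0⟩ := (Matrix.exists_mulVec_eq_zero_iff
    (M := Matrix.of ![z p0, z (p0+1), z (p0+2), (0 : Fin 4 → ℤ)])).2
    (Matrix.det_eq_zero_of_row_eq_zero 3 (by intro j; simp))
  have k0 : ∑ i, c i * z p0 i = 0 := by
    have := congrFun hc0 0
    simpa [Matrix.mulVec, dotProduct, mul_comm] using this
  have k1 : ∑ i, c i * z (p0+1) i = 0 := by
    have := congrFun hc0 1
    simpa [Matrix.mulVec, dotProduct, mul_comm] using this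
  have k2 : ∑ i, c i * z (p0+2) i = 0 := by
    have := congrFun hc0 2
    simpa [Matrix.mulVec, dotProduct, mul_comm] using this
  have hex : ∃ n, ∑ i, c i * z (p0 + n) i ≠ 0 := by
    obtain ⟨j, hj, hj'⟩ := h.nondeg hT hη c hc p0
    obtain ⟨n, rfl⟩ := Nat.exists_eq_add_of_le hj
    exact ⟨n, hj'⟩
  set n := Nat.find hex with hn
  have hn1 : ∑ i, c i * z (p0 + n) i ≠ 0 := Nat.find_spec hex
  have hn2 : ∀ m < n, ∑ i, c i * z (p0 + m) i = 0 := fun m hm => by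
    have := Nat.find_min hex hm
    push Not at this; exact this
  have hn3 : 3 ≤ n := by
    by_contra hlt
    have : n = 0 ∨ n = 1 ∨ n = 2 := by omega
    rcases this with h' | h' | h' <;> rw [h'] at hn1
    · exact hn1 k0
    · exact hn1 k1
    · exact hn1 k2
  obtain ⟨t, ht⟩ : ∃ t, n = t + 3 := ⟨n - 3, by omega⟩
  -- q = p0 + t + 1
  have hP : ¬ Dep z (p0 + 0) := hnd
  set s := Nat.findGreatest (fun s => ¬ Dep z (p0 + s)) t with hs
  have hs1 : ¬ Dep z (p0 + s) := Nat.findGreatest_spec (P := fun s => ¬ Dep z (p0 + s)) (Nat.zero_le t) hP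
  have hs2 : s ≤ t := Nat.findGreatest_le t
  have hs3 : ∀ u, s < u → u ≤ t → Dep z (p0 + u) := by
    intro u h1 h2
    have := Nat.findGreatest_is_greatest (P := fun s => ¬ Dep z (p0 + s)) h1 h2
    push Not at this; exact this
  refine ⟨p0 + s, by omega, p0 + t + 1, by omega, ?_, ?_⟩
  · intro j h1 h2
    obtain ⟨u, rfl⟩ := Nat.exists_eq_add_of_le (show p0 ≤ j by omega)
    exact hs3 u (by omega) (by omega)
  · apply h.det_ne _ _ hs1 c
    · exact hn2 s (by omega)
    · exact hn2 (s+1) (by omega)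
    · exact hn2 (s+2) (by omega)
    · rw [ht] at hn1
      exact hn1

lemma det_laplace (a b c d : Fin 4 → ℤ) :
    ((Matrix.of ![a, b, c, d]).det : ℝ) =
      W2 (xc 0) (xc 1) b c * W2 (ec T 0) (ec T 1) a d
      - W2 (xc 0) (ec T 0) b c * W2 (xc 1) (ec T 1) a d
      + W2 (xc 0) (ec T 1) b c * W2 (xc 1) (ec T 0) a d
      + W2 (xc 1) (ec T 0) b c * W2 (xc 0) (ec T 1) a d
      - W2 (xc 1) (ec T 1) b c * W2 (xc 0) (ec T 0) a d
      + W2 (ec T 0) (ec T 1) b c * W2 (xc 0) (xc 1) a d := by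
  simp only [W2, xc_apply, ec_apply, xs_zero, xs_one, es_zero, es_one]
  simp [Matrix.det_succ_row_zero, Fin.sum_univ_succ, Fin.succAbove]
  ring

lemma W2_le {f g : (Fin 4 → ℤ) →+ ℝ} {u v : Fin 4 → ℤ} {A B C D : ℝ} (h1 : |f u| ≤ A)
    (h2 : |g v| ≤ B) (h3 : |f v| ≤ C) (h4 : |g u| ≤ D) : |W2 f g u v| ≤ A * B + C * D :=
  abs_minor_le h1 h2 h3 h4

/-- main inequality -/
lemma MinSeq.main_ineq (h : MinSeq T z) (p q : ℕ) (hpq : p < q)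
    (hd : ∀ j, p < j → j < q → Dep z j)
    (hdet : (Matrix.of ![z p, z (p+1), z (p+2), z (q+2)]).det ≠ 0)
    (hη : ∀ j ≥ p, ‖es T (z j)‖ * ‖xs (z (j+1))‖ ≤ 1 / 4) :
    1 ≤ 32 * (‖es T (z p)‖ * ‖xs (z (q+2))‖ * (‖es T (z q)‖ * ‖xs (z (q+1))‖)) := by
  obtain ⟨n, rfl⟩ : ∃ n, q = p + 1 + n := Nat.exists_eq_add_of_le hpq
  obtain ⟨s, hs, H⟩ := h.chain (p+1) n (fun j h1 h2 => hd j (by omega) (by omega))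
  set q := p + 1 + n with hq
  have hs' : |s| = 1 := by rcases hs with rfl | rfl <;> simp
  have H' : ∀ f g : (Fin 4 → ℤ) →+ ℝ, |W2 f g (z (p+1)) (z (p+2))| = |W2 f g (z q) (z (q+1))| := by
    intro f g
    have := congrArg abs (H f g)
    rwa [abs_mul, hs', one_mul] at this
  have hD : (1:ℝ) ≤ |((Matrix.of ![z p, z (p+1), z (p+2), z (q+2)]).det : ℝ)| := by
    exact_mod_cast Int.one_le_abs hdet
  rw [det_laplace (T := T)] at hD
  have Xm := h.Xmono.monotone
  have Em := h.Eanti.antitone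
  have X1 : ‖xs (z p)‖ ≤ ‖xs (z (p+1))‖ := Xm (by omega)
  have X2 : ‖xs (z (p+1))‖ ≤ ‖xs (z (p+2))‖ := Xm (by omega)
  have X3 : ‖xs (z (p+2))‖ ≤ ‖xs (z (q+1))‖ := Xm (by omega)
  have X4 : ‖xs (z (q+1))‖ ≤ ‖xs (z (q+2))‖ := Xm (by omega)
  have X5 : ‖xs (z (q+2))‖ ≤ ‖xs (z (q+3))‖ := Xm (by omega)
  have Xq : ‖xs (z q)‖ ≤ ‖xs (z (q+1))‖ := Xm (by omega)
  have E1 : ‖es T (z q)‖ ≤ ‖es T (z p)‖ := Em (by omega)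
  have E2 : ‖es T (z (q+1))‖ ≤ ‖es T (z q)‖ := Em (by omega)
  have E3 : ‖es T (z (q+2))‖ ≤ ‖es T (z (q+1))‖ := Em (by omega)
  have n1 := hη p le_rfl
  have n2 := hη q (by omega)
  have n3 : ‖es T (z (q+1))‖ * ‖xs (z (q+2))‖ ≤ 1/4 := hη (q+1) (by omega)
  have n4 : ‖es T (z (q+2))‖ * ‖xs (z (q+3))‖ ≤ 1/4 := hη (q+2) (by omega)
  have x0 := norm_nonneg (xs (z p))
  have x1 := norm_nonneg (xs (z (p+1)))
  have x2 := norm_nonneg (xs (z (p+2)))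
  have x3 := norm_nonneg (xs (z (q+1)))
  have x4 := norm_nonneg (xs (z (q+2)))
  have y0 := norm_nonneg (es T (z p))
  have y1 := norm_nonneg (es T (z q))
  have y2 := norm_nonneg (es T (z (q+1)))
  have y3 := norm_nonneg (es T (z (q+2)))
  -- the three kinds of terms
  have A1 : |W2 (xc 0) (xc 1) (z (p+1)) (z (p+2)) * W2 (ec T 0) (ec T 1) (z p) (z (q+2))| ≤ 1/4 := by
    have a := W2_le (f := xc 0) (g := xc 1) (xs_le (z (p+1)) 0) (xs_le (z (p+2)) 1)
      (xs_le (z (p+2)) 0) (xs_le (z (p+1)) 1)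
    have b := W2_le (f := ec T 0) (g := ec T 1) (es_le (T := T) (z p) 0) (es_le (T := T) (z (q+2)) 1)
      (es_le (T := T) (z (q+2)) 0) (es_le (T := T) (z p) 1)
    rw [abs_mul]
    refine (mul_le_mul a b (abs_nonneg _) (by positivity)).trans ?_
    have : ‖es T (z (q+2))‖ * ‖xs (z (p+2))‖ ≤ 1/4 :=
      (mul_le_mul_of_nonneg_left (X3.trans (X4.trans X5)) y3).trans n4
    have := mul_le_mul n1 this (by positivity) (by positivity)
    linarith
  have A3 : |W2 (ec T 0) (ec T 1) (z (p+1)) (z (p+2)) * W2 (xc 0) (xc 1) (z p) (z (q+2))| ≤ 1/4 := by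
    have a := W2_le (f := xc 0) (g := xc 1) (xs_le (z p) 0) (xs_le (z (q+2)) 1)
      (xs_le (z (q+2)) 0) (xs_le (z p) 1)
    have b := W2_le (f := ec T 0) (g := ec T 1) (es_le (T := T) (z q) 0) (es_le (T := T) (z (q+1)) 1)
      (es_le (T := T) (z (q+1)) 0) (es_le (T := T) (z q) 1)
    rw [abs_mul, H']
    refine (mul_le_mul b a (abs_nonneg _) (by positivity)).trans ?_
    have : ‖es T (z q)‖ * ‖xs (z p)‖ ≤ 1/4 :=
      (mul_le_mul_of_nonneg_left (X1.trans (X2.trans X3)) y1).trans n2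
    have := mul_le_mul this n3 (by positivity) (by positivity)
    linarith
  set Q := ‖es T (z p)‖ * ‖xs (z (q+2))‖ * (‖es T (z q)‖ * ‖xs (z (q+1))‖) with hQ
  have A2 : ∀ a b a' b' : Fin 2, |W2 (xc a) (ec T b) (z (p+1)) (z (p+2)) *
      W2 (xc a') (ec T b') (z p) (z (q+2))| ≤ 4 * Q := by
    intro a b a' b'
    rw [abs_mul, H']
    have u := W2_le (f := xc a) (g := ec T b) (xs_le (z q) a) (es_le (T := T) (z (q+1)) b)
      (xs_le (z (q+1)) a) (es_le (T := T) (z q) b)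
    have v := W2_le (f := xc a') (g := ec T b') (xs_le (z p) a') (es_le (T := T) (z (q+2)) b')
      (xs_le (z (q+2)) a') (es_le (T := T) (z p) b')
    have u' := mul_le_mul Xq E2 y2 x3
    have v' := mul_le_mul (X1.trans (X2.trans (X3.trans X4))) (E3.trans (E2.trans E1)) y3 x4
    have u2 : |W2 (xc a) (ec T b) (z q) (z (q+1))| ≤ 2 * (‖es T (z q)‖ * ‖xs (z (q+1))‖) := by
      linarith
    have v2 : |W2 (xc a') (ec T b') (z p) (z (q+2))| ≤ 2 * (‖es T (z p)‖ * ‖xs (z (q+2))‖) := by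
      linarith
    refine (mul_le_mul u2 v2 (abs_nonneg _) (by positivity)).trans ?_
    rw [hQ]; linarith
  have B1 := A2 0 0 1 1
  have B2 := A2 0 1 1 0
  have B3 := A2 1 0 0 1
  have B4 := A2 1 1 0 0
  rw [abs_le] at A1 A3 B1 B2 B3 B4
  rcases le_abs.1 hD with hD | hD <;> linarith

/-- the growth contradiction -/
lemma MinSeq.contra (h : MinSeq T z) (hT : IntIndep T) (hX : Tendsto (fun k => ‖xs (z k)‖) atTop atTop)
    (γ b C : ℝ) (hγ : 1 < γ) (hC : 0 < C)
    (hub : ∀ᶠ k in atTop, ‖es T (z k)‖ ≤ C * ‖xs (z (k+1))‖ ^ (-γ))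
    (hlb : ∀ᶠ k in atTop, ‖xs (z k)‖ ^ (-b) ≤ ‖es T (z k)‖)
    (hlt : (b + γ - γ ^ 2) * (b - 1) < γ ^ 2 * (γ - 1)) : False := by
  have hX1 : Tendsto (fun k => ‖xs (z (k+1))‖) atTop atTop := hX.comp (tendsto_add_atTop_nat 1)
  have hη : Tendsto (fun k => ‖es T (z k)‖ * ‖xs (z (k+1))‖) atTop (nhds 0) := by
    have t : Tendsto (fun k => C * ‖xs (z (k+1))‖ ^ (-(γ-1))) atTop (nhds 0) := by
      simpa using ((tendsto_rpow_neg_atTop (show 0 < γ - 1 by linarith)).comp hX1).const_mul C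
    refine tendsto_of_tendsto_of_tendsto_of_le_of_le' tendsto_const_nhds t
      (Eventually.of_forall fun k => by positivity) ?_
    filter_upwards [hub, hX1.eventually_gt_atTop 0] with k hk hk0
    have : ‖xs (z (k+1))‖ ^ (-(γ-1)) = ‖xs (z (k+1))‖ ^ (-γ) * ‖xs (z (k+1))‖ := by
      rw [← Real.rpow_add_one hk0.ne']; ring_nf
    rw [this, ← mul_assoc]
    exact mul_le_mul_of_nonneg_right hk hk0.le
  have hlX : Tendsto (fun k => Real.log ‖xs (z k)‖) atTop atTop := Real.tendsto_log_atTop.comp hX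
  set c := Real.log C with hc
  -- constants
  set k1 : ℝ := γ * (Real.log 32 + 2 * c) + c with hk1
  set k2 : ℝ := Real.log 6 + c with hk2
  have hA := (hlX.const_mul_atTop (show 0 < γ ^ 2 by positivity)).eventually_gt_atTop k1
  have hA2 := (hlX.const_mul_atTop (show 0 < γ ^ 2 * (γ - 1) - (b + γ - γ ^ 2) * (b - 1) by linarith)).eventually_gt_atTop
    ((γ - 1) * k1 + (b + γ - γ ^ 2) * k2)
  obtain ⟨K, hK⟩ := eventually_atTop.1 (hub.and (hlb.and ((hη.eventually_le_const (show (0:ℝ) < 1/4 by norm_num)).and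
    ((hX.eventually_ge_atTop 1).and (hA.and hA2)))))
  obtain ⟨p, hp, q, hq, hd, hdet⟩ := h.exists_pair hT hη K
  have M := h.main_ineq p q hq hd hdet (fun j hj => (hK j (by omega)).2.2.1)
  obtain ⟨n, rfl⟩ : ∃ n, q = p + 1 + n := Nat.exists_eq_add_of_le hq
  have N := h.chain_area (p+1) n (fun j h1 h2 => hd j (by omega) (by omega))
  set q := p + 1 + n with hqd
  have Lub : ∀ j ≥ K, Real.log ‖es T (z j)‖ ≤ c - γ * Real.log ‖xs (z (j+1))‖ := by
    intro j hj
    have h0 : 0 < ‖xs (z (j+1))‖ := lt_of_lt_of_le one_pos (hK (j+1) (by omega)).2.2.2.1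
    have := Real.log_le_log (h.Epos j) (hK j hj).1
    rw [Real.log_mul hC.ne' (by positivity), Real.log_rpow h0] at this
    linarith
  have Llb : ∀ j ≥ K, -b * Real.log ‖xs (z j)‖ ≤ Real.log ‖es T (z j)‖ := by
    intro j hj
    have h0 : 0 < ‖xs (z j)‖ := lt_of_lt_of_le one_pos (hK j hj).2.2.2.1
    have := Real.log_le_log (by positivity) (hK j hj).2.1
    rwa [Real.log_rpow h0] at this
  have xpos : ∀ j ≥ K, 0 < ‖xs (z j)‖ := fun j hj => lt_of_lt_of_le one_pos (hK j hj).2.2.2.1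
  have P1 := xpos (p+1) (by omega)
  have P2 := xpos (q+1) (by omega)
  have P3 := xpos (q+2) (by omega)
  have P4 := xpos (p+2) (by omega)
  have Q1 := h.Epos p
  have Q2 := h.Epos q
  have Q3 := h.Epos (p+1)
  -- logs of the main inequalities
  have LM : 0 ≤ Real.log 32 + (Real.log ‖es T (z p)‖ + Real.log ‖xs (z (q+2))‖ +
      (Real.log ‖es T (z q)‖ + Real.log ‖xs (z (q+1))‖)) := by
    have := Real.log_le_log one_pos M
    rw [Real.log_one, Real.log_mul (by norm_num) (by positivity), Real.log_mul (by positivity) (by positivity),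
      Real.log_mul (by positivity) (by positivity), Real.log_mul (by positivity) (by positivity)] at this
    exact this
  have LN : Real.log ‖es T (z (p+1))‖ + Real.log ‖xs (z (p+2))‖ ≤
      Real.log 6 + (Real.log ‖es T (z q)‖ + Real.log ‖xs (z (q+1))‖) := by
    have := Real.log_le_log (mul_pos Q3 P4) N
    rw [Real.log_mul Q3.ne' P4.ne', Real.log_mul (by norm_num) (mul_pos Q2 P2).ne',
      Real.log_mul Q2.ne' P2.ne'] at this
    exact this
  have u1 := Lub p (by omega)
  have u2 := Lub q (by omega)
  have u3 : Real.log ‖es T (z (q+1))‖ ≤ c - γ * Real.log ‖xs (z (q+2))‖ := Lub (q+1) (by omega)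
  have l1 := Llb (p+1) (by omega)
  have l2 := Llb (q+1) (by omega)
  have m1 : Real.log ‖xs (z (p+1))‖ ≤ Real.log ‖xs (z (p+2))‖ := Real.log_le_log P1 (h.hX (p+1)).le
  have m2 : Real.log ‖xs (z (p+1))‖ ≤ Real.log ‖xs (z (q+1))‖ :=
    Real.log_le_log P1 (h.Xmono.monotone (by omega))
  have m3 : 0 ≤ Real.log ‖xs (z (p+1))‖ := Real.log_nonneg (hK (p+1) (by omega)).2.2.2.1
  have a1 := (hK (p+1) (by omega)).2.2.2.2.1
  have a2 := (hK (p+1) (by omega)).2.2.2.2.2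
  set A := Real.log ‖xs (z (p+1))‖
  set B := Real.log ‖xs (z (q+1))‖
  set D := Real.log ‖xs (z (q+2))‖
  have r1 : γ * D ≤ c + b * B := by linarith
  have r2 : 0 ≤ Real.log 32 + 2 * c - γ * A + D + (1 - γ) * B := by linarith
  have r3 : γ ^ 2 * A ≤ k1 + (b + γ - γ ^ 2) * B := by
    rw [hk1]; nlinarith
  have r4 : (γ - 1) * B ≤ k2 + (b - 1) * A := by
    rw [hk2]; linarith
  rcases le_or_gt 0 (b + γ - γ ^ 2) with hu | hu
  · nlinarith
  · nlinarith

end JarnikAux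

namespace JarnikAux

lemma xs_norm (w : Fin 4 → ℤ) : ‖xs w‖ = ((max (w 0).natAbs (w 1).natAbs : ℕ) : ℝ) := by
  apply le_antisymm
  · rw [pi_norm_le_iff_of_nonneg (by positivity)]
    intro i
    fin_cases i
    · simp [Nat.cast_natAbs]
    · simp [Nat.cast_natAbs]
  · have h0 := xs_le w 0
    have h1 := xs_le w 1
    simp only [xs_zero, xs_one] at h0 h1
    rw [Nat.cast_max]
    apply max_le
    · simpa [Nat.cast_natAbs] using h0
    · simpa [Nat.cast_natAbs] using h1

lemma heightM_two (x : Fin 2 → ℤ) : heightM x = max (x 0).natAbs (x 1).natAbs := by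
  apply le_antisymm
  · apply Finset.sup_le
    intro i _
    fin_cases i
    · exact le_max_left _ _
    · exact le_max_right _ _
  · apply max_le
    · exact Finset.le_sup (f := fun i => (x i).natAbs) (Finset.mem_univ 0)
    · exact Finset.le_sup (f := fun i => (x i).natAbs) (Finset.mem_univ 1)

lemma psi_le (T : Matrix (Fin 2) (Fin 2) ℝ) (t : ℝ) (w : Fin 4 → ℤ) (hw : xs w ≠ 0)
    (ht : ‖xs w‖ ≤ t) : psiFn T t ≤ ENNReal.ofReal ‖es T w‖ := by
  unfold psiFn
  refine iInf_le_of_le ![w 0, w 1] (iInf_le_of_le ?_ (iInf_le_of_le ?_ ?_))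
  · intro h
    apply hw
    have h0 := congrFun h 0
    have h1 := congrFun h 1
    simp at h0 h1
    ext i; fin_cases i <;> simp [h0, h1]
  · rw [heightM_two]
    rw [xs_norm] at ht
    simpa using ht
  · apply ENNReal.ofReal_le_ofReal
    apply ciSup_le
    intro j
    fin_cases j
    · refine le_trans ?_ (es_le (T := T) w 0)
      simpa [nid, Fin.sum_univ_two] using round_le (T 0 0 * (w 0 : ℝ) + T 0 1 * w 1) (w 2)
    · refine le_trans ?_ (es_le (T := T) w 1)
      simpa [nid, Fin.sum_univ_two] using round_le (T 1 0 * (w 0 : ℝ) + T 1 1 * w 1) (w 3)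

lemma le_psi (T : Matrix (Fin 2) (Fin 2) ℝ) (t r : ℝ)
    (h : ∀ w : Fin 4 → ℤ, w ≠ 0 → ‖xs w‖ ≤ t → r ≤ ‖es T w‖) :
    ENNReal.ofReal r ≤ psiFn T t := by
  unfold psiFn
  refine le_iInf fun x => le_iInf fun hx => le_iInf fun ht => ?_
  apply ENNReal.ofReal_le_ofReal
  set w : Fin 4 → ℤ := ![x 0, x 1, round (T 0 0 * (x 0 : ℝ) + T 0 1 * x 1),
    round (T 1 0 * (x 0 : ℝ) + T 1 1 * x 1)] with hw
  refine (h w ?_ ?_).trans ?_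
  · intro h0
    apply hx
    have e0 := congrFun h0 0
    have e1 := congrFun h0 1
    simp [hw] at e0 e1
    ext i; fin_cases i <;> simp [e0, e1]
  · rw [xs_norm]
    rw [heightM_two] at ht
    simpa [hw] using ht
  · obtain ⟨j, hj⟩ := exists_abs_eq_norm (es T w)
    rw [← hj]
    refine le_trans (le_of_eq ?_) (le_ciSup (f := fun j => nid (∑ i, T j i * (x i : ℝ)))
      (Set.finite_range _).bddAbove j)
    fin_cases j <;> simp [nid, hw, Fin.sum_univ_two]

lemma floor_close {N : ℕ} (hN : 0 < N) {a b : ℝ} (ha : 0 ≤ a) (hb : 0 ≤ b)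
    (h : ⌊N * a⌋₊ = ⌊N * b⌋₊) : |a - b| ≤ 1 / N := by
  have hN' : (0:ℝ) < N := by exact_mod_cast hN
  have a1 := Nat.floor_le (mul_nonneg hN'.le ha)
  have a2 := Nat.lt_floor_add_one (N * a)
  have b1 := Nat.floor_le (mul_nonneg hN'.le hb)
  have b2 := Nat.lt_floor_add_one (N * b)
  rw [h] at a1 a2
  rw [le_div_iff₀ hN', ← abs_of_pos hN', ← abs_mul, abs_le]
  constructor <;> linarith

lemma dirichlet (T : Matrix (Fin 2) (Fin 2) ℝ) (N : ℕ) (hN : 0 < N) :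
    ∃ w : Fin 4 → ℤ, xs w ≠ 0 ∧ ‖xs w‖ ≤ N ∧ ‖es T w‖ ≤ 1 / N := by
  have hN' : (0:ℝ) < N := by exact_mod_cast hN
  let L : Fin 2 → Fin (N+1) × Fin (N+1) → ℝ := fun j p => T j 0 * (p.1.1 : ℝ) + T j 1 * (p.2.1 : ℝ)
  have hlt : ∀ a : ℝ, ⌊N * Int.fract a⌋₊ < N := by
    intro a
    rw [Nat.floor_lt (mul_nonneg hN'.le (Int.fract_nonneg a))]
    have := Int.fract_lt_one a
    nlinarith
  let F : Fin (N+1) × Fin (N+1) → Fin N × Fin N := fun p =>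
    (⟨⌊N * Int.fract (L 0 p)⌋₊, hlt _⟩, ⟨⌊N * Int.fract (L 1 p)⌋₊, hlt _⟩)
  obtain ⟨p, q, hpq, hF⟩ := Fintype.exists_ne_map_eq_of_card_lt F (by
    simp only [Fintype.card_prod, Fintype.card_fin]; nlinarith)
  have h0 : ⌊N * Int.fract (L 0 p)⌋₊ = ⌊N * Int.fract (L 0 q)⌋₊ :=
    congrArg (fun u => (u.1 : ℕ)) hF
  have h1 : ⌊N * Int.fract (L 1 p)⌋₊ = ⌊N * Int.fract (L 1 q)⌋₊ :=
    congrArg (fun u => (u.2 : ℕ)) hF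
  have c0 := floor_close hN (Int.fract_nonneg _) (Int.fract_nonneg _) h0
  have c1 := floor_close hN (Int.fract_nonneg _) (Int.fract_nonneg _) h1
  have bd : ∀ i j : Fin (N+1), |((i.1 : ℤ) : ℝ) - ((j.1 : ℤ) : ℝ)| ≤ N := by
    intro i j
    have hi : ((i.1 : ℤ) : ℝ) ≤ N := by exact_mod_cast Nat.lt_succ_iff.1 i.2
    have hj : ((j.1 : ℤ) : ℝ) ≤ N := by exact_mod_cast Nat.lt_succ_iff.1 j.2
    have hi0 : (0:ℝ) ≤ ((i.1 : ℤ) : ℝ) := by positivity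
    have hj0 : (0:ℝ) ≤ ((j.1 : ℤ) : ℝ) := by positivity
    rw [abs_le]; constructor <;> linarith
  refine ⟨![(p.1.1 : ℤ) - q.1.1, (p.2.1 : ℤ) - q.2.1, ⌊L 0 p⌋ - ⌊L 0 q⌋, ⌊L 1 p⌋ - ⌊L 1 q⌋], ?_, ?_, ?_⟩
  · intro h
    apply hpq
    have e0 := congrFun h 0
    have e1 := congrFun h 1
    simp [sub_eq_zero, Fin.val_inj] at e0 e1
    exact Prod.ext e0 e1
  · rw [pi_norm_le_iff_of_nonneg hN'.le]
    intro i
    fin_cases i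
    · simpa using bd p.1 q.1
    · simpa using bd p.2 q.2
  · rw [pi_norm_le_iff_of_nonneg (by positivity)]
    intro i
    fin_cases i
    · refine le_trans (le_of_eq ?_) c0
      rw [Real.norm_eq_abs]
      congr 1
      simp [L, -Int.self_sub_floor, Int.fract]; ring
    · refine le_trans (le_of_eq ?_) c1
      rw [Real.norm_eq_abs]
      congr 1
      simp [L, -Int.self_sub_floor, Int.fract]; ring

lemma es_pos {T : Matrix (Fin 2) (Fin 2) ℝ} (hT : IntIndep T) (w : Fin 4 → ℤ) (hw : w ≠ 0) :
    0 < ‖es T w‖ := by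
  rw [norm_pos_iff]
  intro h
  apply hw
  have e0 := congrFun h 0
  have e1 := congrFun h 1
  simp only [es_zero, es_one, Pi.zero_apply] at e0 e1
  have a := hT (-(w 2)) (w 0) (w 1) 0 0 (by push_cast; linear_combination e0)
  have b := hT (-(w 3)) 0 0 (w 0) (w 1) (by push_cast; linear_combination e1)
  ext i; fin_cases i
  · exact a.2.1
  · exact a.2.2.1
  · simpa using a.1
  · simpa using b.1

/-- minimal points -/
def Good (T : Matrix (Fin 2) (Fin 2) ℝ) (w : Fin 4 → ℤ) : Prop :=
  w ≠ 0 ∧ ∀ u, u ≠ 0 → ‖xs u‖ ≤ ‖xs w‖ → ‖es T w‖ ≤ ‖es T u‖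

lemma finite_box (T : Matrix (Fin 2) (Fin 2) ℝ) (R S : ℝ) :
    {w : Fin 4 → ℤ | ‖xs w‖ ≤ R ∧ ‖es T w‖ ≤ S}.Finite := by
  set B : ℝ := R + S + (|T 0 0| + |T 0 1|) * R + (|T 1 0| + |T 1 1|) * R with hB
  apply (Set.finite_Icc (fun _ : Fin 4 => -⌈B⌉) (fun _ => ⌈B⌉)).subset
  rintro w ⟨h1, h2⟩
  have x0 := (xs_le w 0).trans h1
  have x1 := (xs_le w 1).trans h1
  have y0 := (es_le (T := T) w 0).trans h2
  have y1 := (es_le (T := T) w 1).trans h2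
  simp only [xs_zero, xs_one, es_zero, es_one] at x0 x1 y0 y1
  have hR : 0 ≤ R := (abs_nonneg _).trans x0
  have hS : 0 ≤ S := (abs_nonneg _).trans y0
  have m : ∀ (c : ℝ) (v : ℤ), |(v:ℝ)| ≤ R → |c * v| ≤ |c| * R := by
    intro c v hv
    rw [abs_mul]; gcongr
  have m00 := m (T 0 0) _ x0
  have m01 := m (T 0 1) _ x1
  have m10 := m (T 1 0) _ x0
  have m11 := m (T 1 1) _ x1
  have p00 := (abs_nonneg _).trans m00
  have p01 := (abs_nonneg _).trans m01
  have p10 := (abs_nonneg _).trans m10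
  have p11 := (abs_nonneg _).trans m11
  have key : ∀ i, |(w i : ℝ)| ≤ B := by
    intro i
    rw [hB]
    rw [abs_le] at *
    fin_cases i <;> constructor <;> simp <;> linarith
  constructor
  · intro i
    have := (abs_le.1 (key i)).1
    have h3 : ((-⌈B⌉ : ℤ) : ℝ) ≤ w i := by push_cast; linarith [Int.le_ceil B]
    exact_mod_cast h3
  · intro i
    have := (abs_le.1 (key i)).2
    have h3 : (w i : ℝ) ≤ ⌈B⌉ := by linarith [Int.le_ceil B]
    exact_mod_cast h3

lemma Good.next {T : Matrix (Fin 2) (Fin 2) ℝ} (hT : IntIndep T) {w : Fin 4 → ℤ} (hw : Good T w) :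
    ∃ u, Good T u ∧ ‖xs w‖ < ‖xs u‖ ∧ ‖es T u‖ < ‖es T w‖ ∧
      ∀ v, ‖xs v‖ < ‖xs u‖ → ‖es T v‖ < ‖es T w‖ → v = 0 := by
  classical
  have hex : ∃ n : ℕ, ∃ u : Fin 4 → ℤ, u ≠ 0 ∧ ‖xs u‖ = n ∧ ‖es T u‖ < ‖es T w‖ := by
    obtain ⟨n, hn⟩ := exists_nat_one_div_lt (es_pos hT w hw.1)
    obtain ⟨u, hu, _, hu2⟩ := dirichlet T (n+1) (Nat.succ_pos n)
    refine ⟨_, u, ?_, xs_norm u, ?_⟩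
    · rintro rfl; exact hu (map_zero _)
    · push_cast at hu2; linarith
  set N := Nat.find hex with hN
  obtain ⟨u0, hu0, hu0N, hu0E⟩ := Nat.find_spec hex
  have hmin : ∀ v : Fin 4 → ℤ, v ≠ 0 → ‖es T v‖ < ‖es T w‖ → (N:ℝ) ≤ ‖xs v‖ := by
    intro v hv hvE
    rw [xs_norm]
    exact_mod_cast Nat.find_min' hex ⟨v, hv, xs_norm v, hvE⟩
  let S : Set (Fin 4 → ℤ) := {v | v ≠ 0 ∧ ‖xs v‖ = N ∧ ‖es T v‖ < ‖es T w‖}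
  have hS : S.Finite := (finite_box T N ‖es T w‖).subset (fun v hv => ⟨hv.2.1.le, hv.2.2.le⟩)
  obtain ⟨u, huS, hu⟩ := S.exists_min_image (fun v => ‖es T v‖) hS ⟨u0, hu0, hu0N, hu0E⟩
  obtain ⟨hu1, hu2, hu3⟩ := huS
  refine ⟨u, ⟨hu1, ?_⟩, ?_, hu3, ?_⟩
  · intro v hv hvX
    by_contra hlt
    push Not at hlt
    have h1 := hmin v hv (hlt.trans hu3)
    have := hu v ⟨hv, le_antisymm (hvX.trans hu2.le) h1, hlt.trans hu3⟩
    linarith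
  · by_contra hle
    push Not at hle
    have := hw.2 u hu1 hle
    linarith
  · intro v hv1 hv2
    by_contra hv
    have := hmin v hv hv2
    linarith

lemma exists_minSeq {T : Matrix (Fin 2) (Fin 2) ℝ} (hT : IntIndep T) :
    ∃ z : ℕ → Fin 4 → ℤ, MinSeq T z := by
  have h0 : Good T ![0, 0, 1, 0] := by
    refine ⟨fun h => by simpa using congrFun h 2, ?_⟩
    intro u hu hx
    have e : ‖xs (![0, 0, 1, 0] : Fin 4 → ℤ)‖ = 0 := by rw [xs_norm]; simp
    rw [e] at hx
    have x0 := abs_nonpos_iff.1 ((xs_le u 0).trans hx)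
    have x1 := abs_nonpos_iff.1 ((xs_le u 1).trans hx)
    have y0 := es_le (T := T) u 0
    have y1 := es_le (T := T) u 1
    simp only [xs_zero, xs_one, es_zero, es_one] at x0 x1 y0 y1
    rw [x0, x1] at y0 y1
    simp only [mul_zero, add_zero, zero_sub, abs_neg] at y0 y1
    have hge : 1 ≤ ‖es T u‖ := by
      by_contra hlt
      push Not at hlt
      apply hu
      ext i; fin_cases i
      · exact_mod_cast x0
      · exact_mod_cast x1
      · exact int_zero_of_abs (lt_of_le_of_lt y0 hlt)
      · exact int_zero_of_abs (lt_of_le_of_lt y1 hlt)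
    refine le_trans ?_ hge
    rw [pi_norm_le_iff_of_nonneg zero_le_one]
    intro i; fin_cases i <;> simp
  choose! nx hnx using fun (w : Fin 4 → ℤ) (hw : Good T w) => hw.next hT
  let z : ℕ → Fin 4 → ℤ := fun k => Nat.rec ![0, 0, 1, 0] (fun _ w => nx w) k
  have hz : ∀ k, Good T (z k) := by
    intro k
    induction k with
    | zero => exact h0
    | succ k ih => exact (hnx _ ih).1
  exact ⟨z, fun k => (hnx _ (hz k)).2.1, fun k => (hnx _ (hz k)).2.2.1,
    fun k => (hnx _ (hz k)).2.2.2⟩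

lemma MinSeq.tendsto {T : Matrix (Fin 2) (Fin 2) ℝ} {z : ℕ → Fin 4 → ℤ} (h : MinSeq T z) :
    Tendsto (fun k => ‖xs (z k)‖) atTop atTop := by
  have hm : StrictMono (fun k => max (z k 0).natAbs (z k 1).natAbs) := by
    apply strictMono_nat_of_lt_succ
    intro k
    have := h.hX k
    rw [xs_norm, xs_norm] at this
    exact_mod_cast this
  have := tendsto_natCast_atTop_atTop (R := ℝ) |>.comp hm.tendsto_atTop
  refine this.congr fun k => ?_
  rw [xs_norm]; rfl

lemma one_mem (T : Matrix (Fin 2) (Fin 2) ℝ) : (1:ℝ) ∈ uniformExps T := by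
  refine ⟨one_pos, ?_⟩
  refine lt_of_le_of_lt (limsup_le_of_le (a := ENNReal.ofReal 2) (by isBoundedDefault) ?_)
    ENNReal.ofReal_lt_top
  filter_upwards [eventually_ge_atTop (1:ℝ)] with t ht
  have hN : 0 < ⌊t⌋₊ := Nat.floor_pos.2 ht
  obtain ⟨w, h1, h2, h3⟩ := dirichlet T ⌊t⌋₊ hN
  have ht0 : 0 ≤ t := by linarith
  have hp := psi_le T t w h1 (h2.trans (Nat.floor_le ht0))
  calc ENNReal.ofReal (t ^ (1:ℝ)) * psiFn T t ≤ ENNReal.ofReal t * ENNReal.ofReal ‖es T w‖ := by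
        rw [Real.rpow_one]; gcongr
    _ = ENNReal.ofReal (t * ‖es T w‖) := (ENNReal.ofReal_mul ht0).symm
    _ ≤ ENNReal.ofReal 2 := by
        apply ENNReal.ofReal_le_ofReal
        have hN' : (1:ℝ) ≤ ⌊t⌋₊ := by exact_mod_cast hN
        have := Nat.lt_floor_add_one t
        calc t * ‖es T w‖ ≤ (2 * ⌊t⌋₊) * (1 / ⌊t⌋₊) := by
              gcongr; linarith
          _ = 2 := by field_simp

lemma one_mem' (T : Matrix (Fin 2) (Fin 2) ℝ) : (1:ℝ) ∈ individualExps T :=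
  ⟨one_pos, lt_of_le_of_lt (liminf_le_limsup) (one_mem T).2⟩

lemma core {T : Matrix (Fin 2) (Fin 2) ℝ} (hT : IntIndep T) (γ b : ℝ) (hγ : 1 < γ)
    (hu : γ ∈ uniformExps T) (hb : 0 < b) (hi : b ∉ individualExps T)
    (hlt : (b + γ - γ ^ 2) * (b - 1) < γ ^ 2 * (γ - 1)) : False := by
  obtain ⟨z, h⟩ := exists_minSeq hT
  have hX := h.tendsto
  have hX1 : Tendsto (fun k => ‖xs (z (k+1))‖) atTop atTop := hX.comp (tendsto_add_atTop_nat 1)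
  obtain ⟨c, hc1, _⟩ := ENNReal.lt_iff_exists_nnreal_btwn.1 hu.2
  have hev := eventually_lt_of_limsup_lt hc1
  refine h.contra hT hX γ b ((c + 1) * 2 ^ γ) hγ (by positivity) ?_ ?_ hlt
  · have := (hX1.atTop_div_const (show (0:ℝ) < 2 by norm_num)).eventually hev
    filter_upwards [this, hX1.eventually_gt_atTop 0] with k hk hk0
    set X := ‖xs (z (k+1))‖ with hXd
    have hle : ENNReal.ofReal ‖es T (z k)‖ ≤ psiFn T (X/2) := by
      apply le_psi
      intro w hw hwX
      by_contra hlt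
      push Not at hlt
      exact hw (h.hmin k w (by rw [← hXd]; linarith) hlt)
    have h2 : ENNReal.ofReal ((X/2) ^ γ * ‖es T (z k)‖) ≤ ENNReal.ofReal (c:ℝ) := by
      rw [ENNReal.ofReal_mul (by positivity), ENNReal.ofReal_coe_nnreal]
      exact (mul_le_mul_right hle _).trans hk.le
    have h3 : (X/2) ^ γ * ‖es T (z k)‖ ≤ c := (ENNReal.ofReal_le_ofReal_iff c.2).1 h2
    rw [Real.div_rpow hk0.le (by norm_num)] at h3
    rw [Real.rpow_neg hk0.le, ← div_eq_mul_inv, le_div_iff₀ (by positivity)]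
    have p2 : (0:ℝ) < 2 ^ γ := by positivity
    rw [div_mul_eq_mul_div, div_le_iff₀ p2] at h3
    nlinarith
  · have htop : liminf (fun t : ℝ => ENNReal.ofReal (t ^ b) * psiFn T t) atTop = ⊤ := by
      by_contra hne
      exact hi ⟨hb, lt_top_iff_ne_top.2 hne⟩
    have hev2 := eventually_lt_of_lt_liminf
      (show (1 : ℝ≥0∞) < liminf (fun t : ℝ => ENNReal.ofReal (t ^ b) * psiFn T t) atTop by
        rw [htop]; exact ENNReal.one_lt_top)
    filter_upwards [hX.eventually hev2, hX.eventually_gt_atTop 0] with k hk hk0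
    have hp := psi_le T ‖xs (z k)‖ (z k) (norm_pos_iff.1 hk0) le_rfl
    have h2 : (1 : ℝ≥0∞) ≤ ENNReal.ofReal (‖xs (z k)‖ ^ b * ‖es T (z k)‖) := by
      rw [ENNReal.ofReal_mul (by positivity)]
      exact hk.le.trans (mul_le_mul_right hp _)
    rw [ENNReal.one_le_ofReal] at h2
    rw [Real.rpow_neg hk0.le, inv_le_iff_one_le_mul₀ (by positivity), mul_comm]
    exact h2

lemma g3_one : g3 1 = 1 := by
  unfold g3
  have : Real.sqrt ((1 - 1) ^ 2 + 4 * 1 * (2 * 1 ^ 2 - 2 * 1 + 1)) = 2 := by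
    rw [show ((1:ℝ) - 1) ^ 2 + 4 * 1 * (2 * 1 ^ 2 - 2 * 1 + 1) = 2 ^ 2 by norm_num]
    exact Real.sqrt_sq (by norm_num)
  rw [this]; norm_num

lemma alg {a b : ℝ} (ha : 1 < a) (hb : 1 ≤ b) (h : b < a * g3 a) :
    (b + a - a ^ 2) * (b - 1) < a ^ 2 * (a - 1) := by
  rcases lt_or_ge b a with hba | hba
  · have h1 : b * (b - (a ^ 2 - a + 1)) < 0 := by
      apply mul_neg_of_pos_of_neg <;> nlinarith
    nlinarith [mul_nonneg (by linarith : (0:ℝ) ≤ a) (sq_nonneg (a - 1))]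
  · have e : a * g3 a = (1 - a + Real.sqrt ((1 - a) ^ 2 + 4 * a * (2 * a ^ 2 - 2 * a + 1))) / 2 := by
      unfold g3
      have : a ≠ 0 := by linarith
      field_simp
    rw [e] at h
    have h1 : 2 * b + a - 1 < Real.sqrt ((1 - a) ^ 2 + 4 * a * (2 * a ^ 2 - 2 * a + 1)) := by linarith
    rw [Real.lt_sqrt (by linarith)] at h1
    have h2 : a ^ 2 * a ≤ a ^ 2 * b := by gcongr
    nlinarith

lemma final {T : Matrix (Fin 2) (Fin 2) ℝ} (hT : IntIndep T) (hfin : alphaExp T ≠ ⊤) :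
    ENNReal.ofReal ((alphaExp T).toReal * g3 (alphaExp T).toReal) ≤ betaExp T := by
  have hα1 : 1 ≤ alphaExp T := by
    rw [← ENNReal.ofReal_one]
    exact le_sSup ⟨1, one_mem T, rfl⟩
  have hβ1 : 1 ≤ betaExp T := by
    rw [← ENNReal.ofReal_one]
    exact le_sSup ⟨1, one_mem' T, rfl⟩
  set a := (alphaExp T).toReal with had
  have haα : ENNReal.ofReal a = alphaExp T := ENNReal.ofReal_toReal hfin
  have ha1 : 1 ≤ a := by
    rw [← haα] at hα1
    exact ENNReal.one_le_ofReal.1 hα1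
  by_contra hcon
  push Not at hcon
  rcases ha1.eq_or_lt with h1 | h1
  · rw [← h1, g3_one, mul_one, ENNReal.ofReal_one] at hcon
    exact absurd hβ1 (not_le.2 hcon)
  have hβf : betaExp T ≠ ⊤ := ne_top_of_lt hcon
  set β := (betaExp T).toReal with hβd
  have hβ : ENNReal.ofReal β = betaExp T := ENNReal.ofReal_toReal hβf
  have hβ1' : 1 ≤ β := by
    rw [← hβ] at hβ1
    exact ENNReal.one_le_ofReal.1 hβ1
  rw [← hβ] at hcon
  have hlt : β < a * g3 a := by
    by_contra hle
    push Not at hle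
    exact absurd (ENNReal.ofReal_le_ofReal hle) (not_le.2 hcon)
  obtain ⟨b, hb1, hb2⟩ := exists_between hlt
  have hb : 1 ≤ b := by linarith
  have hi : b ∉ individualExps T := by
    intro hm
    have : ENNReal.ofReal b ≤ betaExp T := le_sSup ⟨b, hm, rfl⟩
    rw [← hβ, ENNReal.ofReal_le_ofReal_iff (by linarith)] at this
    linarith
  have hP := alg h1 hb hb2
  have hcont : ∀ᶠ x in nhds a, (b + x - x ^ 2) * (b - 1) < x ^ 2 * (x - 1) := by
    apply ContinuousAt.eventually_lt _ _ hP
    · fun_prop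
    · fun_prop
  obtain ⟨ε, hε, hball⟩ := Metric.eventually_nhds_iff.1 hcont
  have hmax : max 1 (a - ε) < a := max_lt h1 (by linarith)
  have hsup : ENNReal.ofReal (max 1 (a - ε)) < alphaExp T := by
    rw [← haα]
    exact (ENNReal.ofReal_lt_ofReal_iff (by linarith)).2 hmax
  obtain ⟨_, ⟨γ, hγ, rfl⟩, hγ2⟩ := lt_sSup_iff.1 hsup
  have hγ3 : max 1 (a - ε) < γ := (ENNReal.ofReal_lt_ofReal_iff hγ.1).1 hγ2
  have hγ4 : γ ≤ a := by
    have : ENNReal.ofReal γ ≤ alphaExp T := le_sSup ⟨γ, hγ, rfl⟩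
    rwa [← haα, ENNReal.ofReal_le_ofReal_iff (by linarith)] at this
  have hγ5 := (max_lt_iff.1 hγ3)
  refine core hT γ b hγ5.1 hγ (by linarith) hi (hball ?_)
  rw [Real.dist_eq, abs_lt]
  constructor <;> linarith

end JarnikAux

/-- **Theorem 4 (Moshchevitin).** For a 2×2 real matrix `Θ = (θ_j^i)` whose entries together
with `1` are linearly independent over `ℚ`, if `α(Θ)` is finite then
`β(Θ) ≥ α(Θ)·g₃(α(Θ))`. -/
theorem jarnik_improvement_m2_n2 (θ11 θ12 θ21 θ22 : ℝ)
    (hli : LinearIndependent ℚ ![(1 : ℝ), θ11, θ12, θ21, θ22])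
    (hfin : alphaExp !![θ11, θ12; θ21, θ22] ≠ ⊤) :
    ENNReal.ofReal
        ((alphaExp !![θ11, θ12; θ21, θ22]).toReal *
          g3 (alphaExp !![θ11, θ12; θ21, θ22]).toReal) ≤
      betaExp !![θ11, θ12; θ21, θ22] := by
  have hT : JarnikAux.IntIndep !![θ11, θ12; θ21, θ22] := by
    intro a b c d e h
    rw [Fintype.linearIndependent_iff] at hli
    have := hli ![(a:ℚ), b, c, d, e] (by
      simp [Fin.sum_univ_succ, Algebra.smul_def] at h ⊢
      linear_combination h)
    have h0 := this 0
    have h1 := this 1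
    have h2 := this 2
    have h3 := this 3
    have h4 := this 4
    simp at h0 h1 h2 h3 h4
    exact ⟨h0, h1, h2, h3, h4⟩
  exact JarnikAux.final hT hfin
end
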